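/- ∫_0^1 (2-t)[K(√t)]³ / (2(1-t)^{5/8} t^{1/4}) dt = (π³/8) · √(1+√2) (1+2√2) / (2^{5/2} (2+√2)⁴) · Γ(1/8)⁸ / (π³ Γ(1/4)⁴), i.e., equals √(1+√2)(1+2√2) Γ(1/8)⁸ / (8 · 2^{5/2} (2+√2)⁴ Γ(1/4)⁴). -/

import Mathlib

open Real MeasureTheory intervalIntegral Complex

/-- Complete elliptic integral of the first kind. -/
noncomputable def ellipticK (k : ℝ) : ℝ :=
  ∫ θ in (0:ℝ)..(π/2), (1 - k ^ 2 * Real.sin θ ^ 2) ^ (-(1/2 : ℝ))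

/-- Complete elliptic integral of the second kind. -/
noncomputable def ellipticE (k : ℝ) : ℝ :=
  ∫ θ in (0:ℝ)..(π/2), (1 - k ^ 2 * Real.sin θ ^ 2) ^ ((1/2 : ℝ))

/-- Legendre function of the first kind of degree ν : P_ν(1-2z) = ₂F₁(-ν, ν+1; 1; z). -/
noncomputable def legendreP (ν : ℂ) (x : ℂ) : ℂ :=
  ordinaryHypergeometric (-ν) (ν + 1) 1 ((1 - x) / 2)


lemma hda {f g : ℝ → ℝ} {f' g' x : ℝ} (h : HasDerivAt f f' x) (e1 : ∀ y, g y = f y) (e2 : g' = f') :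
    HasDerivAt g g' x := by
  have : g = f := funext e1
  rw [this, e2]; exact h

noncomputable def cf : ℕ → ℝ
  | 0 => 1
  | (n+1) => cf n * ((n:ℝ)^2 + n + 3/16) / ((n:ℝ)+1)^2

lemma cf_succ (n : ℕ) : ((n:ℝ)+1)^2 * cf (n+1) = ((n:ℝ)^2 + n + 3/16) * cf n := by
  have : ((n:ℝ)+1)^2 ≠ 0 := by positivity
  simp only [cf]; field_simp

lemma cf_pos (n : ℕ) : 0 < cf n := by
  induction n with
  | zero => simp [cf]
  | succ n ih => simp only [cf]; positivity

noncomputable def df : ℕ → ℝ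
  | 0 => 1
  | (n+1) => df n * ((n:ℝ) + 3/16) / ((n:ℝ)+1)

lemma df_pos (n : ℕ) : 0 < df n := by
  induction n with
  | zero => simp [df]
  | succ n ih => simp only [df]; positivity

lemma cf_le_df (n : ℕ) : cf n ≤ df n := by
  induction n with
  | zero => simp [df, cf]
  | succ n ih =>
    simp only [df, cf]
    rw [div_le_div_iff₀ (by positivity) (by positivity)]
    have h1 := (cf_pos n).le
    have hn : (0:ℝ) ≤ n := by positivity
    calc cf n * ((n:ℝ)^2 + n + 3/16) * (n+1) ≤ cf n * (((n:ℝ)+3/16) * (n+1)) * (n+1) := by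
            gcongr; nlinarith
      _ ≤ df n * (((n:ℝ)+3/16) * (n+1)) * (n+1) := by gcongr
      _ = _ := by ring

lemma df_le_one (n : ℕ) : df n ≤ 1 := by
  induction n with
  | zero => simp [df]
  | succ n ih =>
    simp only [df]
    rw [div_le_one (by positivity)]
    have h1 := (df_pos n).le
    have hn : (0:ℝ) ≤ n := by positivity
    nlinarith

lemma cf_le_one (n : ℕ) : cf n ≤ 1 := (cf_le_df n).trans (df_le_one n)

lemma summable_ps (c : ℕ → ℝ) (C : ℝ) (hc : ∀ n, |c n| ≤ C * ((n:ℝ)+1)) {x : ℝ} (hx : |x| < 1) :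
    Summable (fun n => c n * x^n) := by
  have h1 : Summable (fun n : ℕ => C * ((n:ℝ) * |x|^n) + C * |x|^n) := by
    have := summable_pow_mul_geometric_of_norm_lt_one 1 (r := |x|) (by simpa using hx)
    have h2 := summable_geometric_of_lt_one (abs_nonneg x) hx
    simp only [pow_one] at this
    exact (this.mul_left C).add (h2.mul_left C)
  refine Summable.of_norm_bounded h1 (fun n => ?_)
  rw [Real.norm_eq_abs, abs_mul, abs_pow]
  calc |c n| * |x|^n ≤ (C * ((n:ℝ)+1)) * |x|^n := mul_le_mul_of_nonneg_right (hc n) (by positivity)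
    _ = _ := by ring

lemma hasDerivAt_ps (c : ℕ → ℝ) (C : ℝ) (hc : ∀ n, |c n| ≤ C) {x : ℝ} (hx : |x| < 1) :
    HasDerivAt (fun x => ∑' n, c n * x^n) (∑' n : ℕ, ((n:ℝ)+1) * c (n+1) * x^n) x := by
  obtain ⟨r, hr1, hr2⟩ := exists_between hx
  have hr0 : 0 < r := (abs_nonneg x).trans_lt hr1
  have hC : 0 ≤ C := (abs_nonneg _).trans (hc 0)
  have hu : Summable (fun n : ℕ => C / r * ((n:ℝ) * r^n)) := by
    have := summable_pow_mul_geometric_of_norm_lt_one 1 (r := r) (by rwa [Real.norm_eq_abs, abs_of_pos hr0])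
    simp only [pow_one] at this
    exact this.mul_left _
  have hbd : ∀ (n : ℕ) (y : ℝ), y ∈ Metric.ball (0:ℝ) r → ‖c n * ((n:ℝ) * y^(n-1))‖ ≤ C / r * ((n:ℝ) * r^n) := by
    intro n y hy
    have hy' : |y| < r := by simpa using hy
    rcases n with _ | n
    · simp
    · rw [norm_mul, norm_mul, norm_pow, Real.norm_eq_abs, Real.norm_eq_abs, Real.norm_eq_abs, Nat.abs_cast]
      calc |c (n+1)| * (((n+1:ℕ):ℝ) * |y|^(n+1-1)) ≤ C * (((n+1:ℕ):ℝ) * r^(n+1-1)) := by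
            gcongr; exact hc _
        _ = _ := by rw [Nat.add_sub_cancel, pow_succ]; field_simp
  have key := hasDerivAt_tsum_of_isPreconnected (g := fun n x => c n * x^n)
    (g' := fun n y => c n * ((n:ℝ) * y^(n-1))) hu Metric.isOpen_ball
    (convex_ball (0:ℝ) r).isPreconnected
    (fun n y _ => (hasDerivAt_pow n y).const_mul (c n)) hbd
    (Metric.mem_ball_self hr0)
    (summable_ps c C (fun n => (hc n).trans (by nlinarith [(Nat.cast_nonneg n : (0:ℝ) ≤ (n:ℝ))])) (by simp))
    (y := x) (by simpa using hr1)
  have hs : Summable (fun n : ℕ => c n * ((n:ℝ) * x^(n-1))) :=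
    Summable.of_norm_bounded hu (fun n => hbd n x (by simpa using hr1))
  have e : (∑' n : ℕ, ((n:ℝ)+1) * c (n+1) * x^n) = ∑' n : ℕ, c n * ((n:ℝ) * x^(n-1)) := by
    rw [hs.tsum_eq_zero_add]
    simp only [Nat.cast_zero, zero_mul, mul_zero, zero_add, Nat.add_sub_cancel]
    refine tsum_congr (fun n => ?_)
    push_cast; ring
  rw [e]; exact key

noncomputable def FF (z : ℝ) : ℝ := ∑' n, cf n * z^n
noncomputable def FF' (z : ℝ) : ℝ := ∑' n : ℕ, ((n:ℝ)+1) * cf (n+1) * z^n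
noncomputable def GG (z : ℝ) : ℝ := z * (1 - z) * FF' z

lemma abs_cf_le (n : ℕ) : |cf n| ≤ 1 := by rw [abs_of_pos (cf_pos n)]; exact cf_le_one n

lemma FF_deriv {z : ℝ} (hz : |z| < 1) : HasDerivAt FF (FF' z) z := hasDerivAt_ps cf 1 abs_cf_le hz

lemma FF_summable {z : ℝ} (hz : |z| < 1) : Summable (fun n => cf n * z^n) :=
  summable_ps cf 1 (fun n => (abs_cf_le n).trans (by nlinarith [(Nat.cast_nonneg n : (0:ℝ) ≤ n)])) hz

lemma FF'_summable {z : ℝ} (hz : |z| < 1) : Summable (fun n : ℕ => ((n:ℝ)+1) * cf (n+1) * z^n) :=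
  summable_ps _ 1 (fun n => by
    rw [abs_mul, abs_of_nonneg (by positivity : (0:ℝ) ≤ (n:ℝ)+1)]
    nlinarith [abs_cf_le (n+1), (Nat.cast_nonneg n : (0:ℝ) ≤ n)]) hz

noncomputable def gf : ℕ → ℝ
  | 0 => 0
  | (n+1) => 3/16 * cf n / ((n:ℝ)+1)

lemma abs_gf_le (n : ℕ) : |gf n| ≤ 1 := by
  rcases n with _ | n
  · simp [gf]
  · have := (cf_pos n)
    have h1 := cf_le_one n
    simp only [gf]
    rw [abs_of_pos (by positivity), div_le_one (by positivity)]
    nlinarith [(Nat.cast_nonneg n : (0:ℝ) ≤ n)]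

lemma GG_eq {z : ℝ} (hz : |z| < 1) : GG z = ∑' n, gf n * z^n := by
  have hg := summable_ps gf 1 (fun n => (abs_gf_le n).trans (by nlinarith [(Nat.cast_nonneg n : (0:ℝ) ≤ n)])) hz
  have hF := FF'_summable hz
  -- ∑ n c_n z^n = z F'
  have hs2 : Summable (fun n : ℕ => (n:ℝ) * cf n * z^n) := by
    rw [← summable_nat_add_iff 1]
    refine (hF.mul_left z).congr (fun n => ?_)
    push_cast; ring
  have e1 : ∑' n : ℕ, (n:ℝ) * cf n * z^n = z * FF' z := by
    rw [hs2.tsum_eq_zero_add, FF', ← tsum_mul_left]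
    simp only [Nat.cast_zero, zero_mul, zero_add]
    refine tsum_congr (fun n => ?_)
    push_cast; ring
  have : GG z = z * FF' z - z * ∑' n : ℕ, (n:ℝ) * cf n * z^n := by rw [e1, GG]; ring
  rw [this, FF', ← tsum_mul_left, ← tsum_mul_left, ← Summable.tsum_sub (hF.mul_left z) (hs2.mul_left z), hg.tsum_eq_zero_add]
  simp only [gf, zero_mul, zero_add]
  refine tsum_congr (fun n => ?_)
  have h := cf_succ n
  have h1 : ((n:ℝ)+1) ≠ 0 := by positivity
  have h2 : ((n:ℝ)+1) * cf (n+1) = ((n:ℝ)^2 + n + 3/16) * cf n / ((n:ℝ)+1) := by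
    rw [eq_div_iff h1, ← h]; ring
  rw [h2]; field_simp; ring

lemma GG_deriv {z : ℝ} (hz : |z| < 1) : HasDerivAt GG (3/16 * FF z) z := by
  have := hasDerivAt_ps gf 1 abs_gf_le hz
  have e : ∑' n : ℕ, ((n:ℝ)+1) * gf (n+1) * z^n = 3/16 * FF z := by
    rw [FF, ← tsum_mul_left]
    refine tsum_congr (fun n => ?_)
    have h1 : ((n:ℝ)+1) ≠ 0 := by positivity
    simp only [gf]; field_simp
  rw [e] at this
  refine this.congr_of_eventuallyEq ?_
  have : ∀ᶠ y in nhds z, |y| < 1 := (continuous_abs.tendsto z).eventually (gt_mem_nhds hz)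
  filter_upwards [this] with y hy using GG_eq hy

lemma FF_zero : FF 0 = 1 := by
  rw [FF, tsum_eq_single 0]; · simp [cf]
  · intro n hn; simp [hn]

lemma FF_ge_one {z : ℝ} (h0 : 0 ≤ z) (hz : z < 1) : 1 ≤ FF z := by
  have := (FF_summable (z := z) (by rwa [abs_of_nonneg h0])).le_tsum 0 (fun n _ => mul_nonneg (cf_pos n).le (pow_nonneg h0 n))
  simpa [cf, FF] using this

/-- binomial series -/
noncomputable def bf (a : ℝ) : ℕ → ℝ
  | 0 => 1
  | (n+1) => bf a n * (a + n) / ((n:ℝ)+1)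

lemma bf_eq (a : ℝ) (n : ℕ) : Ring.choose (a + n - 1) n = bf a n := by
  rw [Ring.choose_eq_smul, Polynomial.descPochhammer_smeval_eq_ascPochhammer, Polynomial.ascPochhammer_smeval_eq_eval]
  have : a + n - 1 - n + 1 = a := by ring
  rw [this]
  induction n with
  | zero => simp [bf]
  | succ n ih =>
    rw [ascPochhammer_succ_eval]
    have ih' := ih (by ring)
    simp only [bf, ← ih', Nat.factorial_succ, smul_eq_mul, Nat.cast_mul, mul_inv]
    have h1 : ((n:ℝ)+1) ≠ 0 := by positivity
    push_cast
    field_simp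

lemma hasSum_binom (a : ℝ) {x : ℝ} (hx : |x| < 1) : HasSum (fun n => bf a n * x^n) ((1-x)^(-a)) := by
  have h := (Real.one_div_one_sub_rpow_hasFPowerSeriesOnBall_zero a).hasSum (y := x)
    (by simpa [Metric.eball_coe, enorm_eq_nnnorm] using (by exact_mod_cast hx : ‖x‖₊ < 1))
  have h2 : (1-x)^(-a) = 1 / (1 - (0 + x))^a := by
    rw [zero_add, Real.rpow_neg (by linarith [le_abs_self x]), one_div]
  rw [h2]
  have e : (fun n => bf a n * x^n) = fun n => (FormalMultilinearSeries.ofScalars ℝ (fun n : ℕ => Ring.choose (a + (n:ℝ) - 1) n) n) fun _ => x := by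
    funext n
    rw [FormalMultilinearSeries.ofScalars_apply_eq, smul_eq_mul, bf_eq]
  rw [e]; exact h
 
lemma bf_pos {a : ℝ} (ha : 0 < a) (n : ℕ) : 0 < bf a n := by
  induction n with
  | zero => simp [bf]
  | succ n ih => simp only [bf]; positivity

lemma df_eq (n : ℕ) : df n = bf (3/16) n := by
  induction n with
  | zero => simp [df, bf]
  | succ n ih => simp only [df, bf, ih]; ring

lemma cf_eq (n : ℕ) : cf n = bf (3/4) n * bf (1/4) n := by
  induction n with
  | zero => simp [cf, bf]
  | succ n ih => simp only [cf, bf, ih]; field_simp; ring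

lemma FF_le {z : ℝ} (h0 : 0 ≤ z) (hz : z < 1) : FF z ≤ (1-z)^(-(3/16:ℝ)) := by
  have hz' : |z| < 1 := by rwa [abs_of_nonneg h0]
  have h := hasSum_binom (3/16) hz'
  rw [← h.tsum_eq]
  refine (FF_summable hz').tsum_le_tsum (fun n => ?_) h.summable
  rw [← df_eq]
  have := cf_le_df n
  gcongr

lemma FF'_le {z : ℝ} (h0 : 0 ≤ z) (hz : z < 1) : FF' z ≤ (1-z)^(-(19/16:ℝ)) := by
  have hz' : |z| < 1 := by rwa [abs_of_nonneg h0]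
  have h := hasSum_binom (19/16) hz'
  rw [← h.tsum_eq]
  refine (FF'_summable hz').tsum_le_tsum (fun n => ?_) h.summable
  gcongr
  have key : ∀ n : ℕ, ((n:ℝ)+1) * df (n+1) ≤ bf (19/16) n := by
    intro n
    induction n with
    | zero => simp [df, bf]; norm_num
    | succ n ih =>
      simp only [df, bf] at ih ⊢
      have h1 : ((n:ℝ)+1) ≠ 0 := by positivity
      have h2 : ((n:ℝ)+1+1) ≠ 0 := by positivity
      push_cast
      have e1 : ((n:ℝ)+1) * (df n * (n + 3/16) / (n+1)) = df n * (n+3/16) := by field_simp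
      have e2 : ((n:ℝ)+1+1) * (df n * (n + 3/16) / (n+1) * (n+1+3/16)/(n+1+1)) = df n * (n+3/16) * (n + 19/16) / (n+1) := by field_simp; ring
      rw [e1] at ih
      rw [e2, add_comm (19/16:ℝ)]
      gcongr
  refine le_trans ?_ (key n)
  have := cf_le_df (n+1)
  gcongr

lemma FF'_nonneg {z : ℝ} (h0 : 0 ≤ z) : 0 ≤ FF' z :=
  tsum_nonneg (fun n => mul_nonneg (mul_nonneg (by positivity) (cf_pos _).le) (pow_nonneg h0 n))


noncomputable def Qp (N : ℕ) (a b : ℝ) : ℝ :=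
  ∑ ij ∈ Finset.HasAntidiagonal.antidiagonal N, ((N.choose ij.1 : ℝ))^2 * (a^ij.1 * b^ij.2)

noncomputable def qd (N : ℕ) (Y X : ℝ) : ℝ :=
  ∑ ij ∈ Finset.HasAntidiagonal.antidiagonal N, ((N.choose ij.1 : ℝ))^2 * ((1-Y)^ij.1 * Y^ij.2) *
    ((ij.1:ℝ) * X^(ij.1-1) * (1-X)^ij.2 - (ij.2:ℝ) * X^ij.1 * (1-X)^(ij.2-1))

noncomputable def qe (N : ℕ) (Y X : ℝ) : ℝ :=
  ∑ ij ∈ Finset.HasAntidiagonal.antidiagonal N, ((N.choose ij.1 : ℝ))^2 * ((1-Y)^ij.1 * Y^ij.2) *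
    ((ij.1:ℝ) * (X^ij.1 * (1-X)^(ij.2+1)) - (ij.2:ℝ) * (X^(ij.1+1) * (1-X)^ij.2))

lemma q_deriv (N : ℕ) (Y X : ℝ) : HasDerivAt (fun X => Qp N (X*(1-Y)) (Y*(1-X))) (qd N Y X) X := by
  unfold Qp qd
  refine HasDerivAt.fun_sum (fun ij _ => ?_)
  have h := ((hasDerivAt_pow ij.1 X).mul (((hasDerivAt_id X).const_sub 1).pow ij.2)).const_mul
    (((N.choose ij.1 : ℝ))^2 * ((1-Y)^ij.1 * Y^ij.2))
  refine hda h ?_ ?_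
  · intro x; simp only [mul_pow, Pi.mul_apply, Pi.pow_apply, id]; ring
  · simp only [Pi.pow_apply, id]; ring

lemma qe_eq (N : ℕ) (Y X : ℝ) : qe N Y X = X * (1-X) * qd N Y X := by
  unfold qe qd
  rw [Finset.mul_sum]
  refine Finset.sum_congr rfl (fun ij _ => ?_)
  obtain ⟨i, j⟩ := ij
  simp only
  rcases i with _ | i <;> rcases j with _ | j <;> simp <;> ring

lemma sumi (M : ℕ) (f : ℕ → ℕ → ℝ) :
    ∑ ij ∈ Finset.HasAntidiagonal.antidiagonal (M+1), (((M+1).choose ij.1 : ℝ))^2 * ((ij.1:ℝ)^2 * f (ij.1-1) ij.2)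
     = ((M:ℝ)+1)^2 * ∑ ij ∈ Finset.HasAntidiagonal.antidiagonal M, ((M.choose ij.1 : ℝ))^2 * f ij.1 ij.2 := by
  rw [Finset.Nat.sum_antidiagonal_succ, Finset.mul_sum]
  simp only [Nat.cast_zero, ne_eq, OfNat.ofNat_ne_zero, not_false_eq_true, zero_pow, zero_mul, mul_zero, zero_add]
  refine Finset.sum_congr rfl (fun ij _ => ?_)
  have h : ((M:ℝ)+1) * (M.choose ij.1) = ((M+1).choose (ij.1+1)) * ((ij.1:ℝ)+1) := by
    exact_mod_cast Nat.add_one_mul_choose_eq M ij.1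
  simp only [Nat.add_sub_cancel]
  push_cast
  rw [← mul_assoc, ← mul_assoc, ← mul_pow, ← mul_pow, h]

lemma sumj (M : ℕ) (f : ℕ → ℕ → ℝ) :
    ∑ ij ∈ Finset.HasAntidiagonal.antidiagonal (M+1), (((M+1).choose ij.1 : ℝ))^2 * ((ij.2:ℝ)^2 * f ij.1 (ij.2-1))
     = ((M:ℝ)+1)^2 * ∑ ij ∈ Finset.HasAntidiagonal.antidiagonal M, ((M.choose ij.1 : ℝ))^2 * f ij.1 ij.2 := by
  rw [Finset.Nat.sum_antidiagonal_succ', Finset.mul_sum]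
  simp only [Nat.cast_zero, ne_eq, OfNat.ofNat_ne_zero, not_false_eq_true, zero_pow, zero_mul, mul_zero, zero_add]
  refine Finset.sum_congr rfl (fun ij hij => ?_)
  have hM : ij.1 + ij.2 = M := by simpa using hij
  have h : ((M:ℝ)+1) * (M.choose ij.1) = ((M+1).choose (ij.1)) * ((ij.2:ℝ)+1) := by
    have := Nat.choose_mul_succ_eq M ij.1
    have e : M + 1 - ij.1 = ij.2 + 1 := by omega
    rw [e] at this
    rw [mul_comm]
    exact_mod_cast this
  simp only [Nat.add_sub_cancel]
  push_cast
  rw [← mul_assoc, ← mul_assoc, ← mul_pow, ← mul_pow, h]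

lemma qe_deriv (M : ℕ) (Y X : ℝ) : HasDerivAt (qe (M+1) Y)
    (((M:ℝ)+1)^2 * Qp M (X*(1-Y)) (Y*(1-X)) - ((M:ℝ)+1)*((M:ℝ)+2) * Qp (M+1) (X*(1-Y)) (Y*(1-X))) X := by
  have h : HasDerivAt (qe (M+1) Y) (∑ ij ∈ Finset.HasAntidiagonal.antidiagonal (M+1), (((M+1).choose ij.1 : ℝ))^2 * ((1-Y)^ij.1 * Y^ij.2) *
    ((ij.1:ℝ) * ((ij.1:ℝ) * X^(ij.1-1) * (1-X)^(ij.2+1) - ((ij.2:ℝ)+1) * X^ij.1 * (1-X)^ij.2) - (ij.2:ℝ) *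
      (((ij.1:ℝ)+1) * X^ij.1 * (1-X)^ij.2 - (ij.2:ℝ) * X^(ij.1+1) * (1-X)^(ij.2-1)))) X := by
    unfold qe
    refine HasDerivAt.fun_sum (fun ij _ => ?_)
    have h1 := ((hasDerivAt_pow ij.1 X).mul (((hasDerivAt_id X).const_sub 1).pow (ij.2+1))).const_mul (ij.1:ℝ)
    have h2 := ((hasDerivAt_pow (ij.1+1) X).mul (((hasDerivAt_id X).const_sub 1).pow (ij.2))).const_mul (ij.2:ℝ)
    have h := (h1.sub h2).const_mul
      (((M+1).choose ij.1 : ℝ)^2 * ((1-Y)^ij.1 * Y^ij.2))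
    refine hda h (fun x => ?_) ?_
    · simp only [Pi.pow_apply, Pi.mul_apply, Pi.sub_apply, id]
    simp only [Pi.pow_apply, id, Nat.add_sub_cancel]; push_cast; ring
  refine hda h (fun _ => rfl) ?_
  have e1 := sumi M (fun i j => (X*(1-Y))^i * (Y*(1-X))^j)
  have e2 := sumj M (fun i j => (X*(1-Y))^i * (Y*(1-X))^j)
  unfold Qp
  set S := ∑ ij ∈ Finset.HasAntidiagonal.antidiagonal M, ((M.choose ij.1 : ℝ))^2 * ((X*(1-Y))^ij.1 * (Y*(1-X))^ij.2) with hS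
  have : ((M:ℝ)+1)^2 * S = (1-X)*(1-Y) * (((M:ℝ)+1)^2 * S) + X*(1-Y)*(((M:ℝ)+1)^2 * S) + X*Y*(((M:ℝ)+1)^2 * S)
     + Y*(1-X)*(((M:ℝ)+1)^2 * S) := by ring
  rw [this]
  nth_rewrite 1 [← e1]
  nth_rewrite 1 [← e1]
  nth_rewrite 1 [← e2]
  rw [← e2]
  simp only [Finset.mul_sum]
  rw [← Finset.sum_add_distrib, ← Finset.sum_add_distrib, ← Finset.sum_add_distrib, ← Finset.sum_sub_distrib]
  refine Finset.sum_congr rfl (fun ij hij => ?_)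
  obtain ⟨i, j⟩ := ij
  have hM : (i:ℝ) + j = M + 1 := by
    have : i + j = M + 1 := by simpa using hij
    exact_mod_cast this
  have hM' : (M:ℝ) = i + j - 1 := by linarith
  simp only [hM']
  rcases i with _ | i <;> rcases j with _ | j
  · simp
  · simp [mul_pow]; ring
  · simp [mul_pow]; ring
  · simp [mul_pow]; ring

lemma Qp_nonneg {N : ℕ} {a b : ℝ} (ha : 0 ≤ a) (hb : 0 ≤ b) : 0 ≤ Qp N a b :=
  Finset.sum_nonneg (fun _ _ => by positivity)

lemma Qp_le {N : ℕ} {a b : ℝ} (ha : 0 ≤ a) (hb : 0 ≤ b) : Qp N a b ≤ ((√a + √b)^2)^N := by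
  have h : (√a + √b)^N = ∑ ij ∈ Finset.HasAntidiagonal.antidiagonal N, (N.choose ij.1 : ℝ) * (√a^ij.1 * √b^ij.2) := by
    have := (Commute.all (√a) (√b)).add_pow' N
    simpa using this
  rw [← pow_mul, mul_comm 2 N, pow_mul, h, Qp]
  have : ∀ ij ∈ Finset.HasAntidiagonal.antidiagonal N, 0 ≤ (N.choose ij.1 : ℝ) * (√a^ij.1 * √b^ij.2) := fun _ _ => by positivity
  refine le_trans (le_of_eq ?_) (Finset.sum_sq_le_sq_sum_of_nonneg this)
  refine Finset.sum_congr rfl (fun ij _ => ?_)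
  rw [mul_pow, mul_pow, ← pow_mul, ← pow_mul, mul_comm _ 2, mul_comm _ 2, pow_mul, pow_mul, Real.sq_sqrt ha, Real.sq_sqrt hb]

lemma Qp_zero (N : ℕ) (b : ℝ) : Qp N 0 b = b^N := by
  rw [Qp, Finset.sum_eq_single (0, N)]
  · simp
  · rintro ⟨i, j⟩ h1 h2
    have : i ≠ 0 := by
      rintro rfl
      apply h2
      simpa using h1
    simp [this]
  · simp


noncomputable def SM (M : ℕ) (Y X : ℝ) : ℝ := ∑ N ∈ Finset.range (M+1), cf N * Qp N (X*(1-Y)) (Y*(1-X))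
noncomputable def SMd (M : ℕ) (Y X : ℝ) : ℝ := ∑ N ∈ Finset.range (M+1), cf N * qd N Y X
noncomputable def SMe (M : ℕ) (Y X : ℝ) : ℝ := ∑ N ∈ Finset.range (M+1), cf N * qe N Y X

lemma SM_deriv (M : ℕ) (Y X : ℝ) : HasDerivAt (SM M Y) (SMd M Y X) X := by
  unfold SM SMd
  exact HasDerivAt.fun_sum (fun N _ => (q_deriv N Y X).const_mul _)

lemma SMe_eq (M : ℕ) (Y X : ℝ) : SMe M Y X = X * (1-X) * SMd M Y X := by
  unfold SMe SMd
  rw [Finset.mul_sum]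
  refine Finset.sum_congr rfl (fun N _ => ?_)
  rw [qe_eq]; ring

lemma SMe_deriv (M : ℕ) (Y X : ℝ) : HasDerivAt (SMe M Y)
    (3/16 * SM M Y X - ((M:ℝ)+1)^2 * cf (M+1) * Qp M (X*(1-Y)) (Y*(1-X))) X := by
  induction M with
  | zero =>
    have h1 : ∀ x, SMe 0 Y x = 0 := by
      intro x; simp [SMe, qe]
    refine hda (hasDerivAt_const X (0:ℝ)) h1 ?_
    simp [SM, Qp, cf]
  | succ M ih =>
    have h := ih.add ((qe_deriv M Y X).const_mul (cf (M+1)))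
    refine hda h (fun x => ?_) ?_
    · simp [SMe, Finset.sum_range_succ _ (M+1)]
    · have e : SM (M+1) Y X = SM M Y X + cf (M+1) * Qp (M+1) (X*(1-Y)) (Y*(1-X)) := by
        simp [SM, Finset.sum_range_succ _ (M+1)]
      have hc := cf_succ (M+1)
      push_cast at hc ⊢
      rw [e, hc]; ring

lemma rho_lt {X Y : ℝ} (hX : 0 ≤ X) (hY : 0 ≤ Y) (h : X + Y < 1) :
    (√(X*(1-Y)) + √(Y*(1-X)))^2 < 1 := by
  have ha : 0 ≤ X*(1-Y) := mul_nonneg hX (by linarith)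
  have hb : 0 ≤ Y*(1-X) := mul_nonneg hY (by linarith)
  have e : (√(X*(1-Y)) + √(Y*(1-X)))^2 = X*(1-Y) + Y*(1-X) + 2 * √(X*(1-Y) * (Y*(1-X))) := by
    rw [Real.sqrt_mul ha, add_sq, Real.sq_sqrt ha, Real.sq_sqrt hb]; ring
  rw [e]
  have : √(X*(1-Y) * (Y*(1-X))) < (1 - X*(1-Y) - Y*(1-X))/2 := by
    rw [Real.sqrt_lt' (by nlinarith [mul_nonneg hX hY])]
    nlinarith [mul_pos (sub_pos.2 h) (sub_pos.2 h)]
  linarith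

lemma prod_formula {X Y : ℝ} (hX : 0 ≤ X) (hY : 0 ≤ Y) (h : X + Y < 1) :
    HasSum (fun N => cf N * Qp N (X*(1-Y)) (Y*(1-X))) (FF X * FF Y) := by
  have hX1 : X < 1 := by linarith
  have hY1 : Y < 1 := by linarith
  -- uniform rho
  obtain ⟨ρ, hρ0, hρ1, hρ⟩ : ∃ ρ : ℝ, 0 ≤ ρ ∧ ρ < 1 ∧ ∀ x ∈ Set.Icc 0 X, (√(x*(1-Y)) + √(Y*(1-x)))^2 ≤ ρ := by
    have hc : ContinuousOn (fun x => (√(x*(1-Y)) + √(Y*(1-x)))^2) (Set.Icc 0 X) := by fun_prop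
    obtain ⟨x, hx, hmax⟩ := isCompact_Icc.exists_isMaxOn (Set.nonempty_Icc.2 hX) hc
    exact ⟨_, by positivity, rho_lt hx.1 hY (by linarith [hx.2]), fun y hy => hmax hy⟩
  have hQ : ∀ N : ℕ, ∀ x ∈ Set.Icc 0 X, |Qp N (x*(1-Y)) (Y*(1-x))| ≤ ρ^N := by
    intro N x hx
    have ha : 0 ≤ x*(1-Y) := mul_nonneg hx.1 (by linarith)
    have hb : 0 ≤ Y*(1-x) := mul_nonneg hY (by linarith [hx.2])
    rw [abs_of_nonneg (Qp_nonneg ha hb)]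
    exact (Qp_le ha hb).trans (pow_le_pow_left₀ (by positivity) (hρ x hx) N)
  have hFmono : ∀ x ∈ Set.Icc 0 X, |FF x| ≤ FF X := by
    intro x hx
    have hx1 : x < 1 := by linarith [hx.2]
    rw [abs_of_nonneg (by linarith [FF_ge_one hx.1 hx1])]
    refine (FF_summable (by rw [abs_of_nonneg hx.1]; exact hx1)).tsum_le_tsum (fun n => ?_) (FF_summable (by rw [abs_of_nonneg hX]; exact hX1))
    have := cf_pos n
    have := hx.1
    have := hx.2
    gcongr
  have hFX : 1 ≤ FF X := FF_ge_one hX hX1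
  have hbound : ∀ M : ℕ, |SM M Y X / FF X - SM M Y 0 / FF 0| ≤ (((M:ℝ)+1)^2 * ρ^M) * (FF X / (1-X) * X) := by
    intro M
    set B := ((M:ℝ)+1)^2 * ρ^M * FF X with hB
    have hB0 : 0 ≤ B := by positivity
    have hW : ∀ x ∈ Set.Icc 0 X, |SMe M Y x * FF x - SM M Y x * GG x| ≤ B * x := by
      intro x hx
      have hd : ∀ y ∈ Set.Icc 0 x, HasDerivWithinAt (fun y => SMe M Y y * FF y - SM M Y y * GG y)
          (-(((M:ℝ)+1)^2 * cf (M+1) * Qp M (y*(1-Y)) (Y*(1-y)) * FF y)) (Set.Icc 0 x) y := by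
        intro y hy
        have hy1 : |y| < 1 := by rw [abs_of_nonneg hy.1]; linarith [hy.2, hx.2]
        refine HasDerivAt.hasDerivWithinAt ?_
        refine hda (((SMe_deriv M Y y).mul (FF_deriv hy1)).sub ((SM_deriv M Y y).mul (GG_deriv hy1))) (fun _ => rfl) ?_
        rw [SMe_eq, GG]; ring
      have := Convex.norm_image_sub_le_of_norm_hasDerivWithin_le (C := B) hd (fun y hy => ?_) (convex_Icc 0 x)
        (Set.left_mem_Icc.2 hx.1) (Set.right_mem_Icc.2 hx.1)
      · have e0 : SMe M Y 0 * FF 0 - SM M Y 0 * GG 0 = 0 := by rw [SMe_eq, GG]; ring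
        simp only [e0, sub_zero, Real.norm_eq_abs, abs_of_nonneg hx.1] at this
        exact this
      · have hy' : y ∈ Set.Icc 0 X := ⟨hy.1, hy.2.trans hx.2⟩
        rw [norm_neg, norm_mul, norm_mul, norm_mul, Real.norm_eq_abs, Real.norm_eq_abs, Real.norm_eq_abs, Real.norm_eq_abs, hB,
          abs_of_nonneg (by positivity : (0:ℝ) ≤ ((M:ℝ)+1)^2)]
        have h1 := abs_cf_le (M+1)
        have h2 := hQ M y hy'
        have h3 := hFmono y hy'
        calc ((M:ℝ)+1)^2 * |cf (M+1)| * |Qp M (y*(1-Y)) (Y*(1-y))| * |FF y| ≤ ((M:ℝ)+1)^2 * 1 * ρ^M * FF X := by gcongr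
          _ = _ := by ring
    have hd : ∀ y ∈ Set.Icc 0 X, HasDerivWithinAt (fun y => SM M Y y / FF y)
          ((SMd M Y y * FF y - SM M Y y * FF' y) / FF y ^ 2) (Set.Icc 0 X) y := by
      intro y hy
      have hy1 : y < 1 := by linarith [hy.2]
      have hF1 := FF_ge_one hy.1 hy1
      refine HasDerivAt.hasDerivWithinAt ?_
      exact (SM_deriv M Y y).fun_div (FF_deriv (by rwa [abs_of_nonneg hy.1])) (by linarith)
    rcases eq_or_lt_of_le hX with h0 | h0
    · rw [← h0]; simp
    obtain ⟨y, hy, hs⟩ := exists_hasDerivAt_eq_slope (fun y => SM M Y y / FF y)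
      (fun y => (SMd M Y y * FF y - SM M Y y * FF' y) / FF y ^ 2) h0
      (fun y hy => (hd y hy).continuousWithinAt)
      (fun y hy => (hd y ⟨hy.1.le, hy.2.le⟩).hasDerivAt (Icc_mem_nhds hy.1 hy.2))
    simp only [sub_zero] at hs
    rw [eq_div_iff h0.ne'] at hs
    rw [← hs, abs_mul, abs_of_pos h0, ← mul_assoc]
    refine mul_le_mul_of_nonneg_right ?_ h0.le
    have hy1 : y < 1 := by linarith [hy.2]
    have hF1 := FF_ge_one hy.1.le hy1
    have hW1 := hW y ⟨hy.1.le, hy.2.le⟩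
    have e : SMe M Y y * FF y - SM M Y y * GG y = (y * (1-y)) * (SMd M Y y * FF y - SM M Y y * FF' y) := by
      rw [SMe_eq, GG]; ring
    rw [e, abs_mul, abs_of_pos (mul_pos hy.1 (by linarith))] at hW1
    have h2 : (1-y) * |SMd M Y y * FF y - SM M Y y * FF' y| ≤ B := by
      refine le_of_mul_le_mul_left ?_ hy.1
      linarith
    have key : |SMd M Y y * FF y - SM M Y y * FF' y| ≤ B / (1-X) := by
      rw [le_div_iff₀ (by linarith)]
      nlinarith [abs_nonneg (SMd M Y y * FF y - SM M Y y * FF' y), hy.2]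
    rw [abs_div, abs_of_pos (by positivity : 0 < FF y ^ 2)]
    refine (div_le_self (abs_nonneg _) (one_le_pow₀ hF1)).trans (key.trans (le_of_eq ?_))
    rw [hB]; ring
  have hsum : Summable (fun N => cf N * Qp N (X*(1-Y)) (Y*(1-X))) := by
    refine Summable.of_norm_bounded (summable_geometric_of_lt_one hρ0 hρ1) (fun N => ?_)
    rw [norm_mul, Real.norm_eq_abs, Real.norm_eq_abs]
    have h1 := abs_cf_le N
    have h2 := hQ N X (Set.right_mem_Icc.2 hX)
    calc _ ≤ 1 * ρ^N := by gcongr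
      _ = _ := one_mul _
  have t1 : Filter.Tendsto (fun M => SM M Y X) Filter.atTop (nhds (∑' N, cf N * Qp N (X*(1-Y)) (Y*(1-X)))) :=
    hsum.hasSum.tendsto_sum_nat.comp (Filter.tendsto_add_atTop_nat 1)
  have t2 : Filter.Tendsto (fun M => SM M Y 0) Filter.atTop (nhds (FF Y)) := by
    have h1 := (FF_summable (z := Y) (by rwa [abs_of_nonneg hY])).hasSum.tendsto_sum_nat.comp (Filter.tendsto_add_atTop_nat 1)
    refine h1.congr (fun M => ?_)
    simp [SM, Qp_zero]
  have t3 : Filter.Tendsto (fun M : ℕ => (((M:ℝ)+1)^2 * ρ^M) * (FF X / (1-X) * X)) Filter.atTop (nhds 0) := by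
    have a1 : Filter.Tendsto (fun M : ℕ => ((M:ℝ)^2 * ρ^M) + (2 * ((M:ℝ)^1 * ρ^M) + ρ^M)) Filter.atTop (nhds (0 + (2 * 0 + 0))) :=
      (tendsto_pow_const_mul_const_pow_of_lt_one 2 hρ0 hρ1).add
        (((tendsto_pow_const_mul_const_pow_of_lt_one 1 hρ0 hρ1).const_mul 2).add (tendsto_pow_atTop_nhds_zero_of_lt_one hρ0 hρ1))
    have a2 := a1.mul_const (FF X / (1-X) * X)
    simp only [mul_zero, add_zero, zero_mul] at a2
    refine a2.congr (fun M => ?_)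
    ring
  have t4 : Filter.Tendsto (fun M => SM M Y X / FF X - SM M Y 0 / FF 0) Filter.atTop (nhds 0) :=
    squeeze_zero_norm hbound t3
  have t5 := (t1.div_const (FF X)).sub (t2.div_const (FF 0))
  have hu := tendsto_nhds_unique t4 t5
  rw [FF_zero, div_one] at hu
  have : ∑' N, cf N * Qp N (X*(1-Y)) (Y*(1-X)) = FF X * FF Y := by
    have h1 : FF X ≠ 0 := by linarith
    field_simp at hu
    linarith
  rw [← this]
  exact hsum.hasSum

lemma Qp_smul (N : ℕ) (s a b : ℝ) : Qp N (s*a) (s*b) = s^N * Qp N a b := by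
  unfold Qp
  rw [Finset.mul_sum]
  refine Finset.sum_congr rfl (fun ij hij => ?_)
  have : ij.1 + ij.2 = N := by simpa using hij
  rw [← this]; ring

lemma abel_pos (a : ℕ → ℝ) (ha : ∀ n, 0 ≤ a n) (f : ℝ → ℝ) (L : ℝ)
    (hf : ∀ s ∈ Set.Ioo (0:ℝ) 1, HasSum (fun n => a n * s^n) (f s))
    (hL : Filter.Tendsto f (nhdsWithin 1 (Set.Ioo 0 1)) (nhds L)) : HasSum a L := by
  have hne : (nhdsWithin (1:ℝ) (Set.Ioo 0 1)).NeBot := by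
    rw [← mem_closure_iff_nhdsWithin_neBot, closure_Ioo (by norm_num)]; simp
  have hpart : ∀ n, ∑ i ∈ Finset.range n, a i ≤ L := by
    intro n
    have h1 : Filter.Tendsto (fun s : ℝ => ∑ i ∈ Finset.range n, a i * s^i) (nhdsWithin 1 (Set.Ioo 0 1))
        (nhds (∑ i ∈ Finset.range n, a i * 1^i)) :=
      ((by fun_prop : Continuous (fun s : ℝ => ∑ i ∈ Finset.range n, a i * s^i)).tendsto 1).mono_left nhdsWithin_le_nhds
    simp only [one_pow, mul_one] at h1
    refine le_of_tendsto_of_tendsto h1 hL ?_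
    filter_upwards [self_mem_nhdsWithin] with s hs
    exact sum_le_hasSum _ (fun i _ => mul_nonneg (ha i) (pow_nonneg hs.1.le i)) (hf s hs)
  have hsum : Summable a := summable_of_sum_range_le ha hpart
  have h1 : ∑' n, a n ≤ L := hsum.tsum_le_of_sum_range_le hpart
  have h2 : L ≤ ∑' n, a n := by
    refine le_of_tendsto hL ?_
    filter_upwards [self_mem_nhdsWithin] with s hs
    refine hasSum_le (fun n => ?_) (hf s hs) hsum.hasSum
    exact mul_le_of_le_one_right (ha n) (pow_le_one₀ hs.1.le hs.2.le)
  rw [← le_antisymm h1 h2]; exact hsum.hasSum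

lemma prod_diag {z : ℝ} (h0 : 0 < z) (h1 : z < 1) :
    HasSum (fun N => cf N * Qp N (z^2) ((1-z)^2)) (FF z * FF (1-z)) := by
  set D : ℝ → ℝ := fun s => √((1-s)*(1-s*(2*z-1)^2)) with hD
  set Xs : ℝ → ℝ := fun s => ((1 + s*(2*z-1)) - D s)/2 with hXs
  set Ys : ℝ → ℝ := fun s => ((1 - s*(2*z-1)) - D s)/2 with hYs
  have hz2 : (2*z-1)^2 < 1 := by nlinarith
  refine abel_pos _ (fun n => mul_nonneg (cf_pos n).le (Qp_nonneg (by positivity) (by positivity)))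
    (fun s => FF (Xs s) * FF (Ys s)) _ ?_ ?_
  · intro s hs
    have hp : 0 < (1-s)*(1-s*(2*z-1)^2) := mul_pos (by linarith [hs.2]) (by nlinarith [hs.1, hs.2])
    have hDp : 0 < D s := Real.sqrt_pos.2 hp
    have hD2 : D s ^ 2 = (1-s)*(1-s*(2*z-1)^2) := Real.sq_sqrt hp.le
    have hlt1 : D s ≤ 1 + s*(2*z-1) := by
      refine Real.sqrt_le_iff.2 ⟨by nlinarith [hs.1, hs.2], ?_⟩
      nlinarith [mul_pos hs.1 (mul_pos h0 h0)]
    have hlt2 : D s ≤ 1 - s*(2*z-1) := by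
      refine Real.sqrt_le_iff.2 ⟨by nlinarith [hs.1, hs.2], ?_⟩
      nlinarith [mul_pos hs.1 (mul_pos (sub_pos.2 h1) (sub_pos.2 h1))]
    have := prod_formula (X := Xs s) (Y := Ys s) (by simp only [hXs]; linarith) (by simp only [hYs]; linarith)
      (by simp only [hXs, hYs]; linarith)
    have e1 : Xs s * (1 - Ys s) = s * z^2 := by
      simp only [hXs, hYs]; linear_combination (-1/4) * hD2
    have e2 : Ys s * (1 - Xs s) = s * (1-z)^2 := by
      simp only [hXs, hYs]; linear_combination (-1/4) * hD2
    rw [e1, e2] at this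
    simp only [Qp_smul] at this
    have e3 : (fun n => cf n * Qp n (z^2) ((1-z)^2) * s^n) = fun N => cf N * (s^N * Qp N (z^2) ((1-z)^2)) := by
      funext n; ring
    rw [e3]; exact this
  · have cD : Continuous D := by simp only [hD]; fun_prop
    have hD1 : D 1 = 0 := by simp [hD]
    have hX1 : Xs 1 = z := by simp only [hXs, hD1]; ring
    have hY1 : Ys 1 = 1 - z := by simp only [hYs, hD1]; ring
    have cX : ContinuousAt Xs 1 := by simp only [hXs]; fun_prop
    have cY : ContinuousAt Ys 1 := by simp only [hYs]; fun_prop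
    have cFX : ContinuousAt FF (Xs 1) := (FF_deriv (by rw [hX1, abs_of_pos h0]; exact h1)).continuousAt
    have cFY : ContinuousAt FF (Ys 1) := (FF_deriv (by rw [hY1, abs_of_pos (by linarith)]; linarith)).continuousAt
    have c := (ContinuousAt.comp (f := Xs) cFX cX).mul (ContinuousAt.comp (f := Ys) cFY cY)
    have := c.tendsto.mono_left (nhdsWithin_le_nhds (s := Set.Ioo 0 1))
    have e : FF z * FF (1-z) = FF (Xs 1) * FF (Ys 1) := by rw [hX1, hY1]
    rw [e]; exact this

lemma coeff_lin (a b : ℝ) (n i : ℕ) :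
    ((Polynomial.C a * Polynomial.X + Polynomial.C b)^n).coeff i = b^(n-i) * (n.choose i) * a^i := by
  have : (Polynomial.C a * Polynomial.X + Polynomial.C b)^n
      = ((Polynomial.X + Polynomial.C b)^n).comp (Polynomial.C a * Polynomial.X) := by simp
  rw [this, Polynomial.comp_C_mul_X_coeff, Polynomial.coeff_X_add_C_pow]

lemma Qp_diag (N : ℕ) (z : ℝ) : Qp N (z^2) ((1-z)^2) =
    ∑ k ∈ Finset.range (N+1), (N.choose k : ℝ) * ((2*k).choose k) * (-(z*(1-z)))^k := by
  have e0 : (Polynomial.C (z^2) * Polynomial.X + Polynomial.C ((1-z)^2))^N *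
      (Polynomial.C (1:ℝ) * Polynomial.X + Polynomial.C 1)^N
      = ((Polynomial.C z * Polynomial.X + Polynomial.C (z-1))^2 + Polynomial.X)^N := by
    rw [← mul_pow]
    congr 1
    simp only [map_pow, map_sub, map_one]
    ring
  have e1 := congrArg (fun p => Polynomial.coeff p N) e0
  rw [Polynomial.coeff_mul, add_pow (_ ^ 2), Polynomial.finsetSum_coeff] at e1
  have e2 : Qp N (z^2) ((1-z)^2) = ∑ x ∈ Finset.HasAntidiagonal.antidiagonal N,
    ((Polynomial.C (z^2) * Polynomial.X + Polynomial.C ((1-z)^2))^N).coeff x.1 *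
      ((Polynomial.C (1:ℝ) * Polynomial.X + Polynomial.C 1)^N).coeff x.2 := by
    unfold Qp
    refine Finset.sum_congr rfl (fun ij hij => ?_)
    have h : ij.1 + ij.2 = N := by simpa using hij
    rw [coeff_lin, coeff_lin]
    have h1 : N - ij.1 = ij.2 := by omega
    have h2 : N.choose ij.2 = N.choose ij.1 := by rw [← h1]; exact Nat.choose_symm (by omega)
    rw [h1, h2]; simp; ring
  rw [e2, e1]
  refine Finset.sum_congr rfl (fun k hk => ?_)
  have hk' : k ≤ N := by simpa [Nat.lt_succ_iff] using hk
  rw [mul_comm _ ((N.choose k : Polynomial ℝ)), ← Polynomial.C_eq_natCast, Polynomial.coeff_C_mul, Polynomial.coeff_mul_X_pow', if_pos (by omega),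
    ← pow_mul, coeff_lin]
  have h1 : N - (N - k) = k := by omega
  have h2 : 2 * k - k = k := by omega
  rw [h1, h2]
  have : -(z*(1-z)) = (z-1)*z := by ring
  rw [this, mul_pow]; ring


lemma cov_l {s t : Set ℝ} (hs : MeasurableSet s) {f f' : ℝ → ℝ} (hf : ∀ x ∈ s, HasDerivAt f (f' x) x)
    (hpos : ∀ x ∈ s, 0 ≤ f' x) {g : ℝ → ℝ} (hst : ∀ x ∈ s, f x ∈ t) (hts : ∀ y ∈ t, g y ∈ s)
    (hgf : ∀ x ∈ s, g (f x) = x) (hfg : ∀ y ∈ t, f (g y) = y) (u : ℝ → ENNReal) :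
    ∫⁻ x in t, u x = ∫⁻ x in s, ENNReal.ofReal (f' x) * u (f x) := by
  have him : f '' s = t := by
    ext y; constructor
    · rintro ⟨x, hx, rfl⟩; exact hst x hx
    · intro hy; exact ⟨g y, hts y hy, hfg y hy⟩
  have hinj : Set.InjOn f s := fun x hx y hy h => by rw [← hgf x hx, ← hgf y hy, h]
  rw [← him, lintegral_image_eq_lintegral_abs_deriv_mul hs (fun x hx => (hf x hx).hasDerivWithinAt) hinj]
  refine setLIntegral_congr_fun hs (fun x hx => ?_)
  simp only [abs_of_nonneg (hpos x hx)]

lemma cov_i {s t : Set ℝ} (hs : MeasurableSet s) {f f' : ℝ → ℝ} (hf : ∀ x ∈ s, HasDerivAt f (f' x) x)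
    (hpos : ∀ x ∈ s, 0 ≤ f' x) {g : ℝ → ℝ} (hst : ∀ x ∈ s, f x ∈ t) (hts : ∀ y ∈ t, g y ∈ s)
    (hgf : ∀ x ∈ s, g (f x) = x) (hfg : ∀ y ∈ t, f (g y) = y) (u : ℝ → ℝ) :
    ∫ x in t, u x = ∫ x in s, f' x * u (f x) := by
  have him : f '' s = t := by
    ext y; constructor
    · rintro ⟨x, hx, rfl⟩; exact hst x hx
    · intro hy; exact ⟨g y, hts y hy, hfg y hy⟩
  have hinj : Set.InjOn f s := fun x hx y hy h => by rw [← hgf x hx, ← hgf y hy, h]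
  rw [← him, integral_image_eq_integral_abs_deriv_smul hs (fun x hx => (hf x hx).hasDerivWithinAt) hinj]
  refine setIntegral_congr_fun hs (fun x hx => ?_)
  simp only [abs_of_nonneg (hpos x hx), smul_eq_mul]

open ProbabilityTheory in
lemma beta_l {a b : ℝ} (ha : 0 < a) (hb : 0 < b) :
    ∫⁻ x in Set.Ioo (0:ℝ) 1, ENNReal.ofReal (x^(a-1) * (1-x)^(b-1)) = ENNReal.ofReal (beta a b) := by
  have h := lintegral_betaPDF_eq_one ha hb
  rw [lintegral_betaPDF] at h
  have hp := beta_pos ha hb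
  have : ∀ x : ℝ, ENNReal.ofReal (1 / beta a b * x ^ (a - 1) * (1 - x) ^ (b - 1))
      = ENNReal.ofReal (1 / beta a b) * ENNReal.ofReal (x^(a-1) * (1-x)^(b-1)) := by
    intro x
    rw [mul_assoc, ENNReal.ofReal_mul (by positivity)]
  simp only [this] at h
  rw [lintegral_const_mul _ (by fun_prop)] at h
  have h2 := congrArg (fun y => ENNReal.ofReal (beta a b) * y) h
  simp only [mul_one, ← mul_assoc] at h2
  rw [← ENNReal.ofReal_mul hp.le, mul_one_div_cancel hp.ne', ENNReal.ofReal_one, one_mul] at h2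
  exact h2

open ProbabilityTheory in
lemma conf_l {a b c d : ℝ} (ha : 0 < a) (hb : 0 < b) (hc : 0 < c) (hd : 0 < d) :
    ∫⁻ p in Set.Ioo (0:ℝ) 1, ENNReal.ofReal (p^(a-1) * (1-p)^(b-1) * (c*(1-p)+d*p)^(-(a+b)))
      = ENNReal.ofReal (beta a b * c^(-b) * d^(-a)) := by
  have hL : ∀ p ∈ Set.Ioo (0:ℝ) 1, 0 < c*(1-p)+d*p := fun p hp => by
    have := hp.1; have := hp.2
    have : 0 < 1 - p := by linarith
    positivity
  have hL' : ∀ p ∈ Set.Ioo (0:ℝ) 1, 0 < d*(1-p)+c*p := fun p hp => by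
    have := hp.1; have := hp.2
    have : 0 < 1 - p := by linarith
    positivity
  have h := cov_l (s := Set.Ioo (0:ℝ) 1) (t := Set.Ioo (0:ℝ) 1) measurableSet_Ioo
    (f := fun p => d*p/(c*(1-p)+d*p)) (f' := fun p => c*d/(c*(1-p)+d*p)^2)
    (fun p hp => ?_) (fun p hp => by have := hL p hp; positivity) (g := fun x => c*x/(d*(1-x)+c*x))
    (fun p hp => ⟨by have := hL p hp; have := hp.1; positivity, by
      have := hp.2
      rw [div_lt_one (hL p hp)]; nlinarith⟩)
    (fun p hp => ⟨by have := hL' p hp; have := hp.1; positivity, by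
      have := hp.2
      rw [div_lt_one (hL' p hp)]; nlinarith⟩)
    (fun p hp => ?_) (fun p hp => ?_) (fun x => ENNReal.ofReal (x^(a-1) * (1-x)^(b-1)))
  · rw [beta_l ha hb] at h
    rw [mul_assoc, ENNReal.ofReal_mul (beta_pos ha hb).le, h, ← lintegral_mul_const _ (by fun_prop)]
    refine setLIntegral_congr_fun measurableSet_Ioo (fun p hp => ?_)
    have h1 := hL p hp
    have hp0 := hp.1
    have hp1 : 0 < 1 - p := by linarith [hp.2]
    have e : 1 - d*p/(c*(1-p)+d*p) = c*(1-p)/(c*(1-p)+d*p) := by field_simp; ring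
    rw [e]
    rw [← ENNReal.ofReal_mul (by positivity), ← ENNReal.ofReal_mul (by positivity)]
    congr 1
    rw [Real.div_rpow (by positivity) h1.le, Real.div_rpow (by positivity) h1.le, Real.mul_rpow hd.le hp0.le,
      Real.mul_rpow hc.le hp1.le]
    have e2 : (c*(1-p)+d*p)^(-(a+b)) = 1/((c*(1-p)+d*p)^(a-1) * (c*(1-p)+d*p)^(b-1) * (c*(1-p)+d*p)^2) := by
      rw [← Real.rpow_natCast, ← Real.rpow_add h1, ← Real.rpow_add h1, Real.rpow_neg h1.le, one_div]
      congr 2; push_cast; ring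
    have e3 : c^(-b) = 1/(c^(b-1) * c) := by
      rw [← Real.rpow_add_one hc.ne', Real.rpow_neg hc.le, one_div]; congr 2; ring
    have e4 : d^(-a) = 1/(d^(a-1) * d) := by
      rw [← Real.rpow_add_one hd.ne', Real.rpow_neg hd.le, one_div]; congr 2; ring
    rw [e2, e3, e4]
    have := Real.rpow_pos_of_pos h1 (a-1)
    have := Real.rpow_pos_of_pos h1 (b-1)
    have := Real.rpow_pos_of_pos hc (b-1)
    have := Real.rpow_pos_of_pos hd (a-1)
    field_simp
  · have h1 := hL p hp
    have := ((hasDerivAt_id p).const_mul d).fun_div ((((hasDerivAt_id p).const_sub 1).const_mul c).add ((hasDerivAt_id p).const_mul d)) h1.ne'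
    refine hda this (fun _ => rfl) ?_
    simp only [id, Pi.add_apply]; congr 1; ring
  · have h1 := hL p hp
    have e : d*(1 - d*p/(c*(1-p)+d*p)) + c*(d*p/(c*(1-p)+d*p)) = c*d/(c*(1-p)+d*p) := by field_simp; ring
    rw [e]; field_simp
  · have h1 := hL' p hp
    have e : c*(1 - c*p/(d*(1-p)+c*p)) + d*(c*p/(d*(1-p)+c*p)) = c*d/(d*(1-p)+c*p) := by field_simp; ring
    rw [e]; field_simp

lemma ofReal_hasSum {f : ℕ → ℝ} {a : ℝ} (hf : ∀ n, 0 ≤ f n) (h : HasSum f a) :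
    ENNReal.ofReal a = ∑' n, ENNReal.ofReal (f n) := by
  rw [← h.tsum_eq]; exact ENNReal.ofReal_tsum_of_nonneg hf h.summable

open ProbabilityTheory in
lemma binbeta {u v s y : ℝ} (hu : 0 < u) (hv : 0 < v) (hs : 0 < s) (hy : 0 ≤ y) (hy1 : y ≤ 1) :
    ∫⁻ x in Set.Ioo (0:ℝ) 1, ENNReal.ofReal (x^(u-1) * (1-x)^(v-1) * (1-x*y)^(-s))
      = ∑' n : ℕ, ENNReal.ofReal (bf s n * y^n * beta (u+n) v) := by
  have e : ∀ x ∈ Set.Ioo (0:ℝ) 1, ENNReal.ofReal (x^(u-1) * (1-x)^(v-1) * (1-x*y)^(-s))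
      = ∑' n : ℕ, ENNReal.ofReal (bf s n * y^n) * ENNReal.ofReal (x^(u+n-1) * (1-x)^(v-1)) := by
    intro x hx
    have hx0 := hx.1
    have hx1 : 0 < 1 - x := by linarith [hx.2]
    have hxy : x * y < 1 := by nlinarith [hx.2]
    have h := (hasSum_binom s (x := x*y) (by rwa [abs_of_nonneg (by positivity)])).mul_left (x^(u-1) * (1-x)^(v-1))
    rw [ofReal_hasSum (fun n => by have := bf_pos hs n; positivity) h]
    refine tsum_congr (fun n => ?_)
    have := bf_pos hs n
    rw [← ENNReal.ofReal_mul (by positivity)]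
    congr 1
    have e : u + n - 1 = (u - 1) + n := by ring
    rw [e, Real.rpow_add hx0, Real.rpow_natCast]; ring
  rw [setLIntegral_congr_fun measurableSet_Ioo e, lintegral_tsum (fun n => by fun_prop)]
  refine tsum_congr (fun n => ?_)
  have := bf_pos hs n
  rw [lintegral_const_mul _ (by fun_prop), beta_l (by positivity) hv, ← ENNReal.ofReal_mul (by positivity)]

lemma bf_gamma {a : ℝ} (ha : 0 < a) (n : ℕ) : bf a n * Real.Gamma a = Real.Gamma (a+n) / (n.factorial) := by
  induction n with
  | zero => simp [bf]
  | succ n ih =>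
    have h1 : Real.Gamma (a + (n+1:ℕ)) = (a+n) * Real.Gamma (a+n) := by
      push_cast; rw [← add_assoc, Real.Gamma_add_one (by positivity)]
    rw [h1, Nat.factorial_succ]
    simp only [bf]
    have : bf a n = Real.Gamma (a+n) / (n.factorial) / Real.Gamma a := by
      rw [← ih]; field_simp [(Real.Gamma_pos_of_pos ha).ne']
    rw [this]
    have := (Real.Gamma_pos_of_pos ha).ne'
    push_cast
    field_simp

lemma euler {z : ℝ} (h0 : 0 ≤ z) (h1 : z < 1) :
    ENNReal.ofReal (FF z) = ENNReal.ofReal (1/(Real.Gamma (3/4) * Real.Gamma (1/4))) *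
      ∫⁻ t in Set.Ioo (0:ℝ) 1, ENNReal.ofReal (t^(-(3/4:ℝ)) * (1-t)^(-(1/4:ℝ)) * (1-t*z)^(-(3/4:ℝ))) := by
  have h := binbeta (u := 1/4) (v := 3/4) (s := 3/4) (y := z) (by norm_num) (by norm_num) (by norm_num) h0 h1.le
  have g1 := Real.Gamma_pos_of_pos (show (0:ℝ) < 3/4 by norm_num)
  have g2 := Real.Gamma_pos_of_pos (show (0:ℝ) < 1/4 by norm_num)
  norm_num at h ⊢
  have hF : ENNReal.ofReal (FF z) = ∑' n : ℕ, ENNReal.ofReal (cf n * z^n) :=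
    ofReal_hasSum (fun n => mul_nonneg (cf_pos n).le (pow_nonneg h0 n))
      (FF_summable (z := z) (by rwa [abs_of_nonneg h0])).hasSum
  rw [h, ← ENNReal.tsum_mul_left, hF]
  refine tsum_congr (fun n => ?_)
  rw [← ENNReal.ofReal_mul (by positivity)]
  congr 1
  have e := bf_gamma (show (0:ℝ) < 1/4 by norm_num) n
  rw [cf_eq]
  have e2 : Real.Gamma (1/4 + n + 3/4) = n.factorial := by
    rw [← Real.Gamma_nat_eq_factorial]; congr 1; ring
  rw [ProbabilityTheory.beta, e2]
  have : bf (1/4) n = Real.Gamma (1/4+n) / (n.factorial) / Real.Gamma (1/4) := by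
    rw [← e]; field_simp
  rw [this]; field_simp


open ProbabilityTheory in
lemma int_beta {a b : ℝ} (ha : 0 < a) (hb : 0 < b) :
    IntegrableOn (fun x : ℝ => x^(a-1) * (1-x)^(b-1)) (Set.Ioo 0 1) := by
  have hm : Measurable (fun x : ℝ => x^(a-1) * (1-x)^(b-1)) := by fun_prop
  have h := beta_l ha hb
  refine (lintegral_ofReal_ne_top_iff_integrable hm.aestronglyMeasurable ?_).1 ?_
  · filter_upwards [ae_restrict_mem measurableSet_Ioo] with x hx
    have := hx.1
    have : 0 < 1 - x := by linarith [hx.2]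
    positivity
  · rw [h]; exact ENNReal.ofReal_ne_top

lemma FF_contOn : ContinuousOn FF (Set.Ioo (-1) 1) := fun z hz =>
  (FF_deriv (z := z) (abs_lt.2 hz)).continuousAt.continuousWithinAt

lemma FF_aesm : AEStronglyMeasurable FF (volume.restrict (Set.Ioo (0:ℝ) 1)) :=
  (FF_contOn.mono (Set.Ioo_subset_Ioo (by norm_num) le_rfl)).aestronglyMeasurable measurableSet_Ioo

lemma FF_pos {z : ℝ} (h0 : 0 ≤ z) (h1 : z < 1) : 0 < FF z := lt_of_lt_of_le one_pos (FF_ge_one h0 h1)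

noncomputable def Mk (k : ℕ) : ℝ := ∫ z in Set.Ioo (0:ℝ) 1, (z*(1-z))^((k:ℝ)-5/8) * FF z

lemma Mk_int (k : ℕ) : IntegrableOn (fun z : ℝ => (z*(1-z))^((k:ℝ)-5/8) * FF z) (Set.Ioo 0 1) := by
  refine Integrable.mono' (int_beta (a := 3/8) (b := 3/16) (by norm_num) (by norm_num)) ?_ ?_
  · refine AEStronglyMeasurable.mul ?_ FF_aesm
    exact Measurable.aestronglyMeasurable (by fun_prop)
  · filter_upwards [ae_restrict_mem measurableSet_Ioo] with z hz
    have h0 := hz.1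
    have h1 : 0 < 1 - z := by linarith [hz.2]
    have hF := FF_le h0.le hz.2
    have hF0 := FF_pos h0.le hz.2
    rw [Real.norm_of_nonneg (by positivity)]
    have e1 : (z*(1-z))^((k:ℝ)-5/8) ≤ (z*(1-z))^(-(5/8:ℝ)) := by
      apply Real.rpow_le_rpow_of_exponent_ge (by positivity) (by nlinarith)
      have : (0:ℝ) ≤ k := by positivity
      linarith
    calc (z*(1-z))^((k:ℝ)-5/8) * FF z ≤ (z*(1-z))^(-(5/8:ℝ)) * (1-z)^(-(3/16:ℝ)) := by gcongr
      _ = z^((3/8:ℝ)-1) * (1-z)^((3/16:ℝ)-1) := by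
        rw [Real.mul_rpow h0.le h1.le, mul_assoc, ← Real.rpow_add h1]; norm_num

open ProbabilityTheory in
lemma Mk_zero : Mk 0 = beta (3/8) (3/8) * beta (1/4) (3/8) * (1/(Real.Gamma (3/4) * Real.Gamma (1/4))) := by
  have b1 := beta_pos (show (0:ℝ) < 3/8 by norm_num) (show (0:ℝ) < 3/8 by norm_num)
  have b2 := beta_pos (show (0:ℝ) < 1/4 by norm_num) (show (0:ℝ) < 3/8 by norm_num)
  have g1 := Real.Gamma_pos_of_pos (show (0:ℝ) < 3/4 by norm_num)
  have g2 := Real.Gamma_pos_of_pos (show (0:ℝ) < 1/4 by norm_num)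
  have hnn : 0 ≤ Mk 0 := setIntegral_nonneg measurableSet_Ioo (fun z hz => by
    have h0 := hz.1
    have h1 : 0 < 1 - z := by linarith [hz.2]
    have hF0 := FF_pos h0.le hz.2
    positivity)
  rw [← ENNReal.ofReal_eq_ofReal_iff hnn (by positivity), Mk, ofReal_integral_eq_lintegral_ofReal (Mk_int 0)
    (by filter_upwards [ae_restrict_mem measurableSet_Ioo] with z hz
        have h0 := hz.1
        have h1 : 0 < 1 - z := by linarith [hz.2]
        have hF0 := FF_pos h0.le hz.2
        simp only [Pi.zero_apply]; positivity)]
  set c := ENNReal.ofReal (1/(Real.Gamma (3/4) * Real.Gamma (1/4))) with hc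
  have e1 : ∀ z ∈ Set.Ioo (0:ℝ) 1, ENNReal.ofReal ((z*(1-z))^(((0:ℕ):ℝ)-5/8) * FF z) =
      c * ∫⁻ t in Set.Ioo (0:ℝ) 1, ENNReal.ofReal (t^(-(3/4:ℝ)) * (1-t)^(-(1/4:ℝ))) *
        ENNReal.ofReal (z^((3/8:ℝ)-1)*(1-z)^((3/8:ℝ)-1)*(1*(1-z)+(1-t)*z)^(-(3/8+3/8:ℝ))) := by
    intro z hz
    have h0 := hz.1
    have h1 : 0 < 1 - z := by linarith [hz.2]
    rw [ENNReal.ofReal_mul (by positivity), euler h0.le hz.2, ← hc, mul_left_comm]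
    rw [← lintegral_const_mul _ (by fun_prop)]
    congr 1
    refine setLIntegral_congr_fun measurableSet_Ioo (fun t ht => ?_)
    have h2 := ht.1
    have h3 : 0 < 1 - t := by linarith [ht.2]
    rw [← ENNReal.ofReal_mul (by positivity), ← ENNReal.ofReal_mul (by positivity)]
    congr 1
    rw [Real.mul_rpow h0.le h1.le, show 1*(1-z)+(1-t)*z = 1 - t*z by ring]
    norm_num; ring
  rw [setLIntegral_congr_fun measurableSet_Ioo e1, lintegral_const_mul', lintegral_lintegral_swap]
  · have e2 : ∀ t ∈ Set.Ioo (0:ℝ) 1, ∫⁻ z in Set.Ioo (0:ℝ) 1, ENNReal.ofReal (t^(-(3/4:ℝ)) * (1-t)^(-(1/4:ℝ))) *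
        ENNReal.ofReal (z^((3/8:ℝ)-1)*(1-z)^((3/8:ℝ)-1)*(1*(1-z)+(1-t)*z)^(-(3/8+3/8:ℝ))) =
        ENNReal.ofReal (beta (3/8) (3/8)) * ENNReal.ofReal (t^((1/4:ℝ)-1)*(1-t)^((3/8:ℝ)-1)) := by
      intro t ht
      have h2 := ht.1
      have h3 : 0 < 1 - t := by linarith [ht.2]
      rw [lintegral_const_mul _ (by fun_prop), conf_l (by norm_num) (by norm_num) (by norm_num) h3,
        ← ENNReal.ofReal_mul (by positivity), ← ENNReal.ofReal_mul (by positivity)]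
      congr 1
      rw [show (3/8:ℝ)-1 = -(1/4)+-(3/8) by norm_num, Real.rpow_add h3]; norm_num; ring
    rw [setLIntegral_congr_fun measurableSet_Ioo e2, lintegral_const_mul _ (by fun_prop), beta_l (by norm_num) (by norm_num),
      ← ENNReal.ofReal_mul (by positivity), hc, mul_comm, ← ENNReal.ofReal_mul (by positivity)]
  · exact Measurable.aemeasurable (by unfold Function.uncurry; fun_prop)
  · exact ENNReal.ofReal_ne_top

lemma Mk_succ (k : ℕ) : (4*((k:ℝ)+1/2)*(k+3/4)) * Mk (k+1) = (k+3/8)^2 * Mk k := by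
  set s : ℝ := (k:ℝ) + 3/8 with hs
  have hk : (0:ℝ) ≤ k := by positivity
  have hs0 : 3/8 ≤ s := by rw [hs]; linarith
  set H : ℝ → ℝ := fun z => (z*(1-z))^s * (GG z - s*(1-2*z)*FF z) with hH
  have hder : ∀ z ∈ Set.Ioo (0:ℝ) 1, HasDerivAt H ((4*((k:ℝ)+1/2)*(k+3/4)) * ((z*(1-z))^(((k+1:ℕ):ℝ)-5/8) * FF z) -
      s^2 * ((z*(1-z))^((k:ℝ)-5/8) * FF z)) z := by
    intro z hz
    have h0 := hz.1
    have h1 : 0 < 1 - z := by linarith [hz.2]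
    have hz' : |z| < 1 := by rw [abs_of_pos h0]; exact hz.2
    have d1 := ((hasDerivAt_id z).mul ((hasDerivAt_id z).const_sub 1)).rpow_const (p := s) (Or.inl (by simp; constructor <;> linarith))
    have d2 := (GG_deriv hz').sub ((((((hasDerivAt_id z).const_mul 2).const_sub 1).const_mul s)).mul (FF_deriv hz'))
    refine hda (d1.mul d2) (fun _ => rfl) ?_
    simp only [id, Pi.mul_apply, Pi.sub_apply]
    have e1 : (z*(1-z))^(((k+1:ℕ):ℝ)-5/8) = (z*(1-z))^((k:ℝ)-5/8) * (z*(1-z)) := by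
      rw [← Real.rpow_add_one (by positivity)]; congr 1; push_cast; ring
    have e2 : (z*(1-z))^s = (z*(1-z))^((k:ℝ)-5/8) * (z*(1-z)) := by
      rw [← Real.rpow_add_one (by positivity)]; congr 1; rw [hs]; ring
    have e3 : s - 1 = (k:ℝ) - 5/8 := by rw [hs]; ring
    rw [e1, e2, e3, GG, hs]
    ring
  have hbd : ∀ z ∈ Set.Ioo (0:ℝ) 1, ‖H z‖ ≤ (1+s) * (z^s * (1-z)^(s-3/16)) := by
    intro z hz
    have h0 := hz.1
    have h1 : 0 < 1 - z := by linarith [hz.2]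
    have f1 := FF_le h0.le hz.2
    have f2 := FF'_le h0.le hz.2
    have f0 := FF_pos h0.le hz.2
    have f3 := FF'_nonneg h0.le
    have hg : |GG z| ≤ (1-z)^(-(3/16:ℝ)) := by
      rw [GG, abs_of_nonneg (by positivity)]
      calc z*(1-z)*FF' z ≤ 1*(1-z)*(1-z)^(-(19/16:ℝ)) := by gcongr; exact hz.2.le
        _ = _ := by rw [one_mul, mul_comm, ← Real.rpow_add_one h1.ne']; norm_num
    have hf : |s*(1-2*z)*FF z| ≤ s*(1-z)^(-(3/16:ℝ)) := by
      rw [abs_mul, abs_mul, abs_of_nonneg (by linarith : 0 ≤ s), abs_of_pos f0]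
      have : |1-2*z| ≤ 1 := by rw [abs_le]; constructor <;> linarith
      calc s * |1-2*z| * FF z ≤ s * 1 * (1-z)^(-(3/16:ℝ)) := by gcongr
        _ = _ := by ring
    rw [hH]; simp only
    rw [norm_mul, Real.norm_of_nonneg (by positivity), Real.norm_eq_abs]
    calc (z*(1-z))^s * |GG z - s*(1-2*z)*FF z| ≤ (z*(1-z))^s * ((1-z)^(-(3/16:ℝ)) + s*(1-z)^(-(3/16:ℝ))) := by
          gcongr; exact (abs_sub _ _).trans (add_le_add hg hf)
      _ = _ := by rw [Real.mul_rpow h0.le h1.le, sub_eq_add_neg s, Real.rpow_add h1 s]; ring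
  have hc : Continuous (fun z : ℝ => (1+s) * (z^s * (1-z)^(s-3/16))) := by
    have : Continuous (fun z : ℝ => z^s) := Real.continuous_rpow_const (by linarith)
    have h2 : Continuous (fun z : ℝ => (1-z)^(s-3/16)) :=
      (Real.continuous_rpow_const (by linarith)).comp (continuous_const.sub continuous_id)
    fun_prop
  have h := intervalIntegral.integral_eq_sub_of_hasDerivAt_of_tendsto (a := 0) (b := 1) one_pos hder
    (((intervalIntegrable_iff_integrableOn_Ioo_of_le zero_le_one).2
      (((Mk_int (k+1)).const_mul _).sub ((Mk_int k).const_mul _)))) (fa := 0) (fb := 0) ?_ ?_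
  · rw [intervalIntegral.integral_of_le zero_le_one, integral_Ioc_eq_integral_Ioo,
      MeasureTheory.integral_sub ((Mk_int (k+1)).const_mul _) ((Mk_int k).const_mul _), MeasureTheory.integral_const_mul, MeasureTheory.integral_const_mul] at h
    rw [Mk, Mk]; linarith
  · refine squeeze_zero_norm' (a := fun z : ℝ => (1+s) * (z^s * (1-z)^(s-3/16))) ?_ ?_
    · filter_upwards [Ioo_mem_nhdsGT (show (0:ℝ) < 1 by norm_num)] with z hz using hbd z hz
    · have := hc.tendsto 0
      simp only [Real.zero_rpow (by linarith : s ≠ 0), zero_mul, mul_zero] at this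
      exact this.mono_left nhdsWithin_le_nhds
  · refine squeeze_zero_norm' (a := fun z : ℝ => (1+s) * (z^s * (1-z)^(s-3/16))) ?_ ?_
    · filter_upwards [Ioo_mem_nhdsLT (show (0:ℝ) < 1 by norm_num)] with z hz using hbd z hz
    · have := hc.tendsto 1
      simp only [sub_self, Real.zero_rpow (by linarith : s - 3/16 ≠ 0), mul_zero] at this
      exact this.mono_left nhdsWithin_le_nhds


open ProbabilityTheory in
lemma beta_i {a b : ℝ} (ha : 0 < a) (hb : 0 < b) :
    ∫ x in Set.Ioo (0:ℝ) 1, x^(a-1) * (1-x)^(b-1) = beta a b := by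
  have h := beta_l ha hb
  rw [integral_eq_lintegral_of_nonneg_ae, h, ENNReal.toReal_ofReal (beta_pos ha hb).le]
  · filter_upwards [ae_restrict_mem measurableSet_Ioo] with x hx
    have := hx.1
    have : 0 < 1 - x := by linarith [hx.2]
    simp only [Pi.zero_apply]; positivity
  · exact (int_beta ha hb).1

noncomputable def ek : ℕ → ℝ
  | 0 => 1
  | k+1 => ek k * ((k:ℝ)+3/8)^2 / (((k:ℝ)+3/4)*(k+1))

lemma central_Mk (k : ℕ) : ((2*k).choose k : ℝ) * Mk k = Mk 0 * ek k := by
  induction k with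
  | zero => simp [ek]
  | succ k ih =>
    have h1 := Nat.succ_mul_centralBinom_succ k
    have h2 := Mk_succ k
    have h1' : ((k:ℝ)+1) * ((2*(k+1)).choose (k+1) : ℝ) = 2*(2*k+1)*((2*k).choose k : ℝ) := by
      have := congrArg (fun n : ℕ => (n:ℝ)) h1
      simp only [Nat.centralBinom] at this
      push_cast at this ⊢
      linarith
    have e1 : ((2*(k+1)).choose (k+1) : ℝ) = 2*(2*k+1)*((2*k).choose k : ℝ) / (k+1) := by
      rw [← h1']; field_simp
    have e2 : Mk (k+1) = (k+3/8)^2 * Mk k / (4*((k:ℝ)+1/2)*(k+3/4)) := by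
      rw [← h2]; field_simp
    rw [ek, e1, e2]
    have : 2*(2*k+1)*((2*k).choose k : ℝ) / (k+1) * ((k+3/8)^2 * Mk k / (4*((k:ℝ)+1/2)*(k+3/4)))
       = (((2*k).choose k : ℝ) * Mk k) * (((k:ℝ)+3/8)^2 / (((k:ℝ)+3/4)*(k+1))) := by field_simp; ring
    rw [this, ih]; ring

lemma RN_hasint (N : ℕ) : IntegrableOn (fun z : ℝ => (z*(1-z))^(-(5/8:ℝ)) * FF z * Qp N (z^2) ((1-z)^2)) (Set.Ioo 0 1) ∧
    ∫ z in Set.Ioo (0:ℝ) 1, (z*(1-z))^(-(5/8:ℝ)) * FF z * Qp N (z^2) ((1-z)^2) =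
      Mk 0 * ∑ k ∈ Finset.range (N+1), (N.choose k : ℝ) * (-1)^k * ek k := by
  have e : ∀ z ∈ Set.Ioo (0:ℝ) 1, (z*(1-z))^(-(5/8:ℝ)) * FF z * Qp N (z^2) ((1-z)^2) =
      ∑ k ∈ Finset.range (N+1), ((N.choose k : ℝ) * (-1)^k * ((2*k).choose k : ℝ)) * ((z*(1-z))^((k:ℝ)-5/8) * FF z) := by
    intro z hz
    have h0 := hz.1
    have h1 : 0 < 1 - z := by linarith [hz.2]
    rw [Qp_diag, Finset.mul_sum]
    refine Finset.sum_congr rfl (fun k _ => ?_)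
    have e1 : (z*(1-z))^((k:ℝ)-5/8) = (z*(1-z))^k * (z*(1-z))^(-(5/8:ℝ)) := by
      rw [sub_eq_add_neg (k:ℝ), Real.rpow_add (by positivity), Real.rpow_natCast]
    rw [e1, neg_pow]; ring
  have hi : ∀ k ∈ Finset.range (N+1), Integrable (fun z : ℝ => ((N.choose k : ℝ) * (-1)^k * ((2*k).choose k : ℝ)) * ((z*(1-z))^((k:ℝ)-5/8) * FF z))
      (volume.restrict (Set.Ioo 0 1)) := fun k _ => (Mk_int k).const_mul _
  constructor
  · exact (integrableOn_congr_fun e measurableSet_Ioo).2 (integrable_finsetSum _ hi)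
  · rw [setIntegral_congr_fun measurableSet_Ioo e, MeasureTheory.integral_finsetSum _ hi, Finset.mul_sum]
    refine Finset.sum_congr rfl (fun k _ => ?_)
    rw [MeasureTheory.integral_const_mul]
    change _ * Mk k = _
    rw [mul_assoc, central_Mk]; ring

open ProbabilityTheory in
lemma beta_ek (k : ℕ) : beta (3/8+k) (3/8) * beta (3/8+k) (5/8) = beta (3/8) (3/8) * beta (3/8) (5/8) * ek k := by
  have g1 := Real.Gamma_pos_of_pos (show (0:ℝ) < 3/8 by norm_num)
  have g3 := Real.Gamma_pos_of_pos (show (0:ℝ) < 3/8+3/8 by norm_num)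
  have g5 := Real.Gamma_pos_of_pos (show (0:ℝ) < 3/8+5/8 by norm_num)
  induction k with
  | zero => simp [ek]
  | succ k ih =>
    rw [ek]
    have : beta (3/8) (3/8) * beta (3/8) (5/8) * (ek k * ((k:ℝ)+3/8)^2 / (((k:ℝ)+3/4)*(k+1))) =
      (beta (3/8) (3/8) * beta (3/8) (5/8) * ek k) * ((k:ℝ)+3/8)^2 / (((k:ℝ)+3/4)*(k+1)) := by ring
    rw [this, ← ih]
    simp only [beta]
    have e1 : Real.Gamma (3/8 + ((k+1:ℕ):ℝ)) = (3/8+k) * Real.Gamma (3/8+k) := by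
      rw [← Real.Gamma_add_one (by positivity)]; congr 1; push_cast; ring
    have e2 : Real.Gamma (3/8 + ((k+1:ℕ):ℝ) + 3/8) = (3/8+k+3/8) * Real.Gamma (3/8+k+3/8) := by
      rw [← Real.Gamma_add_one (by positivity)]; congr 1; push_cast; ring
    have e3 : Real.Gamma (3/8 + ((k+1:ℕ):ℝ) + 5/8) = (3/8+k+5/8) * Real.Gamma (3/8+k+5/8) := by
      rw [← Real.Gamma_add_one (by positivity)]; congr 1; push_cast; ring
    rw [e1, e2, e3]
    have := Real.Gamma_pos_of_pos (show (0:ℝ) < 3/8+k+3/8 by positivity)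
    have := Real.Gamma_pos_of_pos (show (0:ℝ) < 3/8+k+5/8 by positivity)
    have h1 : (3/8+k+3/8:ℝ) = k + 3/4 := by ring
    have h2 : (3/8+k+5/8:ℝ) = k + 1 := by ring
    rw [h1] at *
    rw [h2] at *
    field_simp
    ring

open ProbabilityTheory in
lemma JN_inner (N : ℕ) {q : ℝ} (h0 : 0 < q) (h1 : q < 1) :
    ∫⁻ p in Set.Ioo (0:ℝ) 1, ENNReal.ofReal (p^((3/8:ℝ)-1)*(1-p)^((3/8:ℝ)-1)*(1-p*q)^N) =
      ENNReal.ofReal (∑ k ∈ Finset.range (N+1), (N.choose k : ℝ) * (-q)^k * beta (3/8+k) (3/8)) ∧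
    0 ≤ ∑ k ∈ Finset.range (N+1), (N.choose k : ℝ) * (-q)^k * beta (3/8+k) (3/8) := by
  have e : ∀ p ∈ Set.Ioo (0:ℝ) 1, p^((3/8:ℝ)-1)*(1-p)^((3/8:ℝ)-1)*(1-p*q)^N =
      ∑ k ∈ Finset.range (N+1), ((N.choose k : ℝ) * (-q)^k) * (p^((3/8:ℝ)+k-1)*(1-p)^((3/8:ℝ)-1)) := by
    intro p hp
    have hp0 := hp.1
    have e1 : (1-p*q)^N = (-q*p+1)^N := by ring
    rw [e1, add_pow, Finset.mul_sum]
    refine Finset.sum_congr rfl (fun k _ => ?_)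
    have e2 : (3/8:ℝ)+k-1 = (3/8-1) + k := by ring
    rw [e2, Real.rpow_add hp0, Real.rpow_natCast, mul_pow, one_pow]; ring
  have hi : ∀ k ∈ Finset.range (N+1), Integrable (fun p : ℝ => ((N.choose k : ℝ) * (-q)^k) * (p^((3/8:ℝ)+k-1)*(1-p)^((3/8:ℝ)-1)))
      (volume.restrict (Set.Ioo 0 1)) := fun k _ => (int_beta (by positivity) (by norm_num)).const_mul _
  have hI : IntegrableOn (fun p : ℝ => p^((3/8:ℝ)-1)*(1-p)^((3/8:ℝ)-1)*(1-p*q)^N) (Set.Ioo 0 1) :=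
    (integrableOn_congr_fun e measurableSet_Ioo).2 (integrable_finsetSum _ hi)
  have hv : ∫ p in Set.Ioo (0:ℝ) 1, p^((3/8:ℝ)-1)*(1-p)^((3/8:ℝ)-1)*(1-p*q)^N =
      ∑ k ∈ Finset.range (N+1), (N.choose k : ℝ) * (-q)^k * beta (3/8+k) (3/8) := by
    rw [setIntegral_congr_fun measurableSet_Ioo e, MeasureTheory.integral_finsetSum _ hi]
    refine Finset.sum_congr rfl (fun k _ => ?_)
    rw [MeasureTheory.integral_const_mul, beta_i (by positivity) (by norm_num)]
  have hnn : ∀ p ∈ Set.Ioo (0:ℝ) 1, 0 ≤ p^((3/8:ℝ)-1)*(1-p)^((3/8:ℝ)-1)*(1-p*q)^N := by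
    intro p hp
    have := hp.1
    have : 0 < 1 - p := by linarith [hp.2]
    have : 0 < 1 - p*q := by nlinarith [hp.2]
    positivity
  rw [← hv]
  refine ⟨(ofReal_integral_eq_lintegral_ofReal hI ?_).symm, setIntegral_nonneg measurableSet_Ioo hnn⟩
  filter_upwards [ae_restrict_mem measurableSet_Ioo] with p hp using hnn p hp

open ProbabilityTheory in
lemma JN (N : ℕ) :
    ∫⁻ q in Set.Ioo (0:ℝ) 1, ENNReal.ofReal (q^((3/8:ℝ)-1)*(1-q)^((5/8:ℝ)-1)) *
      ∫⁻ p in Set.Ioo (0:ℝ) 1, ENNReal.ofReal (p^((3/8:ℝ)-1)*(1-p)^((3/8:ℝ)-1)*(1-p*q)^N) =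
      ENNReal.ofReal (beta (3/8) (3/8) * beta (3/8) (5/8) * ∑ k ∈ Finset.range (N+1), (N.choose k : ℝ) * (-1)^k * ek k) := by
  have e0 : ∀ q ∈ Set.Ioo (0:ℝ) 1, q^((3/8:ℝ)-1)*(1-q)^((5/8:ℝ)-1) *
      (∑ k ∈ Finset.range (N+1), (N.choose k : ℝ) * (-q)^k * beta (3/8+k) (3/8)) =
      ∑ k ∈ Finset.range (N+1), ((N.choose k : ℝ) * (-1)^k * beta (3/8+k) (3/8)) * (q^((3/8:ℝ)+k-1)*(1-q)^((5/8:ℝ)-1)) := by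
    intro q hq
    rw [Finset.mul_sum]
    refine Finset.sum_congr rfl (fun k _ => ?_)
    have e2 : (3/8:ℝ)+k-1 = (3/8-1) + k := by ring
    rw [e2, Real.rpow_add hq.1, Real.rpow_natCast, neg_pow]; ring
  have hi : ∀ k ∈ Finset.range (N+1), Integrable (fun q : ℝ => ((N.choose k : ℝ) * (-1)^k * beta (3/8+k) (3/8)) * (q^((3/8:ℝ)+k-1)*(1-q)^((5/8:ℝ)-1)))
      (volume.restrict (Set.Ioo 0 1)) := fun k _ => (int_beta (by positivity) (by norm_num)).const_mul _
  have hI : IntegrableOn (fun q : ℝ => q^((3/8:ℝ)-1)*(1-q)^((5/8:ℝ)-1) *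
      (∑ k ∈ Finset.range (N+1), (N.choose k : ℝ) * (-q)^k * beta (3/8+k) (3/8))) (Set.Ioo 0 1) :=
    (integrableOn_congr_fun e0 measurableSet_Ioo).2 (integrable_finsetSum _ hi)
  have hv : ∫ q in Set.Ioo (0:ℝ) 1, q^((3/8:ℝ)-1)*(1-q)^((5/8:ℝ)-1) *
      (∑ k ∈ Finset.range (N+1), (N.choose k : ℝ) * (-q)^k * beta (3/8+k) (3/8)) =
      beta (3/8) (3/8) * beta (3/8) (5/8) * ∑ k ∈ Finset.range (N+1), (N.choose k : ℝ) * (-1)^k * ek k := by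
    rw [setIntegral_congr_fun measurableSet_Ioo e0, MeasureTheory.integral_finsetSum _ hi, Finset.mul_sum]
    refine Finset.sum_congr rfl (fun k _ => ?_)
    rw [MeasureTheory.integral_const_mul, beta_i (by positivity) (by norm_num), mul_assoc, beta_ek]; ring
  rw [← hv, ofReal_integral_eq_lintegral_ofReal hI]
  · refine setLIntegral_congr_fun measurableSet_Ioo (fun q hq => ?_)
    have := hq.1
    have : 0 < 1 - q := by linarith [hq.2]
    rw [(JN_inner N hq.1 hq.2).1, ← ENNReal.ofReal_mul (by positivity)]
  · filter_upwards [ae_restrict_mem measurableSet_Ioo] with q hq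
    have := hq.1
    have : 0 < 1 - q := by linarith [hq.2]
    have := (JN_inner N hq.1 hq.2).2
    simp only [Pi.zero_apply]
    positivity


open ProbabilityTheory in
lemma RN_l (N : ℕ) :
    ∫⁻ z in Set.Ioo (0:ℝ) 1, ENNReal.ofReal ((z*(1-z))^(-(5/8:ℝ)) * FF z * Qp N (z^2) ((1-z)^2)) =
      ENNReal.ofReal (Mk 0 / (beta (3/8) (3/8) * beta (3/8) (5/8))) *
      ∫⁻ q in Set.Ioo (0:ℝ) 1, ENNReal.ofReal (q^((3/8:ℝ)-1)*(1-q)^((5/8:ℝ)-1)) *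
      ∫⁻ p in Set.Ioo (0:ℝ) 1, ENNReal.ofReal (p^((3/8:ℝ)-1)*(1-p)^((3/8:ℝ)-1)*(1-p*q)^N) := by
  have b1 := beta_pos (show (0:ℝ) < 3/8 by norm_num) (show (0:ℝ) < 3/8 by norm_num)
  have b2 := beta_pos (show (0:ℝ) < 3/8 by norm_num) (show (0:ℝ) < 5/8 by norm_num)
  have b3 := beta_pos (show (0:ℝ) < 1/4 by norm_num) (show (0:ℝ) < 3/8 by norm_num)
  have g1 := Real.Gamma_pos_of_pos (show (0:ℝ) < 3/4 by norm_num)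
  have g2 := Real.Gamma_pos_of_pos (show (0:ℝ) < 1/4 by norm_num)
  have hM : 0 ≤ Mk 0 := by rw [Mk_zero]; positivity
  rw [JN, ← ENNReal.ofReal_mul (by positivity), ← ofReal_integral_eq_lintegral_ofReal (RN_hasint N).1, (RN_hasint N).2]
  · congr 1; field_simp
  · filter_upwards [ae_restrict_mem measurableSet_Ioo] with z hz
    have h0 := hz.1
    have h1 : 0 < 1 - z := by linarith [hz.2]
    have := FF_pos h0.le hz.2
    have := Qp_nonneg (N := N) (sq_nonneg z) (sq_nonneg (1-z))
    simp only [Pi.zero_apply]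
    positivity

lemma Qp_meas (N : ℕ) : Measurable (fun z : ℝ => Qp N (z^2) ((1-z)^2)) := by
  simp only [Qp_diag]; fun_prop

open ProbabilityTheory in
lemma Y_l1 :
    ∫⁻ z in Set.Ioo (0:ℝ) 1, ENNReal.ofReal ((z*(1-z))^(-(5/8:ℝ)) * FF z^2 * FF (1-z)) =
      ENNReal.ofReal (Mk 0 / (beta (3/8) (3/8) * beta (3/8) (5/8))) *
      ∫⁻ q in Set.Ioo (0:ℝ) 1, ENNReal.ofReal (q^((3/8:ℝ)-1)*(1-q)^((5/8:ℝ)-1)) *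
      ∫⁻ p in Set.Ioo (0:ℝ) 1, ENNReal.ofReal (p^((3/8:ℝ)-1)*(1-p)^((3/8:ℝ)-1)) * ENNReal.ofReal (FF (1-p*q)) := by
  have e1 : ∀ z ∈ Set.Ioo (0:ℝ) 1, ENNReal.ofReal ((z*(1-z))^(-(5/8:ℝ)) * FF z^2 * FF (1-z)) =
      ∑' N : ℕ, ENNReal.ofReal (cf N) * ENNReal.ofReal ((z*(1-z))^(-(5/8:ℝ)) * FF z * Qp N (z^2) ((1-z)^2)) := by
    intro z hz
    have h0 := hz.1
    have h1 : 0 < 1 - z := by linarith [hz.2]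
    have hF := FF_pos h0.le hz.2
    have h := (prod_diag hz.1 hz.2).mul_left ((z*(1-z))^(-(5/8:ℝ)) * FF z)
    rw [show (z*(1-z))^(-(5/8:ℝ)) * FF z^2 * FF (1-z) = (z*(1-z))^(-(5/8:ℝ)) * FF z * (FF z * FF (1-z)) by ring,
      ofReal_hasSum (fun n => ?_) h]
    · refine tsum_congr (fun N => ?_)
      rw [← ENNReal.ofReal_mul (cf_pos N).le]; congr 1; ring
    · have := cf_pos n
      have := Qp_nonneg (N := n) (sq_nonneg z) (sq_nonneg (1-z))
      positivity
  have hm : ∀ N : ℕ, AEMeasurable (fun z : ℝ => ENNReal.ofReal ((z*(1-z))^(-(5/8:ℝ)) * FF z * Qp N (z^2) ((1-z)^2)))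
      (volume.restrict (Set.Ioo 0 1)) := fun N => by
    have := FF_aesm.aemeasurable
    have := (Qp_meas N).aemeasurable (μ := (volume.restrict (Set.Ioo (0:ℝ) 1)))
    fun_prop
  rw [setLIntegral_congr_fun measurableSet_Ioo e1, lintegral_tsum (fun N => (hm N).const_mul _)]
  simp_rw [lintegral_const_mul' _ _ ENNReal.ofReal_ne_top, RN_l, mul_left_comm (ENNReal.ofReal (cf _)), ENNReal.tsum_mul_left]
  congr 1
  have hmp : ∀ N : ℕ, Measurable (fun q : ℝ => ∫⁻ p in Set.Ioo (0:ℝ) 1, ENNReal.ofReal (p^((3/8:ℝ)-1)*(1-p)^((3/8:ℝ)-1)*(1-p*q)^N)) := by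
    intro N
    refine Measurable.lintegral_prod_right' (f := fun x : ℝ × ℝ => ENNReal.ofReal (x.2^((3/8:ℝ)-1)*(1-x.2)^((3/8:ℝ)-1)*(1-x.2*x.1)^N)) ?_
    fun_prop
  simp_rw [← lintegral_const_mul' _ _ ENNReal.ofReal_ne_top]
  rw [← lintegral_tsum (fun N => ?_)]
  · refine setLIntegral_congr_fun measurableSet_Ioo (fun q hq => ?_)
    simp_rw [lintegral_const_mul' _ _ ENNReal.ofReal_ne_top, mul_left_comm (ENNReal.ofReal (cf _)), ENNReal.tsum_mul_left]
    congr 1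
    simp_rw [← lintegral_const_mul' _ _ ENNReal.ofReal_ne_top]
    rw [← lintegral_tsum (fun N => by fun_prop)]
    refine setLIntegral_congr_fun measurableSet_Ioo (fun p hp => ?_)
    have := hp.1
    have : 0 < 1 - p := by linarith [hp.2]
    have := hq.1
    have hpq : 0 < p * q := by positivity
    have hpq1 : 0 < 1 - p*q := by nlinarith [hp.2, hq.2]
    have h : HasSum (fun n => cf n * (1-p*q)^n) (FF (1-p*q)) :=
      (FF_summable (z := 1-p*q) (by rw [abs_of_pos hpq1]; linarith)).hasSum
    rw [ofReal_hasSum (fun n => by have := cf_pos n; positivity) h, ← ENNReal.tsum_mul_left]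
    refine tsum_congr (fun N => ?_)
    have := cf_pos N
    rw [← ENNReal.ofReal_mul (by positivity), ← ENNReal.ofReal_mul (by positivity)]
    congr 1; ring
  · have := hmp N
    simp_rw [lintegral_const_mul' _ _ ENNReal.ofReal_ne_top]
    fun_prop

open ProbabilityTheory in
lemma Y_inner {q : ℝ} (hq : q ∈ Set.Ioo (0:ℝ) 1) :
    ∫⁻ p in Set.Ioo (0:ℝ) 1, ENNReal.ofReal (p^((3/8:ℝ)-1)*(1-p)^((3/8:ℝ)-1)) * ENNReal.ofReal (FF (1-p*q)) =
      ENNReal.ofReal (1/(Real.Gamma (3/4) * Real.Gamma (1/4)) * beta (3/8) (3/8)) *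
      ∑' n : ℕ, ENNReal.ofReal (bf (3/8) n * (1-q)^n * beta (1/4+n) (3/8)) := by
  have b1 := beta_pos (show (0:ℝ) < 3/8 by norm_num) (show (0:ℝ) < 3/8 by norm_num)
  have g1 := Real.Gamma_pos_of_pos (show (0:ℝ) < 3/4 by norm_num)
  have g2 := Real.Gamma_pos_of_pos (show (0:ℝ) < 1/4 by norm_num)
  have hq0 := hq.1
  have hq1 : 0 < 1 - q := by linarith [hq.2]
  rw [← binbeta (by norm_num) (by norm_num) (by norm_num) hq1.le (by linarith), ENNReal.ofReal_mul (by positivity)]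
  set c := ENNReal.ofReal (1/(Real.Gamma (3/4) * Real.Gamma (1/4))) with hc
  have e1 : ∀ p ∈ Set.Ioo (0:ℝ) 1, ENNReal.ofReal (p^((3/8:ℝ)-1)*(1-p)^((3/8:ℝ)-1)) * ENNReal.ofReal (FF (1-p*q)) =
      c * ∫⁻ t in Set.Ioo (0:ℝ) 1, ENNReal.ofReal (t^(-(3/4:ℝ)) * (1-t)^(-(1/4:ℝ))) *
        ENNReal.ofReal (p^((3/8:ℝ)-1)*(1-p)^((3/8:ℝ)-1)*((1-t)*(1-p)+(1-t+t*q)*p)^(-(3/8+3/8:ℝ))) := by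
    intro z hz
    have h0 := hz.1
    have h1 : 0 < 1 - z := by linarith [hz.2]
    have hpq1 : 0 < 1 - z*q := by nlinarith [hz.2, hq.2]
    rw [euler hpq1.le (by nlinarith), ← hc, mul_left_comm]
    rw [← lintegral_const_mul _ (by fun_prop)]
    congr 1
    refine setLIntegral_congr_fun measurableSet_Ioo (fun t ht => ?_)
    have h2 := ht.1
    have h3 : 0 < 1 - t := by linarith [ht.2]
    rw [← ENNReal.ofReal_mul (by positivity), ← ENNReal.ofReal_mul (by positivity)]
    congr 1
    rw [show (1-t)*(1-z)+(1-t+t*q)*z = 1 - t*(1-z*q) by ring]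
    norm_num; ring
  rw [setLIntegral_congr_fun measurableSet_Ioo e1, lintegral_const_mul', lintegral_lintegral_swap, mul_assoc]
  · congr 1
    rw [← lintegral_const_mul _ (by fun_prop)]
    refine setLIntegral_congr_fun measurableSet_Ioo (fun t ht => ?_)
    have h2 := ht.1
    have h3 : 0 < 1 - t := by linarith [ht.2]
    have h4 : 0 < 1 - t + t*q := by positivity
    rw [lintegral_const_mul _ (by fun_prop), conf_l (by norm_num) (by norm_num) h3 h4,
        ← ENNReal.ofReal_mul (by positivity), ← ENNReal.ofReal_mul (by positivity)]
    congr 1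
    rw [show (3/8:ℝ)-1 = -(1/4)+-(3/8) by norm_num, Real.rpow_add h3, show 1-t+t*q = 1-t*(1-q) by ring]; norm_num; ring
  · exact Measurable.aemeasurable (by unfold Function.uncurry; fun_prop)
  · exact ENNReal.ofReal_ne_top

open ProbabilityTheory in
lemma Y_l : ∫⁻ z in Set.Ioo (0:ℝ) 1, ENNReal.ofReal ((z*(1-z))^(-(5/8:ℝ)) * FF z^2 * FF (1-z)) =
    ENNReal.ofReal (Real.Gamma (3/8)^5 / (Real.Gamma (3/4)^4 * Real.Gamma (5/8)^3)) := by
  have b1 := beta_pos (show (0:ℝ) < 3/8 by norm_num) (show (0:ℝ) < 3/8 by norm_num)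
  have b2 := beta_pos (show (0:ℝ) < 3/8 by norm_num) (show (0:ℝ) < 5/8 by norm_num)
  have b3 := beta_pos (show (0:ℝ) < 1/4 by norm_num) (show (0:ℝ) < 3/8 by norm_num)
  have g1 := Real.Gamma_pos_of_pos (show (0:ℝ) < 3/4 by norm_num)
  have g2 := Real.Gamma_pos_of_pos (show (0:ℝ) < 1/4 by norm_num)
  have g3 := Real.Gamma_pos_of_pos (show (0:ℝ) < 3/8 by norm_num)
  have g5 := Real.Gamma_pos_of_pos (show (0:ℝ) < 5/8 by norm_num)
  have hM : 0 ≤ Mk 0 := by rw [Mk_zero]; positivity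
  have e1 : ∀ q ∈ Set.Ioo (0:ℝ) 1, ENNReal.ofReal (q^((3/8:ℝ)-1)*(1-q)^((5/8:ℝ)-1)) *
      ∫⁻ p in Set.Ioo (0:ℝ) 1, ENNReal.ofReal (p^((3/8:ℝ)-1)*(1-p)^((3/8:ℝ)-1)) * ENNReal.ofReal (FF (1-p*q)) =
      ENNReal.ofReal (1/(Real.Gamma (3/4) * Real.Gamma (1/4)) * beta (3/8) (3/8)) *
      ∑' n : ℕ, ENNReal.ofReal (bf (3/8) n * beta (1/4+n) (3/8)) * ENNReal.ofReal (q^((3/8:ℝ)-1)*(1-q)^((5/8:ℝ)+n-1)) := by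
    intro q hq
    have hq0 := hq.1
    have hq1 : 0 < 1 - q := by linarith [hq.2]
    rw [Y_inner hq, mul_left_comm, ← ENNReal.tsum_mul_left]
    congr 1
    refine tsum_congr (fun n => ?_)
    have h1 := bf_pos (show (0:ℝ) < 3/8 by norm_num) n
    have h2 := beta_pos (show (0:ℝ) < 1/4 + n by positivity) (show (0:ℝ) < 3/8 by norm_num)
    rw [← ENNReal.ofReal_mul (by positivity), ← ENNReal.ofReal_mul (by positivity)]
    congr 1
    rw [show (5/8:ℝ)+n-1 = (5/8-1)+n by ring, Real.rpow_add hq1, Real.rpow_natCast]; ring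
  rw [Y_l1, setLIntegral_congr_fun measurableSet_Ioo e1, lintegral_const_mul' _ _ ENNReal.ofReal_ne_top,
    lintegral_tsum (fun n => by fun_prop)]
  simp_rw [lintegral_const_mul' _ _ ENNReal.ofReal_ne_top]
  have e2 : ∀ n : ℕ, ENNReal.ofReal (bf (3/8) n * beta (1/4+n) (3/8)) *
      ∫⁻ q in Set.Ioo (0:ℝ) 1, ENNReal.ofReal (q^((3/8:ℝ)-1)*(1-q)^((5/8:ℝ)+n-1)) =
      ENNReal.ofReal (Real.Gamma (3/8)^2 / Real.Gamma (3/4)) * ENNReal.ofReal (bf (3/8) n * 1^n * beta (1/4+n) (3/4)) := by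
    intro n
    have h1 := bf_pos (show (0:ℝ) < 3/8 by norm_num) n
    have h2 := beta_pos (show (0:ℝ) < 1/4 + n by positivity) (show (0:ℝ) < 3/8 by norm_num)
    rw [beta_l (by norm_num) (by positivity), ← ENNReal.ofReal_mul (by positivity), ← ENNReal.ofReal_mul (by positivity)]
    congr 1
    have h3 := Real.Gamma_pos_of_pos (show (0:ℝ) < 5/8 + n by positivity)
    simp only [beta]
    rw [show (1/4+n+3/8:ℝ) = 5/8+n by ring, show (3/8+(5/8+n):ℝ) = 1/4+n+3/4 by ring]
    field_simp
    simp
  simp_rw [e2, ENNReal.tsum_mul_left]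
  rw [← binbeta (by norm_num) (by norm_num) (by norm_num) zero_le_one le_rfl]
  have e3 : ∀ x ∈ Set.Ioo (0:ℝ) 1, ENNReal.ofReal (x^((1/4:ℝ)-1) * (1-x)^((3/4:ℝ)-1) * (1-x*1)^(-(3/8:ℝ))) =
      ENNReal.ofReal (x^((1/4:ℝ)-1) * (1-x)^((3/8:ℝ)-1)) := by
    intro x hx
    have : 0 < 1 - x := by linarith [hx.2]
    rw [mul_one, mul_assoc, ← Real.rpow_add this]; norm_num
  rw [setLIntegral_congr_fun measurableSet_Ioo e3, beta_l (by norm_num) (by norm_num), ← ENNReal.ofReal_mul (by positivity),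
    ← ENNReal.ofReal_mul (by positivity), ← ENNReal.ofReal_mul (by positivity)]
  congr 1
  rw [Mk_zero]
  simp only [beta]
  norm_num
  field_simp


lemma rpow_nh {x : ℝ} (hx : 0 ≤ x) : x^(-(1/2:ℝ)) = 1/√x := by
  rw [Real.rpow_neg hx, ← Real.sqrt_eq_rpow, one_div]

lemma ck_pos {k : ℝ} (hk : 0 ≤ k) (hk1 : k < 1) (φ : ℝ) : 0 < 1 - k^2 * Real.sin φ^2 := by
  have := Real.sin_sq_le_one φ
  have : k^2 < 1 := by nlinarith
  nlinarith [sq_nonneg k, sq_nonneg (Real.sin φ)]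

noncomputable def Lk (k : ℝ) : ℝ := ∫ θ in (0:ℝ)..π, (1 + k^2 + 2*k*Real.cos θ)^(-(1/2:ℝ))

lemma Lk_pos {k : ℝ} (hk : 0 ≤ k) (hk1 : k < 1) (θ : ℝ) : 0 < 1 + k^2 + 2*k*Real.cos θ := by
  have := Real.neg_one_le_cos θ
  nlinarith [sq_pos_of_pos (show 0 < 1 - k by linarith)]

lemma Lk_cont {k : ℝ} (hk : 0 ≤ k) (hk1 : k < 1) : Continuous (fun θ : ℝ => (1 + k^2 + 2*k*Real.cos θ)^(-(1/2:ℝ))) := by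
  refine Continuous.rpow_const (by fun_prop) (fun θ => Or.inl (Lk_pos hk hk1 θ).ne')

lemma K_cont {k : ℝ} (hk : 0 ≤ k) (hk1 : k < 1) : Continuous (fun θ : ℝ => (1 - k^2 * Real.sin θ^2)^(-(1/2:ℝ))) := by
  refine Continuous.rpow_const (by fun_prop) (fun θ => Or.inl (ck_pos hk hk1 θ).ne')

lemma K_full {k : ℝ} (hk : 0 ≤ k) (hk1 : k < 1) :
    ∫ θ in (0:ℝ)..π, (1 - k^2 * Real.sin θ^2)^(-(1/2:ℝ)) = 2 * ellipticK k := by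
  have hc := K_cont hk hk1
  rw [← intervalIntegral.integral_add_adjacent_intervals (b := π/2) (hc.intervalIntegrable _ _) (hc.intervalIntegrable _ _)]
  have h := intervalIntegral.integral_comp_sub_left (a := 0) (b := π/2) (fun θ : ℝ => (1 - k^2 * Real.sin θ^2)^(-(1/2:ℝ))) π
  simp only [Real.sin_pi_sub, sub_zero] at h
  rw [show π - π/2 = π/2 by ring] at h
  rw [← h, ellipticK]; ring

lemma Lk_eq1 {k : ℝ} (hk : 0 ≤ k) (hk1 : k < 1) : Lk k = 2 * ellipticK k := by
  have hks : ∀ φ, |k * Real.sin φ| < 1 := fun φ => by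
    rw [abs_mul, abs_of_nonneg hk]
    have := Real.abs_sin_le_one φ
    nlinarith [abs_nonneg (Real.sin φ)]
  have hcpos : ∀ φ, 0 < √(1 - k^2 * Real.sin φ^2) := fun φ => Real.sqrt_pos.2 (ck_pos hk hk1 φ)
  have hsum : ∀ φ, 0 < √(1 - k^2 * Real.sin φ^2) + k * Real.cos φ := fun φ => by
    have h1 := Real.sq_sqrt (ck_pos hk hk1 φ).le
    have h2 := Real.sin_sq_add_cos_sq φ
    have h3 := hcpos φ
    by_contra h
    push Not at h
    have : k^2 < 1 := by nlinarith
    nlinarith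
  have h := intervalIntegral.integral_comp_mul_deriv (a := 0) (b := π) (f := fun φ => φ + Real.arcsin (k * Real.sin φ))
    (f' := fun φ => (√(1 - k^2 * Real.sin φ^2) + k * Real.cos φ) / √(1 - k^2 * Real.sin φ^2))
    (g := fun θ : ℝ => (1 + k^2 + 2*k*Real.cos θ)^(-(1/2:ℝ))) ?_ ?_ (Lk_cont hk hk1)
  · simp only [Real.sin_zero, Real.sin_pi, mul_zero, Real.arcsin_zero, add_zero] at h
    rw [Lk, ← h, ← K_full hk hk1]
    refine intervalIntegral.integral_congr (fun φ _ => ?_)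
    simp only [Function.comp]
    have hc := hcpos φ
    have h1 := Real.sq_sqrt (ck_pos hk hk1 φ).le
    have hs := hsum φ
    have ha := abs_lt.1 (hks φ)
    have e : 1 + k^2 + 2*k*Real.cos (φ + Real.arcsin (k * Real.sin φ)) = (√(1 - k^2 * Real.sin φ^2) + k * Real.cos φ)^2 := by
      rw [Real.cos_add, Real.sin_arcsin ha.1.le ha.2.le, Real.cos_arcsin, mul_pow]
      have h2 := Real.sin_sq_add_cos_sq φ
      have h3 : Real.cos φ^2 = 1 - Real.sin φ^2 := by linarith
      ring_nf
      ring_nf at h1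
      rw [h1, h3]; ring
    rw [e, rpow_nh (by positivity), rpow_nh (ck_pos hk hk1 φ).le, Real.sqrt_sq hs.le]
    field_simp
  · intro φ _
    have ha := abs_lt.1 (hks φ)
    have d := (hasDerivAt_id φ).add ((Real.hasDerivAt_arcsin ha.1.ne' ha.2.ne).comp φ ((Real.hasDerivAt_sin φ).const_mul k))
    refine hda d (fun _ => rfl) ?_
    have hc := hcpos φ
    rw [mul_pow]
    field_simp
  · refine Continuous.continuousOn ?_
    refine Continuous.div (by fun_prop) (by fun_prop) (fun φ => (hcpos φ).ne')

lemma Lk_eq2 {k : ℝ} (hk : 0 ≤ k) (hk1 : k < 1) : Lk k = 2/(1+k) * ellipticK (2*√k/(1+k)) := by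
  have h := intervalIntegral.integral_comp_mul_left (a := 0) (b := π/2) (c := 2) (fun θ : ℝ => (1 + k^2 + 2*k*Real.cos θ)^(-(1/2:ℝ))) (by norm_num)
  rw [mul_zero, show 2*(π/2) = π by ring, smul_eq_mul] at h
  change _ = _ * Lk k at h
  have e : ∀ x : ℝ, (1 + k^2 + 2*k*Real.cos (2*x))^(-(1/2:ℝ)) = (1/(1+k)) * (1 - (2*√k/(1+k))^2 * Real.sin x^2)^(-(1/2:ℝ)) := by
    intro x
    have h0 := Lk_pos hk hk1 (2*x)
    have e1 : 1 - (2*√k/(1+k))^2 * Real.sin x^2 = (1 + k^2 + 2*k*Real.cos (2*x)) / (1+k)^2 := by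
      rw [div_pow, mul_pow, Real.sq_sqrt hk, Real.cos_two_mul]
      have := Real.sin_sq_add_cos_sq x
      have h3 : Real.cos x^2 = 1 - Real.sin x^2 := by linarith
      have hk0 : (1+k) ≠ 0 := by linarith
      rw [h3]
      field_simp; ring
    rw [e1, rpow_nh h0.le, rpow_nh (by positivity), Real.sqrt_div h0.le, Real.sqrt_sq (by linarith)]
    have := Real.sqrt_pos.2 h0
    field_simp
  simp only [e] at h
  rw [intervalIntegral.integral_const_mul] at h
  change 1/(1+k) * ellipticK (2*√k/(1+k)) = _ at h
  have : Lk k = 2 * (1/(1+k) * ellipticK (2*√k/(1+k))) := by rw [h]; ring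
  rw [this]; ring

lemma landen {k : ℝ} (hk : 0 ≤ k) (hk1 : k < 1) : ellipticK (2*√k/(1+k)) = (1+k) * ellipticK k := by
  have h := (Lk_eq1 hk hk1).symm.trans (Lk_eq2 hk hk1)
  have : 0 < 1 + k := by linarith
  field_simp at h
  linarith

lemma cos_pow_rec (n : ℕ) : ∫ x in (0:ℝ)..π, Real.cos x^(n+2) = (n+1)/(n+2) * ∫ x in (0:ℝ)..π, Real.cos x^n := by
  rw [integral_cos_pow]; simp

lemma cos_odd (m : ℕ) : ∫ x in (0:ℝ)..π, Real.cos x^(2*m+1) = 0 := by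
  induction m with
  | zero => simp
  | succ m ih => rw [show 2*(m+1)+1 = 2*m+1+2 by ring, cos_pow_rec, ih, mul_zero]

lemma cos_even (m : ℕ) : bf (1/2) (2*m) * ∫ x in (0:ℝ)..π, Real.cos x^(2*m) = π * cf m := by
  induction m with
  | zero => simp [bf, cf]
  | succ m ih =>
    rw [show 2*(m+1) = 2*m+2 by ring, cos_pow_rec]
    simp only [cf]
    have : bf (1/2) (2*m+2) = bf (1/2) (2*m) * ((1/2+2*m)*(1/2+2*m+1)/((2*m+1)*(2*m+2))) := by
      simp only [bf]; push_cast; field_simp; ring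
    rw [this]
    calc _ = (bf (1/2) (2*m) * ∫ x in (0:ℝ)..π, Real.cos x^(2*m)) * ((1/2+2*m)*(1/2+2*m+1)/((2*m+1)*(2*m+2)) * ((2*m+1)/(2*m+2))) := by push_cast; ring
      _ = _ := by rw [ih]; field_simp; ring

lemma F_int {s : ℝ} (hs : 0 ≤ s) (hs1 : s < 1) : ∫ θ in (0:ℝ)..π, (1 + s*Real.cos θ)^(-(1/2:ℝ)) = π * FF (s^2) := by
  have hab : ∀ θ : ℝ, |-(s*Real.cos θ)| ≤ s := fun θ => by
    rw [abs_neg, abs_mul, abs_of_nonneg hs]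
    exact mul_le_of_le_one_right hs (Real.abs_cos_le_one θ)
  have h := intervalIntegral.hasSum_integral_of_dominated_convergence (μ := volume) (a := 0) (b := π)
    (F := fun (n : ℕ) (θ : ℝ) => bf (1/2) n * (-(s*Real.cos θ))^n) (f := fun θ => (1 + s*Real.cos θ)^(-(1/2:ℝ)))
    (fun n _ => bf (1/2) n * s^n) (fun n => (Continuous.aestronglyMeasurable (by fun_prop)))
    (fun n => Filter.Eventually.of_forall fun θ _ => ?_) (Filter.Eventually.of_forall fun θ _ => ?_) ?_
    (Filter.Eventually.of_forall fun θ _ => ?_)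
  · have e : ∀ n : ℕ, ∫ θ in (0:ℝ)..π, bf (1/2) n * (-(s*Real.cos θ))^n = bf (1/2) n * (-s)^n * ∫ θ in (0:ℝ)..π, Real.cos θ^n := by
      intro n
      rw [← intervalIntegral.integral_const_mul]
      refine intervalIntegral.integral_congr (fun θ _ => ?_)
      simp only [← neg_mul, mul_pow]; ring
    simp only [e] at h
    have hinj : Function.Injective (fun m : ℕ => 2*m) := fun a b h => by simpa using h
    rw [← hinj.hasSum_iff] at h
    · refine h.unique ?_
      have h2 : HasSum (fun n => π * (cf n * (s^2)^n)) (π * FF (s^2)) :=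
        (FF_summable (z := s^2) (by rw [abs_of_nonneg (by positivity)]; nlinarith)).hasSum.mul_left π
      have h3 : ((fun n => bf (1 / 2) n * (-s) ^ n * ∫ (θ : ℝ) in 0..π, Real.cos θ ^ n) ∘ fun m => 2 * m) =
          fun n => π * (cf n * (s^2)^n) := by
        funext m
        simp only [Function.comp]
        rw [pow_mul (-s), neg_sq, mul_right_comm, cos_even]; ring
      rw [h3]; exact h2
    · intro n hn
      obtain ⟨m, rfl | rfl⟩ := Nat.even_or_odd' n
      · exact absurd ⟨m, rfl⟩ hn
      · rw [cos_odd, mul_zero]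
  · rw [norm_mul, norm_pow, Real.norm_of_nonneg (bf_pos (by norm_num) n).le, Real.norm_eq_abs]
    have := bf_pos (show (0:ℝ) < 1/2 by norm_num) n
    gcongr; exact hab θ
  · exact (hasSum_binom (1/2) (x := s) (by rwa [abs_of_nonneg hs])).summable
  · exact intervalIntegrable_const
  · have := hasSum_binom (1/2) (x := -(s*Real.cos θ)) (lt_of_le_of_lt (hab θ) hs1)
    rwa [sub_neg_eq_add] at this

lemma F_K {k : ℝ} (hk : 0 ≤ k) (hk1 : k < 1) : π * FF (4*k^2/(1+k^2)^2) = 2 * √(1+k^2) * ellipticK k := by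
  have hs : (2*k/(1+k^2)) < 1 := by rw [div_lt_one (by positivity)]; nlinarith [sq_pos_of_pos (show 0 < 1 - k by linarith)]
  rw [show 4*k^2/(1+k^2)^2 = (2*k/(1+k^2))^2 by rw [div_pow]; ring, ← F_int (by positivity) hs]
  have e : ∀ θ : ℝ, (1 + 2*k/(1+k^2)*Real.cos θ)^(-(1/2:ℝ)) = √(1+k^2) * (1 + k^2 + 2*k*Real.cos θ)^(-(1/2:ℝ)) := by
    intro θ
    have h0 := Lk_pos hk hk1 θ
    have e1 : 1 + 2*k/(1+k^2)*Real.cos θ = (1 + k^2 + 2*k*Real.cos θ)/(1+k^2) := by field_simp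
    rw [e1, rpow_nh (by positivity), rpow_nh h0.le, Real.sqrt_div h0.le]
    field_simp
  simp only [e]
  rw [intervalIntegral.integral_const_mul]
  change _ * Lk k = _
  rw [Lk_eq1 hk hk1]; ring

noncomputable def eK' (k : ℝ) : ℝ := ellipticK (√(1-k^2))

lemma K'_eq {k : ℝ} (hk : 0 < k) (hk1 : k < 1) : ellipticK ((1-k)/(1+k)) = (1+k)/2 * eK' k := by
  have hh : 0 < (1-k)/(1+k) := div_pos (by linarith) (by linarith)
  have hh1 : (1-k)/(1+k) < 1 := by rw [div_lt_one (by linarith)]; linarith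
  have h := landen hh.le hh1
  have e : 2*√((1-k)/(1+k))/(1+(1-k)/(1+k)) = √(1-k^2) := by
    have : 1 + (1-k)/(1+k) = 2/(1+k) := by field_simp; ring
    rw [this, show 1-k^2 = (1-k)/(1+k) * (1+k)^2 by field_simp; ring, Real.sqrt_mul hh.le, Real.sqrt_sq (by linarith)]
    field_simp
  rw [e, show 1 + (1-k)/(1+k) = 2/(1+k) by field_simp; ring] at h
  rw [eK', h]; field_simp

lemma K'_h {k : ℝ} (hk : 0 < k) (hk1 : k < 1) : eK' ((1-k)/(1+k)) = (1+k) * ellipticK k := by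
  rw [← landen hk.le hk1, eK']
  congr 1
  rw [show 1 - ((1-k)/(1+k))^2 = k * (2/(1+k))^2 by field_simp; ring, Real.sqrt_mul hk.le, Real.sqrt_sq (by positivity)]
  ring

lemma F_K' {k : ℝ} (hk : 0 < k) (hk1 : k < 1) : π * FF (1 - 4*k^2/(1+k^2)^2) = √2 * √(1+k^2) * eK' k := by
  have hh : 0 < (1-k)/(1+k) := div_pos (by linarith) (by linarith)
  have hh1 : (1-k)/(1+k) < 1 := by rw [div_lt_one (by linarith)]; linarith
  have h := F_K hh.le hh1
  have e1 : 1 + ((1-k)/(1+k))^2 = 2*(1+k^2)/(1+k)^2 := by field_simp; ring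
  have e2 : 4*((1-k)/(1+k))^2/(1+((1-k)/(1+k))^2)^2 = 1 - 4*k^2/(1+k^2)^2 := by
    rw [e1]; field_simp; ring
  rw [e2, e1, K'_eq hk hk1, Real.sqrt_div (by positivity), Real.sqrt_sq (by linarith), Real.sqrt_mul (by norm_num)] at h
  rw [h]; field_simp


lemma cov_a {s t : Set ℝ} (hs : MeasurableSet s) {f f' : ℝ → ℝ} (hf : ∀ x ∈ s, HasDerivAt f (-f' x) x)
    (hpos : ∀ x ∈ s, 0 ≤ f' x) {g : ℝ → ℝ} (hst : ∀ x ∈ s, f x ∈ t) (hts : ∀ y ∈ t, g y ∈ s)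
    (hgf : ∀ x ∈ s, g (f x) = x) (hfg : ∀ y ∈ t, f (g y) = y) (u : ℝ → ℝ) :
    ∫ x in t, u x = ∫ x in s, f' x * u (f x) := by
  have him : f '' s = t := by
    ext y; constructor
    · rintro ⟨x, hx, rfl⟩; exact hst x hx
    · intro hy; exact ⟨g y, hts y hy, hfg y hy⟩
  have hinj : Set.InjOn f s := fun x hx y hy h => by rw [← hgf x hx, ← hgf y hy, h]
  rw [← him, integral_image_eq_integral_abs_deriv_smul hs (fun x hx => (hf x hx).hasDerivWithinAt) hinj]
  refine setIntegral_congr_fun hs (fun x hx => ?_)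
  simp only [abs_neg, abs_of_nonneg (hpos x hx), smul_eq_mul]

lemma root8 {c : ℝ} (hc : 0 < c) : ∃ C : ℝ, 0 < C ∧ c = C^8 :=
  ⟨c^((1:ℝ)/8), by positivity, by rw [← Real.rpow_natCast, ← Real.rpow_mul hc.le]; norm_num⟩

lemma r8 {C : ℝ} (hC : 0 < C) (r : ℝ) (n : ℕ) (h : r = n/8) : (C^8)^r = C^n := by
  rw [← Real.rpow_natCast C 8, ← Real.rpow_mul hC.le, h, ← Real.rpow_natCast C n]; congr 1; push_cast; ring

lemma r8n {C : ℝ} (hC : 0 < C) (r : ℝ) (n : ℕ) (h : r = n/8) : (C^8)^(-r) = 1/C^n := by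
  rw [Real.rpow_neg (by positivity), r8 hC r n h, one_div]

noncomputable def om (k : ℝ) : ℝ := (1+k^2) * (k*(1-k^2))^(-(1/4:ℝ))

noncomputable def mm (i j : ℕ) : ℝ := ∫ k in Set.Ioo (0:ℝ) 1, om k * ellipticK k^i * eK' k^j

lemma four_q : (4:ℝ)^(1/4:ℝ) = √2 := by
  rw [show (4:ℝ) = 2^(2:ℝ) by norm_num, ← Real.rpow_mul (by norm_num), Real.sqrt_eq_rpow]; norm_num

lemma om_h {k : ℝ} (hk : 0 < k) (hk1 : k < 1) : 2/(1+k)^2 * om ((1-k)/(1+k)) = 2*√2 * om k / (1+k)^3 := by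
  have h1 : 0 < 1 - k := by linarith
  have h2 : 0 < 1 + k := by linarith
  have h3 : 0 < 1 - k^2 := by nlinarith
  have e : (1-k)/(1+k) * (1 - ((1-k)/(1+k))^2) = 4 * (k*(1-k^2)) / (1+k)^4 := by field_simp; ring
  have e2 : ((1+k)^4)^(-(1/4:ℝ)) = 1/(1+k) := by
    rw [← Real.rpow_natCast, ← Real.rpow_mul h2.le]; norm_num; rw [Real.rpow_neg_one]
  have hs : √2^2 = 2 := Real.sq_sqrt (by norm_num)
  rw [om, om, e, Real.div_rpow (by positivity) (by positivity), Real.mul_rpow (by norm_num) (by positivity), e2,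
    Real.rpow_neg (by norm_num) (1/4), four_q]
  have hs0 : 0 < √2 := by positivity
  generalize (k*(1-k^2))^(-(1/4:ℝ)) = A
  field_simp
  rw [hs]; ring

lemma mm_symm {i j : ℕ} (hij : i + j = 3) : mm i j = 2*√2/2^i * mm j i := by
  have h := cov_a (s := Set.Ioo (0:ℝ) 1) (t := Set.Ioo (0:ℝ) 1) measurableSet_Ioo
    (f := fun k => (1-k)/(1+k)) (f' := fun k => 2/(1+k)^2) (g := fun k => (1-k)/(1+k))
    (fun k hk => ?_) (fun k hk => by positivity) (fun k hk => ?_) (fun k hk => ?_) (fun k hk => ?_) (fun k hk => ?_)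
    (fun k => om k * ellipticK k^i * eK' k^j)
  · rw [mm, h, mm, ← MeasureTheory.integral_const_mul]
    refine setIntegral_congr_fun measurableSet_Ioo (fun k hk => ?_)
    have h2 : 0 < 1 + k := by linarith [hk.1]
    rw [← mul_assoc, ← mul_assoc, om_h hk.1 hk.2, K'_eq hk.1 hk.2, K'_h hk.1 hk.2]
    have : (1+k)^3 = (1+k)^i * (1+k)^j := by rw [← pow_add, hij]
    rw [mul_pow, mul_pow, div_pow, this]
    field_simp
  · have h2 : (1 + k) ≠ 0 := by linarith [hk.1]
    have := ((hasDerivAt_id k).const_sub 1).fun_div ((hasDerivAt_id k).const_add 1) h2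
    refine hda this (fun _ => rfl) ?_
    simp only [id]; field_simp; ring
  all_goals have h2 : 0 < 1 + k := by linarith [hk.1]
  · exact ⟨div_pos (by linarith [hk.2]) h2, by rw [div_lt_one h2]; linarith [hk.1]⟩
  · exact ⟨div_pos (by linarith [hk.2]) h2, by rw [div_lt_one h2]; linarith [hk.1]⟩
  · have : 1 + (1-k)/(1+k) = 2/(1+k) := by field_simp; ring
    rw [this]; field_simp; ring
  · have : 1 + (1-k)/(1+k) = 2/(1+k) := by field_simp; ring
    rw [this]; field_simp; ring

lemma I_eq : (∫ t in (0:ℝ)..1, (2 - t) * (ellipticK (Real.sqrt t)) ^ 3 /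
        (2 * (1 - t) ^ ((5:ℝ)/8) * t ^ ((1:ℝ)/4))) = 2*√2 * mm 3 0 := by
  rw [intervalIntegral.integral_of_le zero_le_one, integral_Ioc_eq_integral_Ioo]
  have h := cov_i (s := Set.Ioo (0:ℝ) 1) (t := Set.Ioo (0:ℝ) 1) measurableSet_Ioo
    (f := fun k => 4*k/(1+k)^2) (f' := fun k => 4*(1-k)/(1+k)^3) (g := fun t => (1-√(1-t))/(1+√(1-t)))
    (fun k hk => ?_) (fun k hk => ?_) (fun k hk => ?_) (fun k hk => ?_) (fun k hk => ?_) (fun k hk => ?_)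
    (fun t => (2 - t) * (ellipticK (Real.sqrt t)) ^ 3 / (2 * (1 - t) ^ ((5:ℝ)/8) * t ^ ((1:ℝ)/4)))
  · rw [h, mm, ← MeasureTheory.integral_const_mul]
    refine setIntegral_congr_fun measurableSet_Ioo (fun k hk => ?_)
    have h0 := hk.1
    have h1 : 0 < 1 - k := by linarith [hk.2]
    have h2 : 0 < 1 + k := by linarith
    have e1 : √(4*k/(1+k)^2) = 2*√k/(1+k) := by
      rw [Real.sqrt_div (by positivity), Real.sqrt_sq h2.le, Real.sqrt_mul (by norm_num), show (4:ℝ) = 2^2 by norm_num, Real.sqrt_sq (by norm_num)]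
    rw [e1, landen h0.le hk.2, om]
    have e2 : 1 - 4*k/(1+k)^2 = (1-k)^2/(1+k)^2 := by field_simp; ring
    have e3 : 2 - 4*k/(1+k)^2 = 2*(1+k^2)/(1+k)^2 := by field_simp; ring
    rw [e2, e3, show k*(1-k^2) = k*(1-k)*(1+k) by ring]
    obtain ⟨A, hA, hA'⟩ := root8 h0
    obtain ⟨B, hB, hB'⟩ := root8 h1
    obtain ⟨C, hC, hC'⟩ := root8 h2
    generalize ellipticK k = K
    rw [Real.div_rpow (by positivity) (by positivity), Real.div_rpow (by positivity) (by positivity), Real.mul_rpow (by positivity) (by positivity),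
      Real.mul_rpow (by positivity) (by positivity), Real.mul_rpow (by positivity) (by positivity), four_q, pow_zero, mul_one]
    have hq : ∀ D : ℝ, 0 < D → ((D^8)^2)^((5:ℝ)/8) = D^10 := fun D hD => by
      rw [← pow_mul, ← Real.rpow_natCast, ← Real.rpow_mul hD.le, ← Real.rpow_natCast]; norm_num
    have hq2 : ∀ D : ℝ, 0 < D → ((D^8)^2)^((1:ℝ)/4) = D^4 := fun D hD => by
      rw [← pow_mul, ← Real.rpow_natCast, ← Real.rpow_mul hD.le, ← Real.rpow_natCast]; norm_num
    generalize hX : 1 + k^2 = X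
    rw [hB', hC', hA', hq B hB, hq C hC, hq2 C hC, r8n hA _ 2 (by norm_num), r8n hB _ 2 (by norm_num), r8n hC _ 2 (by norm_num),
      r8 hA _ 2 (by norm_num)]
    have hs : √2^2 = 2 := Real.sq_sqrt (by norm_num)
    have hs0 : 0 < √2 := by positivity
    field_simp
    rw [hs]; ring
  · have h2 : (1 + k) ≠ 0 := by linarith [hk.1]
    have := ((hasDerivAt_id k).const_mul 4).fun_div (((hasDerivAt_id k).const_add 1).fun_pow 2) (pow_ne_zero 2 h2)
    refine hda this (fun _ => rfl) ?_
    simp only [id]; field_simp; ring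
  · have h0 := hk.1
    have h1 : 0 < 1 - k := by linarith [hk.2]
    positivity
  · have h0 := hk.1
    have h1 : 0 < 1 - k := by linarith [hk.2]
    exact ⟨by positivity, by rw [div_lt_one (by positivity)]; nlinarith⟩
  · have h0 := hk.1
    have h1 : 0 < 1 - k := by linarith [hk.2]
    have h3 : 0 < √(1-k) := Real.sqrt_pos.2 h1
    have h4 : √(1-k) < 1 := by rw [Real.sqrt_lt' one_pos]; linarith
    exact ⟨div_pos (by linarith) (by linarith), by rw [div_lt_one (by linarith)]; linarith⟩
  · have h0 := hk.1
    have h1 : 0 < 1 - k := by linarith [hk.2]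
    have e2 : 1 - 4*k/(1+k)^2 = (1-k)^2/(1+k)^2 := by field_simp; ring
    rw [e2, Real.sqrt_div (by positivity), Real.sqrt_sq h1.le, Real.sqrt_sq (by linarith)]
    have : 1 + (1-k)/(1+k) = 2/(1+k) := by field_simp; ring
    rw [this]; field_simp; ring
  · have h1 : 0 < 1 - k := by linarith [hk.2]
    have h3 : 0 < √(1-k) := Real.sqrt_pos.2 h1
    have h5 := Real.sq_sqrt h1.le
    have : 1 + (1-√(1-k))/(1+√(1-k)) = 2/(1+√(1-k)) := by field_simp; ring
    rw [this]; field_simp; linear_combination (-4)*h5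

lemma Y_i : ∫ z in Set.Ioo (0:ℝ) 1, (z*(1-z))^(-(5/8:ℝ)) * FF z^2 * FF (1-z) =
    Real.Gamma (3/8)^5 / (Real.Gamma (3/4)^4 * Real.Gamma (5/8)^3) := by
  have g1 := Real.Gamma_pos_of_pos (show (0:ℝ) < 3/4 by norm_num)
  have g3 := Real.Gamma_pos_of_pos (show (0:ℝ) < 3/8 by norm_num)
  have g5 := Real.Gamma_pos_of_pos (show (0:ℝ) < 5/8 by norm_num)
  rw [integral_eq_lintegral_of_nonneg_ae, Y_l, ENNReal.toReal_ofReal (by positivity)]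
  · filter_upwards [ae_restrict_mem measurableSet_Ioo] with z hz
    have h0 := hz.1
    have h1 : 0 < 1 - z := by linarith [hz.2]
    have := FF_pos h0.le hz.2
    have := FF_pos h1.le (by linarith)
    simp only [Pi.zero_apply]; positivity
  · refine AEStronglyMeasurable.mul (AEStronglyMeasurable.mul (Measurable.aestronglyMeasurable (by fun_prop)) (FF_aesm.pow 2)) ?_
    refine ContinuousOn.aestronglyMeasurable (FF_contOn.comp (by fun_prop) (fun z hz => ?_)) measurableSet_Ioo
    exact ⟨by linarith [hz.2], by linarith [hz.1]⟩

lemma mm_Y : mm 2 1 = π^3 / 2^(17/4:ℝ) * (Real.Gamma (3/8)^5 / (Real.Gamma (3/4)^4 * Real.Gamma (5/8)^3)) := by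
  have h := cov_i (s := Set.Ioo (0:ℝ) 1) (t := Set.Ioo (0:ℝ) 1) measurableSet_Ioo
    (f := fun k => 4*k^2/(1+k^2)^2) (f' := fun k => 8*k*(1-k^2)/(1+k^2)^3) (g := fun z => (1-√(1-z))/√z)
    (fun k hk => ?_) (fun k hk => ?_) (fun k hk => ?_) (fun k hk => ?_) (fun k hk => ?_) (fun k hk => ?_)
    (fun z => (z*(1-z))^(-(5/8:ℝ)) * FF z^2 * FF (1-z))
  · rw [Y_i] at h
    rw [h, mm, ← MeasureTheory.integral_const_mul]
    refine setIntegral_congr_fun measurableSet_Ioo (fun k hk => ?_)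
    have h0 := hk.1
    have h1 : 0 < 1 - k^2 := by nlinarith [hk.2]
    have h2 : 0 < 1 + k^2 := by positivity
    have f1 : FF (4*k^2/(1+k^2)^2) = 2 * √(1+k^2) * ellipticK k / π := by
      rw [← F_K h0.le hk.2]; field_simp
    have f2 : FF (1 - 4*k^2/(1+k^2)^2) = √2 * √(1+k^2) * eK' k / π := by
      rw [← F_K' h0 hk.2]; field_simp
    rw [f1, f2, om]
    generalize ellipticK k = K
    generalize eK' k = K'
    have e2 : 4*k^2/(1+k^2)^2 * (1 - 4*k^2/(1+k^2)^2) = 4 * (k*(1-k^2))^2/((1+k^2)^2)^2 := by field_simp; ring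
    rw [e2]
    have hP : 0 < k*(1-k^2) := by positivity
    rw [show 8*k*(1-k^2) = 8*(k*(1-k^2)) by ring]
    generalize k*(1-k^2) = P at *
    obtain ⟨A, hA, hA'⟩ := root8 hP
    obtain ⟨C, hC, hC'⟩ := root8 h2
    rw [hC', hA']
    obtain ⟨D, hD, hD'⟩ := root8 (show (0:ℝ) < 2 by norm_num)
    have hq : ∀ D : ℝ, 0 < D → ((D^8)^2)^((5:ℝ)/8) = D^10 := fun D hD => by
      rw [← pow_mul, ← Real.rpow_natCast, ← Real.rpow_mul hD.le, ← Real.rpow_natCast]; norm_num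
    have hq2 : (((C^8)^2)^2)^((5:ℝ)/8) = C^20 := by
      rw [← pow_mul, ← pow_mul, ← Real.rpow_natCast, ← Real.rpow_mul hC.le, ← Real.rpow_natCast]; norm_num
    have h4 : (4:ℝ)^((5:ℝ)/8) = D^10 := by
      rw [← hq D hD, ← hD']; norm_num
    have h17 : (2:ℝ)^(17/4:ℝ) = D^34 := by
      rw [hD', r8 hD _ 34 (by norm_num)]
    have hsq : ∀ D : ℝ, 0 < D → √(D^8) = D^4 := fun D hD => by
      rw [show D^8 = (D^4)^2 by ring, Real.sqrt_sq (by positivity)]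
    have hs2 : √2 = D^4 := by rw [← hsq D hD, ← hD']
    rw [r8n hA _ 2 (by norm_num), Real.rpow_neg (by positivity) (5/8), Real.div_rpow (by positivity) (by positivity), Real.mul_rpow (by positivity) (by positivity),
      hq A hA, hq2, h4, h17, hsq C hC, hs2]
    have h8 : (8:ℝ) = D^24 := by rw [show D^24 = (D^8)^3 by ring, ← hD']; norm_num
    rw [h8]
    have hpi := Real.pi_pos
    field_simp
    rw [show D^16 = (D^8)^2 by ring, ← hD']
  · have h2 : (1 + k^2) ≠ 0 := by positivity
    have := (((hasDerivAt_id k).fun_pow 2).const_mul 4).fun_div ((((hasDerivAt_id k).fun_pow 2).const_add 1).fun_pow 2) (pow_ne_zero 2 h2)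
    refine hda this (fun _ => rfl) ?_
    simp only [id]; field_simp; ring
  · have h0 := hk.1
    have h1 : 0 < 1 - k^2 := by nlinarith [hk.2]
    positivity
  · have h0 := hk.1
    have h1 : 0 < 1 - k^2 := by nlinarith [hk.2]
    exact ⟨by positivity, by rw [div_lt_one (by positivity)]; nlinarith⟩
  · have h0 := hk.1
    have h1 : 0 < 1 - k := by linarith [hk.2]
    have h3 : 0 < √(1-k) := Real.sqrt_pos.2 h1
    have h3' : 0 < √k := Real.sqrt_pos.2 h0
    have h4 : √(1-k) < 1 := by rw [Real.sqrt_lt' one_pos]; linarith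
    have h5 := Real.sq_sqrt h1.le
    have h6 := Real.sq_sqrt h0.le
    exact ⟨div_pos (by linarith) (by linarith), by rw [div_lt_one h3']; nlinarith⟩
  · have h0 := hk.1
    have h1 : 0 < 1 - k^2 := by nlinarith [hk.2]
    have e2 : 1 - 4*k^2/(1+k^2)^2 = ((1-k^2)/(1+k^2))^2 := by field_simp; ring
    have e3 : 4*k^2/(1+k^2)^2 = (2*k/(1+k^2))^2 := by field_simp; ring
    rw [e2, e3, Real.sqrt_sq (by positivity), Real.sqrt_sq (by positivity)]
    field_simp; ring
  · have h0 := hk.1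
    have h1 : 0 < 1 - k := by linarith [hk.2]
    have h3 : 0 < √(1-k) := Real.sqrt_pos.2 h1
    have h3' : 0 < √k := Real.sqrt_pos.2 h0
    have h5 := Real.sq_sqrt h1.le
    have h6 := Real.sq_sqrt h0.le
    have h4 : √(1-k) < 1 := by rw [Real.sqrt_lt' one_pos]; linarith
    have e : 1 + ((1-√(1-k))/√k)^2 = 2*(1-√(1-k))/k := by
      rw [div_pow, h6]; field_simp; linear_combination h5
    have h7 : 1 - √(1-k) ≠ 0 := by linarith
    rw [e, div_pow, h6]
    field_simp
    norm_num


noncomputable def ab (r : ℝ) (u : ℝ) : ℝ := (Set.Ioo (-1:ℝ) 1).indicator (fun u => |u|^(-r)) u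

lemma ab_nonneg (r u : ℝ) : 0 ≤ ab r u := Set.indicator_nonneg (fun _ _ => by positivity) _

lemma ab_int {r : ℝ} (hr : r < 1) : Integrable (ab r) := by
  unfold ab
  rw [integrable_indicator_iff measurableSet_Ioo]
  have h1 : IntegrableOn (fun u : ℝ => |u|^(-r)) (Set.Ioo 0 1) := by
    have := (intervalIntegrable_iff_integrableOn_Ioo_of_le (zero_le_one)).1
      (intervalIntegral.intervalIntegrable_rpow' (a := 0) (b := 1) (r := -r) (by linarith))
    refine (integrableOn_congr_fun (fun u hu => ?_) measurableSet_Ioo).1 this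
    simp only [abs_of_pos hu.1]
  have h2 : IntegrableOn (fun u : ℝ => |u|^(-r)) (Set.Ioo (-1) 0) := by
    have := (integrable_indicator_iff measurableSet_Ioo).2 h1
    have h3 := this.comp_neg
    rw [← integrable_indicator_iff measurableSet_Ioo]
    refine h3.congr (Filter.Eventually.of_forall fun u => ?_)
    simp only [Set.indicator, Set.mem_Ioo, abs_neg]
    congr 1
    apply propext; constructor <;> rintro ⟨a, b⟩ <;> constructor <;> linarith
  have h3 : IntegrableOn (fun u : ℝ => |u|^(-r)) {0} := by
    exact IntegrableOn.of_measure_zero (by simp)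
  refine ((h1.union h2).union h3).mono_set (fun u hu => ?_)
  rcases lt_trichotomy u 0 with h | h | h
  · exact Or.inl (Or.inr ⟨hu.1, h⟩)
  · exact Or.inr h
  · exact Or.inl (Or.inl ⟨h, hu.2⟩)

lemma abs_le_ab {r : ℝ} (hr : 0 < r) (u : ℝ) : |u|^(-r) ≤ 1 + ab r u := by
  by_cases h : u ∈ Set.Ioo (-1:ℝ) 1
  · rw [ab, Set.indicator_of_mem h]; linarith
  · rw [ab, Set.indicator_of_notMem h, add_zero]
    have : 1 ≤ |u| := by
      by_contra h'
      push Not at h'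
      exact h (abs_lt.1 h')
    exact Real.rpow_le_one_of_one_le_of_nonpos this (by linarith)

lemma two_pt {a b d : ℝ} (ha : 0 < a) (hb : 0 < b) (hd : 0 < d) (h : d ≤ a + b) :
    a^(-(1/2:ℝ)) * b^(-(1/2:ℝ)) ≤ (d/2)^(-(1/12:ℝ)) * (a^(-(11/12:ℝ)) + b^(-(11/12:ℝ))) := by
  wlog hab : a ≤ b generalizing a b
  · have := this hb ha (by linarith) (by linarith)
    linarith
  have h1 : d/2 ≤ b := by linarith
  calc a^(-(1/2:ℝ)) * b^(-(1/2:ℝ)) = a^(-(1/2:ℝ)) * (b^(-(1/12:ℝ)) * b^(-(5/12:ℝ))) := by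
        rw [← Real.rpow_add hb]; norm_num
    _ ≤ a^(-(1/2:ℝ)) * ((d/2)^(-(1/12:ℝ)) * a^(-(5/12:ℝ))) := by
        have e1 := Real.rpow_le_rpow_of_nonpos (z := -(1/12:ℝ)) (by positivity) h1 (by norm_num)
        have e2 := Real.rpow_le_rpow_of_nonpos (z := -(5/12:ℝ)) ha hab (by norm_num)
        gcongr
    _ = (d/2)^(-(1/12:ℝ)) * a^(-(11/12:ℝ)) := by
        rw [mul_left_comm, ← Real.rpow_add ha]; norm_num
    _ ≤ _ := by
        have : 0 ≤ b^(-(11/12:ℝ)) := by positivity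
        gcongr; linarith

noncomputable def Ai (x v : ℝ) : ℝ := (v*(1-v))^(-(1/2:ℝ)) * |x*v-1|^(-(1/2:ℝ))

lemma Ai_bd {x v : ℝ} (hx : x ≠ 0) (hx1 : x ≠ 1) (hv : v ∈ Set.Ioo (0:ℝ) 1) :
    Ai x v ≤ 4 * (|x|^(-(5/12:ℝ)) * (1 + |x-1|^(-(1/12:ℝ)))) *
      (v^(-(11/12:ℝ)) + (1-v)^(-(11/12:ℝ)) + (1 + ab (11/12) (v - 1/x))) := by
  have h0 := hv.1
  have h1 : 0 < 1 - v := by linarith [hv.2]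
  have hxp : 0 < |x| := abs_pos.2 hx
  have hxp1 : 0 < |x-1| := abs_pos.2 (sub_ne_zero.2 hx1)
  have hab := ab_nonneg (11/12) (v-1/x)
  have hle := abs_le_ab (show (0:ℝ) < 11/12 by norm_num) (v-1/x)
  rcases eq_or_ne (x*v-1) 0 with h | h
  · rw [Ai, h, abs_zero, Real.zero_rpow (by norm_num), mul_zero]; positivity
  have e : |x*v-1| = |x| * |v-1/x| := by rw [← abs_mul]; congr 1; field_simp
  have hm : 0 < |v-1/x| := by
    have : 0 < |x*v-1| := abs_pos.2 h
    rw [e] at this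
    exact pos_of_mul_pos_right this hxp.le
  rw [Ai, e, Real.mul_rpow hxp.le hm.le, Real.mul_rpow h0.le h1.le]
  have t1 := two_pt h0 hm (d := 1/|x|) (by positivity) (by
    rw [← abs_one, ← abs_div]
    have := abs_sub_abs_le_abs_sub (1/x) v
    rw [abs_sub_comm, abs_of_pos h0] at this
    linarith)
  have t2 := two_pt h1 hm (d := |x-1|/|x|) (by positivity) (by
    have e3 : |x-1|/|x| = |(1-v)+(v-1/x)| := by rw [← abs_div]; congr 1; field_simp; ring
    rw [e3]
    refine (abs_add_le _ _).trans ?_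
    rw [abs_of_pos h1])
  have half : ∀ y : ℝ, 1/2 ≤ y → y^(-(1/2:ℝ)) ≤ 2 := fun y hy => by
    refine (Real.rpow_le_rpow_of_nonpos (by norm_num) hy (by norm_num)).trans ?_
    rw [rpow_nh (by norm_num)]
    have : 1/2 ≤ √(1/2:ℝ) := Real.le_sqrt_of_sq_le (by norm_num)
    rw [div_le_iff₀ (by linarith)]; linarith
  have c12 : ∀ y : ℝ, 0 < y → (y/2)^(-(1/12:ℝ)) ≤ 2 * y^(-(1/12:ℝ)) := fun y hy => by
    rw [Real.div_rpow hy.le (by norm_num), div_eq_mul_inv, mul_comm, ← Real.rpow_neg (by norm_num), neg_neg]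
    gcongr
    calc (2:ℝ)^(1/12:ℝ) ≤ 2^(1:ℝ) := Real.rpow_le_rpow_of_exponent_le (by norm_num) (by norm_num)
      _ = 2 := by norm_num
  have d1 : |x|^(-(1/2:ℝ)) * (1/|x|)^(-(1/12:ℝ)) = |x|^(-(5/12:ℝ)) := by
    rw [one_div |x|, Real.inv_rpow hxp.le, ← Real.rpow_neg hxp.le, ← Real.rpow_add hxp]; norm_num
  have d2 : |x|^(-(1/2:ℝ)) * (|x-1|/|x|)^(-(1/12:ℝ)) = |x|^(-(5/12:ℝ)) * |x-1|^(-(1/12:ℝ)) := by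
    rw [← d1, Real.div_rpow hxp1.le hxp.le, one_div |x|, Real.inv_rpow hxp.le]; ring
  have key : ∀ d : ℝ, 0 < d → ∀ a b m E : ℝ, 0 < a → 0 < b → 0 < m → 1/2 ≤ b →
      a^(-(1/2:ℝ)) * m^(-(1/2:ℝ)) ≤ (d/2)^(-(1/12:ℝ)) * E → 0 ≤ E → 
      a^(-(1/2:ℝ)) * b^(-(1/2:ℝ)) * (|x|^(-(1/2:ℝ)) * m^(-(1/2:ℝ))) ≤ 4 * (|x|^(-(1/2:ℝ)) * d^(-(1/12:ℝ))) * E := by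
    intro d hd a b m E ha hb hm hb2 ht hE
    calc _ = (a^(-(1/2:ℝ)) * m^(-(1/2:ℝ))) * b^(-(1/2:ℝ)) * |x|^(-(1/2:ℝ)) := by ring
      _ ≤ ((2 * d^(-(1/12:ℝ))) * E) * 2 * |x|^(-(1/2:ℝ)) := by
        have := half b hb2
        have := c12 d hd
        have : (d/2)^(-(1/12:ℝ)) * E ≤ (2 * d^(-(1/12:ℝ))) * E := by gcongr
        have : a^(-(1/2:ℝ)) * m^(-(1/2:ℝ)) ≤ (2 * d^(-(1/12:ℝ))) * E := by linarith
        gcongr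
      _ = _ := by ring
  have p0 : 0 ≤ |x|^(-(5/12:ℝ)) := by positivity
  have p1 : 0 ≤ |x-1|^(-(1/12:ℝ)) := by positivity
  have p2 : 0 ≤ v^(-(11/12:ℝ)) := by positivity
  have p3 : 0 ≤ (1-v)^(-(11/12:ℝ)) := by positivity
  have p4 : 0 ≤ |v-1/x|^(-(11/12:ℝ)) := by positivity
  rcases le_total v (1/2) with hh | hh
  · have := key _ (by positivity) v (1-v) _ _ h0 h1 hm (by linarith) t1 (by positivity)
    refine this.trans ?_
    rw [d1]
    gcongr ?_ * ?_ 
    · exact mul_le_mul_of_nonneg_left (le_mul_of_one_le_right p0 (by linarith)) (by norm_num)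
    · linarith
  · have := key _ (by positivity) (1-v) v _ _ h1 h0 hm (by linarith) t2 (by positivity)
    rw [mul_comm ((1-v)^_)] at this
    refine this.trans ?_
    rw [d2]
    gcongr ?_ * ?_
    · exact mul_le_mul_of_nonneg_left (mul_le_mul_of_nonneg_left (by linarith) p0) (by norm_num)
    · linarith


lemma hB1 : IntegrableOn (fun v : ℝ => v^(-(11/12:ℝ))) (Set.Ioo 0 1) := by
  have := int_beta (a := 1/12) (b := 1) (by norm_num) (by norm_num)
  refine (integrableOn_congr_fun (fun u hu => ?_) measurableSet_Ioo).1 this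
  norm_num

lemma hB2 : IntegrableOn (fun v : ℝ => (1-v)^(-(11/12:ℝ))) (Set.Ioo 0 1) := by
  have := int_beta (a := 1) (b := 1/12) (by norm_num) (by norm_num)
  refine (integrableOn_congr_fun (fun u hu => ?_) measurableSet_Ioo).1 this
  norm_num

lemma hB3 : IntegrableOn (fun v : ℝ => (v*(1-v))^(-(1/2:ℝ))) (Set.Ioo 0 1) := by
  have := int_beta (a := 1/2) (b := 1/2) (by norm_num) (by norm_num)
  refine (integrableOn_congr_fun (fun u hu => ?_) measurableSet_Ioo).1 this
  rw [Real.mul_rpow hu.1.le (by linarith [hu.2])]; norm_num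

lemma hB4 (c : ℝ) : IntegrableOn (fun v : ℝ => 1 + ab (11/12) (v - c)) (Set.Ioo 0 1) := by
  refine Integrable.add (integrable_const _) ?_
  exact ((ab_int (by norm_num)).comp_sub_right c).integrableOn

lemma Ai_nonneg (x : ℝ) {v : ℝ} (hv : v ∈ Set.Ioo (0:ℝ) 1) : 0 ≤ Ai x v := by
  have := hv.1
  have : 0 < 1 - v := by linarith [hv.2]
  unfold Ai; positivity

lemma Ai_meas (x : ℝ) : Measurable (Ai x) := by unfold Ai; fun_prop

lemma Ai_int {x : ℝ} (hx : x ≠ 0) (hx1 : x ≠ 1) : IntegrableOn (Ai x) (Set.Ioo 0 1) := by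
  have := (((hB1.add hB2).add (hB4 (1/x))).const_mul (4 * (|x|^(-(5/12:ℝ)) * (1 + |x-1|^(-(1/12:ℝ))))))
  refine Integrable.mono' this (Ai_meas x).aestronglyMeasurable ?_
  refine (ae_restrict_iff' measurableSet_Ioo).2 (Filter.Eventually.of_forall fun v hv => ?_)
  rw [Real.norm_of_nonneg (Ai_nonneg x hv)]
  exact Ai_bd hx hx1 hv

noncomputable def Ja (x : ℝ) : ℝ := ∫ v in Set.Ioo 0 1, Ai x v

lemma Ja_nonneg (x : ℝ) : 0 ≤ Ja x := setIntegral_nonneg measurableSet_Ioo fun _ hv => Ai_nonneg x hv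

lemma Ja_bd : ∃ C : ℝ, 0 ≤ C ∧ ∀ x : ℝ, x ≠ 0 → x ≠ 1 →
    Ja x ≤ C * ((1+|x|)^(-(5/12:ℝ)) * (1 + |x-1|^(-(1/12:ℝ)))) := by
  set M1 := ∫ v in Set.Ioo (0:ℝ) 1, v^(-(11/12:ℝ)) with hM1
  set M2 := ∫ v in Set.Ioo (0:ℝ) 1, (1-v)^(-(11/12:ℝ)) with hM2
  set M3 := ∫ v in Set.Ioo (0:ℝ) 1, (v*(1-v))^(-(1/2:ℝ)) with hM3
  set M4 := ∫ u, ab (11/12) u with hM4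
  have q1 : 0 ≤ M1 := setIntegral_nonneg measurableSet_Ioo fun v hv => by
    have := hv.1; positivity
  have q2 : 0 ≤ M2 := setIntegral_nonneg measurableSet_Ioo fun v hv => by
    have : 0 < 1 - v := by linarith [hv.2]
    positivity
  have q3 : 0 ≤ M3 := setIntegral_nonneg measurableSet_Ioo fun v hv => by
    have := hv.1
    have : 0 < 1 - v := by linarith [hv.2]
    positivity
  have q4 : 0 ≤ M4 := integral_nonneg fun u => ab_nonneg _ u
  have half : ∀ y : ℝ, 1/2 ≤ y → y^(-(1/2:ℝ)) ≤ 2 := fun y hy => by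
    refine (Real.rpow_le_rpow_of_nonpos (by norm_num) hy (by norm_num)).trans ?_
    rw [rpow_nh (by norm_num)]
    have : 1/2 ≤ √(1/2:ℝ) := Real.le_sqrt_of_sq_le (by norm_num)
    rw [div_le_iff₀ (by linarith)]; linarith
  refine ⟨4 * M3 + 12 * (M1 + M2 + (1 + M4)), by positivity, fun x hx hx1 => ?_⟩
  have hxp : 0 < |x| := abs_pos.2 hx
  have pe : 0 ≤ |x-1|^(-(1/12:ℝ)) := by positivity
  have p5 : 0 ≤ (1+|x|)^(-(5/12:ℝ)) := by positivity
  rcases le_total |x| (1/2) with h | h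
  · have s1 : Ja x ≤ 2 * M3 := by
      rw [hM3, ← MeasureTheory.integral_const_mul, Ja]
      refine setIntegral_mono_on (Ai_int hx hx1) (hB3.const_mul 2) measurableSet_Ioo fun v hv => ?_
      have h0 := hv.1
      have h1 : 0 < 1 - v := by linarith [hv.2]
      rw [Ai, mul_comm]
      gcongr
      apply half
      have : x * v ≤ 1/2 := by
        have := (abs_le.1 h).2
        nlinarith
      rw [abs_sub_comm]
      exact le_trans (by linarith) (le_abs_self _)
    have s2 : 1/2 ≤ (1+|x|)^(-(5/12:ℝ)) := by
      calc (1/2:ℝ) = 2^(-1:ℝ) := by norm_num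
        _ ≤ (1+|x|)^(-1:ℝ) := Real.rpow_le_rpow_of_nonpos (by positivity) (by linarith) (by norm_num)
        _ ≤ _ := Real.rpow_le_rpow_of_exponent_le (by linarith) (by norm_num)
    calc Ja x ≤ (4 * M3) * ((1/2) * (1 + 0)) := by linarith
      _ ≤ _ := by gcongr; nlinarith
  · have s1 : Ja x ≤ (4 * (|x|^(-(5/12:ℝ)) * (1 + |x-1|^(-(1/12:ℝ))))) * (M1 + M2 + (1 + M4)) := by
      have h4 : ∫ v in Set.Ioo (0:ℝ) 1, (1 + ab (11/12) (v - 1/x)) ≤ 1 + M4 := by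
        have hi := ((ab_int (show (11/12:ℝ) < 1 by norm_num)).comp_sub_right (1/x))
        rw [MeasureTheory.integral_add (integrable_const _) hi.integrableOn]
        have e1 : ∫ v in Set.Ioo (0:ℝ) 1, (1:ℝ) = 1 := by simp
        rw [e1, hM4, ← integral_sub_right_eq_self (ab (11/12)) (1/x)]
        have := setIntegral_le_integral (s := Set.Ioo (0:ℝ) 1) hi (Filter.Eventually.of_forall fun u => ab_nonneg _ _)
        linarith
      have h5 : Ja x ≤ ∫ v in Set.Ioo (0:ℝ) 1, (4 * (|x|^(-(5/12:ℝ)) * (1 + |x-1|^(-(1/12:ℝ))))) * (v^(-(11/12:ℝ)) + (1-v)^(-(11/12:ℝ)) + (1 + ab (11/12) (v - 1/x))) :=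
        setIntegral_mono_on (Ai_int hx hx1) (((hB1.add hB2).add (hB4 (1/x))).const_mul _) measurableSet_Ioo fun v hv => Ai_bd hx hx1 hv
      refine h5.trans ?_
      rw [MeasureTheory.integral_const_mul]
      gcongr
      have e6 := MeasureTheory.integral_add (hB1.add hB2) (hB4 (1/x))
      have e7 := MeasureTheory.integral_add hB1 hB2
      simp only [Pi.add_apply] at e6
      rw [e6, e7]
      linarith
    have s2 : |x|^(-(5/12:ℝ)) ≤ 3 * (1+|x|)^(-(5/12:ℝ)) := by
      calc |x|^(-(5/12:ℝ)) ≤ ((1+|x|)/3)^(-(5/12:ℝ)) := Real.rpow_le_rpow_of_nonpos (by positivity) (by linarith) (by norm_num)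
        _ = (1+|x|)^(-(5/12:ℝ)) * 3^(5/12:ℝ) := by
          rw [Real.div_rpow (by positivity) (by norm_num), div_eq_mul_inv, ← Real.rpow_neg (by norm_num), neg_neg]
        _ ≤ (1+|x|)^(-(5/12:ℝ)) * 3^(1:ℝ) := by
          gcongr <;> norm_num
        _ = _ := by norm_num; ring
    calc Ja x ≤ _ := s1
      _ ≤ (4 * (3 * (1+|x|)^(-(5/12:ℝ)) * (1 + |x-1|^(-(1/12:ℝ))))) * (M1 + M2 + (1 + M4)) := by gcongr
      _ = (12 * (M1 + M2 + (1 + M4))) * ((1+|x|)^(-(5/12:ℝ)) * (1 + |x-1|^(-(1/12:ℝ)))) := by ring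
      _ ≤ _ := by gcongr; linarith


noncomputable def Dom (x : ℝ) : ℝ :=
  4 * ab (5/8) x + 4 * ab (1/2) (x-1) + 90 * (1+‖x‖)^(-(9/8:ℝ))

lemma Dom_int : Integrable Dom := by
  unfold Dom
  refine Integrable.add (Integrable.add ?_ ?_) ?_
  · exact (ab_int (by norm_num)).const_mul _
  · exact ((ab_int (by norm_num)).comp_sub_right 1).const_mul _
  · exact (integrable_one_add_norm (by simp; norm_num)).const_mul _

lemma Dom_nonneg (x : ℝ) : 0 ≤ Dom x := by
  have := ab_nonneg (5/8) x
  have := ab_nonneg (1/2) (x-1)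
  unfold Dom; positivity

lemma rp_le {a y : ℝ} (c : ℝ) (ha : 0 < a) (hy : a ≤ y) (hc : 0 ≤ c) (hc1 : c ≤ 1) (ha1 : a ≤ 1) : y^(-c) ≤ 1/a := by
  calc y^(-c) ≤ a^(-c) := Real.rpow_le_rpow_of_nonpos ha hy (by linarith)
    _ ≤ a^(-1:ℝ) := Real.rpow_le_rpow_of_exponent_ge ha ha1 (by linarith)
    _ = 1/a := by rw [Real.rpow_neg_one, one_div]

lemma rp_sc {a y : ℝ} (c k : ℝ) (ha : 0 < a) (hk : 1 ≤ k) (hy : a/k ≤ y) (hc : 0 ≤ c) (hc1 : c ≤ 1) : y^(-c) ≤ k * a^(-c) := by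
  calc y^(-c) ≤ (a/k)^(-c) := Real.rpow_le_rpow_of_nonpos (by positivity) hy (by linarith)
    _ = a^(-c) * k^c := by
      rw [Real.div_rpow (by positivity) (by positivity), div_eq_mul_inv, ← Real.rpow_neg (by positivity), neg_neg]
    _ ≤ a^(-c) * k^(1:ℝ) := by gcongr
    _ = _ := by rw [Real.rpow_one, mul_comm]

lemma Dom_bd {x : ℝ} (hx : x ≠ 0) (hx1 : x ≠ 1) :
    (1+|x|)^(-(1/4:ℝ)) * |x|^(-(5/8:ℝ)) * (|x-1|^(-(1/4:ℝ)) + |x-1|^(-(1/2:ℝ))) ≤ Dom x := by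
  have hxp : 0 < |x| := abs_pos.2 hx
  have hxp1 : 0 < |x-1| := abs_pos.2 (sub_ne_zero.2 hx1)
  have a1 := ab_nonneg (5/8) x
  have a2 := ab_nonneg (1/2) (x-1)
  have a3 : (1+|x|)^(-(1/4:ℝ)) ≤ 1 := Real.rpow_le_one_of_one_le_of_nonpos (by linarith) (by norm_num)
  have p0 : 0 ≤ (1+‖x‖)^(-(9/8:ℝ)) := by positivity
  unfold Dom
  rcases le_total |x| (1/2) with h | h
  · have h' := abs_le.1 h
    have e1 : ab (5/8) x = |x|^(-(5/8:ℝ)) := by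
      rw [ab, Set.indicator_of_mem]; constructor <;> linarith
    have h2 : 1/2 ≤ |x-1| := by
      rw [abs_sub_comm]; exact le_trans (by linarith) (le_abs_self _)
    have b1 := rp_le (1/4) (by norm_num) h2 (by norm_num) (by norm_num) (by norm_num)
    have b2 := rp_le (1/2) (by norm_num) h2 (by norm_num) (by norm_num) (by norm_num)
    calc _ ≤ 1 * |x|^(-(5/8:ℝ)) * (1/(1/2) + 1/(1/2)) := by gcongr
      _ = 4 * ab (5/8) x := by rw [e1]; ring
      _ ≤ _ := by linarith
  have b0 := rp_le (5/8) (by norm_num) h (by norm_num) (by norm_num) (by norm_num)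
  rcases le_total |x-1| (1/2) with g | g
  · have g' := abs_le.1 g
    have e1 : ab (1/2) (x-1) = |x-1|^(-(1/2:ℝ)) := by
      rw [ab, Set.indicator_of_mem]; constructor <;> linarith
    have b1 : |x-1|^(-(1/4:ℝ)) ≤ |x-1|^(-(1/2:ℝ)) := 
      Real.rpow_le_rpow_of_exponent_ge hxp1 (by linarith) (by norm_num)
    calc _ ≤ 1 * (1/(1/2)) * (|x-1|^(-(1/2:ℝ)) + |x-1|^(-(1/2:ℝ))) := by gcongr
      _ = 4 * ab (1/2) (x-1) := by rw [e1]; ring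
      _ ≤ _ := by linarith
  · have l1 : (1+|x|)/3 ≤ |x| := by linarith
    have l2 : (1+|x|)/5 ≤ |x-1| := by
      have := abs_sub_abs_le_abs_sub x 1
      rw [abs_one] at this
      linarith
    have hp : 0 < 1+|x| := by linarith
    have c1 := rp_sc (5/8) 3 hp (by norm_num) l1 (by norm_num) (by norm_num)
    have c2 := rp_sc (1/4) 5 hp (by norm_num) l2 (by norm_num) (by norm_num)
    have c3 := rp_sc (1/2) 5 hp (by norm_num) l2 (by norm_num) (by norm_num)
    have c4 : (1+|x|)^(-(1/2:ℝ)) ≤ (1+|x|)^(-(1/4:ℝ)) := 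
      Real.rpow_le_rpow_of_exponent_le (by linarith) (by norm_num)
    have c5 : |x-1|^(-(1/4:ℝ)) + |x-1|^(-(1/2:ℝ)) ≤ 10 * (1+|x|)^(-(1/4:ℝ)) := by linarith
    calc _ ≤ (1+|x|)^(-(1/4:ℝ)) * (3 * (1+|x|)^(-(5/8:ℝ))) * (10 * (1+|x|)^(-(1/4:ℝ))) := by gcongr
      _ = 30 * ((1+|x|)^(-(1/4:ℝ)) * (1+|x|)^(-(5/8:ℝ)) * (1+|x|)^(-(1/4:ℝ))) := by ring
      _ = 30 * (1+|x|)^(-(9/8:ℝ)) := by rw [← Real.rpow_add hp, ← Real.rpow_add hp]; norm_num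
      _ ≤ _ := by rw [Real.norm_eq_abs] at *; linarith

noncomputable def KC (l : ℂ) : ℂ :=
  Complex.I * ∫ v in Set.Ioo (0:ℝ) 1, (((v*(1-v))^(-(1/2:ℝ)) : ℝ) : ℂ) * (l * v - 1) ^ ((-(1/2:ℝ) : ℝ) : ℂ)

noncomputable def gg (l : ℂ) : ℂ :=
  (1 + l) * l ^ ((-(5/8:ℝ) : ℝ) : ℂ) * (l-1) ^ ((-(1/4:ℝ) : ℝ) : ℂ) * KC l ^ 3

lemma KCi_bd (x y : ℝ) {v : ℝ} (hv : v ∈ Set.Ioo (0:ℝ) 1) (h : x * v - 1 ≠ 0) :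
    ‖(((v*(1-v))^(-(1/2:ℝ)) : ℝ) : ℂ) * ((x + y * I : ℂ) * v - 1) ^ ((-(1/2:ℝ) : ℝ) : ℂ)‖ ≤ Ai x v := by
  have h0 := hv.1
  have h1 : 0 < 1 - v := by linarith [hv.2]
  rw [norm_mul, Complex.norm_real, Real.norm_of_nonneg (by positivity), Complex.norm_cpow_real, Ai]
  refine mul_le_mul_of_nonneg_left (Real.rpow_le_rpow_of_nonpos (abs_pos.2 h) ?_ (by norm_num)) (by positivity)
  refine le_trans (le_of_eq ?_) (Complex.abs_re_le_norm _)
  simp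

lemma ae_ne (x : ℝ) : ∀ᵐ v : ℝ, x * v - 1 ≠ 0 := by
  have : ∀ᵐ v : ℝ, v ∉ ({1/x} : Set ℝ) := measure_eq_zero_iff_ae_notMem.1 (by simp)
  filter_upwards [this] with v hv h
  apply hv
  have hx : x ≠ 0 := by rintro rfl; simp at h
  rw [Set.mem_singleton_iff]; field_simp; linarith

lemma KC_bd {x : ℝ} (y : ℝ) (hx : x ≠ 0) (hx1 : x ≠ 1) : ‖KC (x + y * I)‖ ≤ Ja x := by
  rw [KC, norm_mul, Complex.norm_I, one_mul, Ja]
  refine norm_integral_le_of_norm_le (Ai_int hx hx1) ?_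
  refine (ae_restrict_iff' measurableSet_Ioo).2 ?_
  filter_upwards [ae_ne x] with v h hv
  exact KCi_bd x y hv h

lemma g_bd : ∃ C : ℝ, 0 ≤ C ∧ ∀ x y : ℝ, x ≠ 0 → x ≠ 1 → 0 ≤ y → 
    ‖gg (x + y * I)‖ ≤ C * ((1+|x|+y)/(1+|x|)) * Dom x := by
  obtain ⟨C, hC, hJ⟩ := Ja_bd
  refine ⟨4 * C^3, by positivity, fun x y hx hx1 hy => ?_⟩
  have hxp : 0 < |x| := abs_pos.2 hx
  have hxp1 : 0 < |x-1| := abs_pos.2 (sub_ne_zero.2 hx1)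
  have hp : 0 < 1 + |x| := by linarith
  have n1 : ‖(1 + (x + y * I) : ℂ)‖ ≤ 1 + |x| + y := by
    refine (norm_add_le _ _).trans ?_
    rw [norm_one, add_assoc]
    gcongr
    refine (norm_add_le _ _).trans ?_
    simp [abs_of_nonneg hy]
  have n2 : ‖(x + y * I : ℂ) ^ ((-(5/8:ℝ) : ℝ) : ℂ)‖ ≤ |x|^(-(5/8:ℝ)) := by
    rw [Complex.norm_cpow_real]
    refine Real.rpow_le_rpow_of_nonpos hxp ?_ (by norm_num)
    refine le_trans (le_of_eq ?_) (Complex.abs_re_le_norm _)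
    simp
  have n3 : ‖(x + y * I - 1 : ℂ) ^ ((-(1/4:ℝ) : ℝ) : ℂ)‖ ≤ |x-1|^(-(1/4:ℝ)) := by
    rw [Complex.norm_cpow_real]
    refine Real.rpow_le_rpow_of_nonpos hxp1 ?_ (by norm_num)
    refine le_trans (le_of_eq ?_) (Complex.abs_re_le_norm _)
    simp
  have n4 := (KC_bd y hx hx1).trans (hJ x hx hx1)
  have n5 : ‖KC (x + y * I)‖^3 ≤ C^3 * (1+|x|)^(-(5/4:ℝ)) * (4 * (1 + |x-1|^(-(1/4:ℝ)))) := by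
    have e : ∀ a : ℝ, 0 ≤ a → (1+a)^3 ≤ 4 * (1 + a^3) := fun a ha => by
      nlinarith [mul_nonneg (by linarith : 0 ≤ a + 1) (sq_nonneg (a-1))]
    calc _ ≤ (C * ((1+|x|)^(-(5/12:ℝ)) * (1 + |x-1|^(-(1/12:ℝ)))))^3 := by gcongr
      _ = C^3 * ((1+|x|)^(-(5/12:ℝ)))^3 * (1 + |x-1|^(-(1/12:ℝ)))^3 := by ring
      _ ≤ C^3 * ((1+|x|)^(-(5/12:ℝ)))^3 * (4 * (1 + (|x-1|^(-(1/12:ℝ)))^3)) := by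
        gcongr; exact e _ (by positivity)
      _ = _ := by
        rw [← Real.rpow_natCast ((1+|x|)^(-(5/12:ℝ))), ← Real.rpow_natCast (|x-1|^(-(1/12:ℝ))), ← Real.rpow_mul hp.le, ← Real.rpow_mul hxp1.le]; norm_num
  calc ‖gg (x + y * I)‖ = ‖(1 + (x + y * I) : ℂ)‖ * ‖(x + y * I : ℂ) ^ ((-(5/8:ℝ) : ℝ) : ℂ)‖ * ‖(x + y * I - 1 : ℂ) ^ ((-(1/4:ℝ) : ℝ) : ℂ)‖ * ‖KC (x + y * I)‖^3 := by
        rw [gg, norm_mul, norm_mul, norm_mul, norm_pow]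
    _ ≤ (1 + |x| + y) * |x|^(-(5/8:ℝ)) * |x-1|^(-(1/4:ℝ)) * (C^3 * (1+|x|)^(-(5/4:ℝ)) * (4 * (1 + |x-1|^(-(1/4:ℝ))))) := by gcongr
    _ = 4 * C^3 * ((1+|x|+y)/(1+|x|)) * ((1+|x|)^(-(1/4:ℝ)) * |x|^(-(5/8:ℝ)) * (|x-1|^(-(1/4:ℝ)) + |x-1|^(-(1/2:ℝ)))) := by
      have f1 : (1+|x|)^(-(5/4:ℝ)) = (1+|x|)^(-(1/4:ℝ)) / (1+|x|) := by
        rw [← Real.rpow_sub_one hp.ne']; norm_num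
      have f2 : |x-1|^(-(1/2:ℝ)) = |x-1|^(-(1/4:ℝ)) * |x-1|^(-(1/4:ℝ)) := by
        rw [← Real.rpow_add hxp1]; norm_num
      rw [f1, f2]; ring
    _ ≤ _ := by
      have := Dom_bd hx hx1
      gcongr

lemma Dom_far {x : ℝ} (h : 2 ≤ |x|) : Dom x = 90 * (1+|x|)^(-(9/8:ℝ)) := by
  have h1 : ab (5/8) x = 0 := by
    rw [ab, Set.indicator_of_notMem]
    intro hx
    have := abs_lt.2 hx
    linarith
  have h2 : ab (1/2) (x-1) = 0 := by
    rw [ab, Set.indicator_of_notMem]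
    intro hx
    have := abs_lt.2 hx
    have := abs_sub_abs_le_abs_sub x 1
    rw [abs_one] at this
    linarith
  rw [Dom, h1, h2, Real.norm_eq_abs]; ring


lemma low_bd {d R : ℝ} (hd : 0 < d) (hR : 0 < R) {l : ℂ} (h1 : d ≤ l.im) (h2 : ‖l‖ ≤ R) {v : ℝ} (hv : v ∈ Set.Ioo (0:ℝ) 1) :
    min (1/2) (d/(2*R)) ≤ ‖l * v - 1‖ := by
  have h0 := hv.1
  rcases le_total (v * R) (1/2) with h | h
  · refine (min_le_left _ _).trans ?_
    have := norm_sub_norm_le (1:ℂ) (l * v)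
    rw [norm_sub_rev, norm_one, norm_mul, Complex.norm_real, Real.norm_of_nonneg h0.le] at this
    nlinarith
  · refine (min_le_right _ _).trans ?_
    refine le_trans ?_ ((le_abs_self _).trans (Complex.abs_im_le_norm _))
    have : (l * v - 1).im = l.im * v := by simp
    rw [this, div_le_iff₀ (by positivity)]
    nlinarith

lemma mem_slit {l : ℂ} (h : 0 < l.im) {v : ℝ} (hv : v ∈ Set.Ioo (0:ℝ) 1) : l * v - 1 ∈ Complex.slitPlane := by
  right
  have : (l * v - 1).im = l.im * v := by simp
  rw [this]
  exact (mul_pos h hv.1).ne'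

lemma KC_diff {l0 : ℂ} (h : 0 < l0.im) : DifferentiableAt ℂ KC l0 := by
  set d := l0.im/2 with hd
  set R := ‖l0‖ + d with hR
  have hdp : 0 < d := by positivity
  have hRp : 0 < R := by positivity
  set c := min (1/2) (d/(2*R)) with hc
  have hcp : 0 < c := by positivity
  have ball : ∀ l ∈ Metric.ball l0 d, d ≤ l.im ∧ ‖l‖ ≤ R := by
    intro l hl
    rw [Metric.mem_ball, dist_eq_norm] at hl
    constructor
    · have h1 := (Complex.abs_im_le_norm (l - l0))
      rw [Complex.sub_im] at h1
      have := (abs_le.1 (h1.trans hl.le)).1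
      linarith
    · have := norm_sub_norm_le l l0
      linarith
  have meas : ∀ s : ℂ, ∀ l : ℂ, AEStronglyMeasurable (fun v : ℝ => (((v*(1-v))^(-(1/2:ℝ)) : ℝ) : ℂ) * (l * v - 1) ^ s) (volume.restrict (Set.Ioo (0:ℝ) 1)) := by
    intro s l
    exact Measurable.aestronglyMeasurable (by fun_prop)
  have key := hasDerivAt_integral_of_dominated_loc_of_deriv_le (𝕜 := ℂ) (μ := volume.restrict (Set.Ioo (0:ℝ) 1))
    (F := fun l v => (((v*(1-v))^(-(1/2:ℝ)) : ℝ) : ℂ) * (l * v - 1) ^ ((-(1/2:ℝ) : ℝ) : ℂ))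
    (F' := fun l v => ((((v*(1-v))^(-(1/2:ℝ)) : ℝ) : ℂ) * (l * v - 1) ^ ((-(3/2:ℝ) : ℝ) : ℂ)) * (((-(1/2:ℝ) : ℝ) : ℂ) * v))
    (x₀ := l0) (s := Metric.ball l0 d) (bound := fun v => (v*(1-v))^(-(1/2:ℝ)) * c^(-(3/2:ℝ)))
    (Metric.ball_mem_nhds _ hdp) (Filter.Eventually.of_forall fun l => meas _ l) ?_ ?_ ?_ ?_ ?_
  · exact (key.2.differentiableAt).const_mul _
  · refine Integrable.mono' (hB3.mul_const (c^(-(1/2:ℝ)))) (meas _ _) ?_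
    refine (ae_restrict_iff' measurableSet_Ioo).2 (Filter.Eventually.of_forall fun v hv => ?_)
    have h0 := hv.1
    have h1 : 0 < 1 - v := by linarith [hv.2]
    rw [norm_mul, Complex.norm_real, Real.norm_of_nonneg (by positivity), Complex.norm_cpow_real]
    have := ball l0 (Metric.mem_ball_self hdp)
    refine mul_le_mul_of_nonneg_left (Real.rpow_le_rpow_of_nonpos hcp (low_bd hdp hRp this.1 this.2 hv) (by norm_num)) (by positivity)
  · refine (meas _ _).mul (Measurable.aestronglyMeasurable (by fun_prop))
  · refine (ae_restrict_iff' measurableSet_Ioo).2 (Filter.Eventually.of_forall fun v hv l hl => ?_)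
    have h0 := hv.1
    have h1 : 0 < 1 - v := by linarith [hv.2]
    have := ball l hl
    have b1 := Real.rpow_le_rpow_of_nonpos (z := -(3/2:ℝ)) hcp (low_bd hdp hRp this.1 this.2 hv) (by norm_num)
    rw [norm_mul, norm_mul, Complex.norm_real, Real.norm_of_nonneg (by positivity), Complex.norm_cpow_real]
    have b2 : ‖((-(1/2:ℝ) : ℝ) : ℂ) * v‖ ≤ 1 := by
      rw [norm_mul, Complex.norm_real, Complex.norm_real, Real.norm_of_nonneg h0.le]
      norm_num
      linarith [hv.2]
    calc _ ≤ (v*(1-v))^(-(1/2:ℝ)) * c^(-(3/2:ℝ)) * 1 := by gcongr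
      _ = _ := mul_one _
  · exact hB3.mul_const _
  · refine (ae_restrict_iff' measurableSet_Ioo).2 (Filter.Eventually.of_forall fun v hv l hl => ?_)
    have h2 := (ball l hl).1
    have h1 : HasDerivAt (fun l : ℂ => l * v - 1) (v:ℂ) l := by
      simpa using ((hasDerivAt_id l).mul_const (v:ℂ)).sub_const 1
    have h3 := (h1.cpow_const (c := ((-(1/2:ℝ) : ℝ) : ℂ)) (mem_slit (by linarith) hv)).const_mul (((v*(1-v))^(-(1/2:ℝ)) : ℝ) : ℂ)
    refine h3.congr_deriv ?_
    have e : (((-(1/2:ℝ) : ℝ) : ℂ) - 1) = ((-(3/2:ℝ) : ℝ) : ℂ) := by push_cast; ring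
    rw [e]; ring

lemma gg_diff {l0 : ℂ} (h : 0 < l0.im) : DifferentiableAt ℂ gg l0 := by
  unfold gg
  refine DifferentiableAt.mul (DifferentiableAt.mul (DifferentiableAt.mul (by fun_prop) ?_) ?_) ((KC_diff h).pow 3)
  · exact DifferentiableAt.cpow differentiableAt_id (by fun_prop) (Or.inr h.ne')
  · refine DifferentiableAt.cpow (by fun_prop) (by fun_prop) (Or.inr ?_)
    simpa using h.ne'

lemma cpw {a : ℝ} (ha : a ≠ 0) {b : ℕ → ℝ} (hb : ∀ n, 0 ≤ b n) (h : Filter.Tendsto b Filter.atTop (nhds 0)) (s : ℂ) :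
    Filter.Tendsto (fun n => ((a:ℂ) + b n * I)^s) Filter.atTop (nhds ((a:ℂ)^s)) := by
  have hz : Filter.Tendsto (fun n => ((a:ℂ) + b n * I)) Filter.atTop (nhdsWithin (a:ℂ) {z : ℂ | 0 ≤ z.im}) := by
    refine tendsto_nhdsWithin_iff.2 ⟨?_, Filter.Eventually.of_forall fun n => by simpa using hb n⟩
    have : Filter.Tendsto (fun n => ((a:ℂ) + b n * I)) Filter.atTop (nhds ((a:ℂ) + (0:ℝ) * I)) :=
      tendsto_const_nhds.add ((((Complex.continuous_ofReal.tendsto 0).comp h)).mul tendsto_const_nhds)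
    simpa using this
  have hl : ContinuousWithinAt Complex.log {z : ℂ | 0 ≤ z.im} (a:ℂ) := by
    rcases lt_or_gt_of_ne ha with h | h
    · exact Complex.continuousWithinAt_log_of_re_neg_of_im_zero (by simpa using h) (by simp)
    · exact (continuousAt_clog (Or.inl (by simpa using h))).continuousWithinAt
  have h1 := (hl.tendsto.comp hz).mul_const s
  have h2 := (Complex.continuous_exp.tendsto _).comp h1
  rw [Complex.cpow_def_of_ne_zero (by exact_mod_cast ha)]
  refine h2.congr fun n => ?_
  have : ((a:ℂ) + b n * I) ≠ 0 := by
    intro h0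
    have := congrArg Complex.re h0
    simp at this
    exact ha this
  rw [Complex.cpow_def_of_ne_zero this]
  rfl

lemma KC_lim {x : ℝ} (hx : x ≠ 0) (hx1 : x ≠ 1) {b : ℕ → ℝ} (hb : ∀ n, 0 ≤ b n) (h : Filter.Tendsto b Filter.atTop (nhds 0)) :
    Filter.Tendsto (fun n => KC ((x:ℂ) + b n * I)) Filter.atTop (nhds (KC x)) := by
  unfold KC
  refine Filter.Tendsto.const_mul _ ?_
  refine tendsto_integral_of_dominated_convergence (Ai x) (fun n => Measurable.aestronglyMeasurable (by fun_prop)) (Ai_int hx hx1) (fun n => ?_) ?_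
  · refine (ae_restrict_iff' measurableSet_Ioo).2 ?_
    filter_upwards [ae_ne x] with v h hv
    exact KCi_bd x _ hv h
  · refine (ae_restrict_iff' measurableSet_Ioo).2 ?_
    filter_upwards [ae_ne x] with v h1 hv
    refine Filter.Tendsto.const_mul _ ?_
    have := cpw (b := fun n => b n * v) h1 (fun n => mul_nonneg (hb n) hv.1.le) (by simpa using h.mul_const v) ((-(1/2:ℝ) : ℝ) : ℂ)
    push_cast at this ⊢
    refine this.congr fun n => ?_
    congr 1; ring

lemma gg_lim {x : ℝ} (hx : x ≠ 0) (hx1 : x ≠ 1) {b : ℕ → ℝ} (hb : ∀ n, 0 ≤ b n) (h : Filter.Tendsto b Filter.atTop (nhds 0)) :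
    Filter.Tendsto (fun n => gg ((x:ℂ) + b n * I)) Filter.atTop (nhds (gg x)) := by
  unfold gg
  refine Filter.Tendsto.mul (Filter.Tendsto.mul (Filter.Tendsto.mul ?_ (cpw hx hb h _)) ?_) ((KC_lim hx hx1 hb h).pow 3)
  · have : Filter.Tendsto (fun n => (1 + ((x:ℂ) + b n * I))) Filter.atTop (nhds (1 + ((x:ℂ) + (0:ℝ) * I))) :=
      tendsto_const_nhds.add (tendsto_const_nhds.add ((((Complex.continuous_ofReal.tendsto 0).comp h)).mul tendsto_const_nhds))
    simpa using this
  · have := cpw (a := x - 1) (sub_ne_zero.2 hx1) hb h ((-(1/4:ℝ) : ℝ) : ℂ)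
    push_cast at this ⊢
    refine this.congr fun n => ?_
    congr 1; ring

lemma KC_top : ∃ C : ℝ, 0 ≤ C ∧ ∀ x y : ℝ, |x| ≤ y → 0 < y → ‖KC (x + y * I)‖ ≤ C * y^(-(5/12:ℝ)) := by
  have hb := int_beta (a := 1/12) (b := 1/2) (by norm_num) (by norm_num)
  set M := ∫ v in Set.Ioo (0:ℝ) 1, v^((1/12:ℝ)-1) * (1-v)^((1/2:ℝ)-1) with hM
  refine ⟨2 * M, mul_nonneg zero_le_two (setIntegral_nonneg measurableSet_Ioo fun v hv => ?_), fun x y hxy hy => ?_⟩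
  · have h0 := hv.1
    have h1 : 0 < 1 - v := by linarith [hv.2]
    positivity
  rw [KC, norm_mul, Complex.norm_I, one_mul, mul_right_comm, hM, ← MeasureTheory.integral_const_mul]
  refine norm_integral_le_of_norm_le (hb.const_mul _) ?_
  refine (ae_restrict_iff' measurableSet_Ioo).2 (Filter.Eventually.of_forall fun v hv => ?_)
  have h0 := hv.1
  have h1 : 0 < 1 - v := by linarith [hv.2]
  rw [norm_mul, Complex.norm_real, Real.norm_of_nonneg (by positivity), Complex.norm_cpow_real]
  set N := ‖(x + y * I : ℂ) * v - 1‖ with hN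
  have l1 : y * v ≤ N := by
    refine le_trans (le_of_eq ?_) ((le_abs_self _).trans (Complex.abs_im_le_norm _))
    simp
  have l2 : 1/2 ≤ N := by
    rcases le_total (y * v) (1/2) with h | h
    · have : |x * v - 1| ≤ N := by
        refine le_trans (le_of_eq ?_) (Complex.abs_re_le_norm _)
        simp
      refine le_trans ?_ this
      rw [abs_sub_comm]
      refine le_trans ?_ (le_abs_self _)
      have := (abs_le.1 hxy).2
      nlinarith
    · linarith
  have hNp : 0 < N := by linarith
  have e1 : N^(-(1/2:ℝ)) ≤ 2 * (y^(-(5/12:ℝ)) * v^(-(5/12:ℝ))) := by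
    calc N^(-(1/2:ℝ)) = N^(-(1/12:ℝ)) * N^(-(5/12:ℝ)) := by rw [← Real.rpow_add hNp]; norm_num
      _ ≤ (1/(1/2)) * (y*v)^(-(5/12:ℝ)) := by
        have := rp_le (1/12) (by norm_num) l2 (by norm_num) (by norm_num) (by norm_num)
        have := Real.rpow_le_rpow_of_nonpos (z := -(5/12:ℝ)) (by positivity) l1 (by norm_num)
        gcongr
      _ = _ := by rw [Real.mul_rpow hy.le h0.le]; norm_num
  calc _ ≤ (v*(1-v))^(-(1/2:ℝ)) * (2 * (y^(-(5/12:ℝ)) * v^(-(5/12:ℝ)))) := by gcongr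
    _ = 2 * y^(-(5/12:ℝ)) * ((v^(-(1/2:ℝ)) * v^(-(5/12:ℝ))) * (1-v)^(-(1/2:ℝ))) := by
      rw [Real.mul_rpow h0.le h1.le]; ring
    _ = _ := by rw [← Real.rpow_add h0]; norm_num

lemma gg_top : ∃ C : ℝ, 0 ≤ C ∧ ∀ x y : ℝ, |x| ≤ y → 1 ≤ y → ‖gg (x + y * I)‖ ≤ C * y^(-(9/8:ℝ)) := by
  obtain ⟨C, hC, hK⟩ := KC_top
  refine ⟨3 * C^3, by positivity, fun x y hxy hy => ?_⟩
  have hyp : 0 < y := by linarith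
  have n1 : ‖(1 + (x + y * I) : ℂ)‖ ≤ 3 * y := by
    have : ‖(1 + (x + y * I) : ℂ)‖ ≤ 1 + (|x| + y) := by
      refine (norm_add_le _ _).trans ?_
      rw [norm_one]
      gcongr
      refine (norm_add_le _ _).trans ?_
      simp [abs_of_nonneg hyp.le]
    linarith
  have n2 : ‖(x + y * I : ℂ) ^ ((-(5/8:ℝ) : ℝ) : ℂ)‖ ≤ y^(-(5/8:ℝ)) := by
    rw [Complex.norm_cpow_real]
    refine Real.rpow_le_rpow_of_nonpos hyp ?_ (by norm_num)
    refine le_trans (le_of_eq ?_) ((le_abs_self _).trans (Complex.abs_im_le_norm _))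
    simp
  have n3 : ‖(x + y * I - 1 : ℂ) ^ ((-(1/4:ℝ) : ℝ) : ℂ)‖ ≤ y^(-(1/4:ℝ)) := by
    rw [Complex.norm_cpow_real]
    refine Real.rpow_le_rpow_of_nonpos hyp ?_ (by norm_num)
    refine le_trans (le_of_eq ?_) ((le_abs_self _).trans (Complex.abs_im_le_norm _))
    simp
  have n4 := hK x y hxy hyp
  calc ‖gg (x + y * I)‖ = ‖(1 + (x + y * I) : ℂ)‖ * ‖(x + y * I : ℂ) ^ ((-(5/8:ℝ) : ℝ) : ℂ)‖ * ‖(x + y * I - 1 : ℂ) ^ ((-(1/4:ℝ) : ℝ) : ℂ)‖ * ‖KC (x + y * I)‖^3 := by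
        rw [gg, norm_mul, norm_mul, norm_mul, norm_pow]
    _ ≤ (3 * y) * y^(-(5/8:ℝ)) * y^(-(1/4:ℝ)) * (C * y^(-(5/12:ℝ)))^3 := by gcongr
    _ = 3 * C^3 * (y^(1:ℝ) * y^(-(5/8:ℝ)) * y^(-(1/4:ℝ)) * (y^(-(5/12:ℝ)))^(3:ℕ)) := by rw [Real.rpow_one]; ring
    _ = _ := by
      rw [← Real.rpow_natCast (y^(-(5/12:ℝ))), ← Real.rpow_mul hyp.le, ← Real.rpow_add hyp, ← Real.rpow_add hyp, ← Real.rpow_add hyp]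
      norm_num


lemma bot_zero : ∃ C : ℝ, ∀ n : ℕ, 2 ≤ n →
    ‖∫ x in (-(n:ℝ))..n, gg (x + ((1/((n:ℝ)+1) : ℝ) : ℂ) * I)‖ ≤ C * (n:ℝ)^(-(1/8:ℝ)) := by
  obtain ⟨C1, hC1, ht⟩ := gg_top
  obtain ⟨C2, hC2, hs⟩ := g_bd
  refine ⟨2 * C1 + 360 * C2, fun n hn => ?_⟩
  have hn2 : (2:ℝ) ≤ n := by exact_mod_cast hn
  have hnp : (0:ℝ) < n := by linarith
  set N : ℝ := (n:ℝ) with hN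
  set b : ℝ := 1/(N+1) with hb
  have hbp : 0 < b := by positivity
  have hb1 : b ≤ 1 := by rw [hb, div_le_one (by positivity)]; linarith
  have H := Complex.integral_boundary_rect_eq_zero_of_differentiableOn gg (⟨-N, b⟩ : ℂ) ⟨N, b+N⟩ (by
    intro l hl
    refine (gg_diff ?_).differentiableWithinAt
    have h2 := hl.2
    simp only [Set.mem_preimage] at h2
    rw [Set.uIcc_of_le (by linarith)] at h2
    linarith [h2.1])
  simp only [smul_eq_mul] at H
  have top : ‖∫ x in (-N)..N, gg (x + ((b+N : ℝ) : ℂ) * I)‖ ≤ (C1 * N^(-(9/8:ℝ))) * (2 * N) := by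
    have := intervalIntegral.norm_integral_le_of_norm_le_const (a := -N) (b := N) (f := fun x : ℝ => gg (x + ((b+N : ℝ) : ℂ) * I)) (C := C1 * N^(-(9/8:ℝ))) (by
      intro x hx
      rw [Set.uIoc_of_le (by linarith)] at hx
      refine (ht x (b+N) (abs_le.2 ⟨by linarith [hx.1], by linarith [hx.2]⟩) (by linarith)).trans ?_
      refine mul_le_mul_of_nonneg_left (Real.rpow_le_rpow_of_nonpos hnp (by linarith) (by norm_num)) hC1)
    rwa [show N - -N = 2 * N by ring, abs_of_nonneg (by linarith)] at this
  have side : ∀ x : ℝ, |x| = N → ‖∫ y in b..(b+N), gg ((x:ℂ) + y * I)‖ ≤ (C2 * 2 * (90 * N^(-(9/8:ℝ)))) * N := by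
    intro x hx
    have := intervalIntegral.norm_integral_le_of_norm_le_const (a := b) (b := b+N) (f := fun y : ℝ => gg ((x:ℂ) + y * I)) (C := C2 * 2 * (90 * N^(-(9/8:ℝ)))) (by
      intro y hy
      rw [Set.uIoc_of_le (by linarith)] at hy
      refine (hs x y ?_ ?_ (by linarith [hy.1])).trans ?_
      · rintro rfl; simp at hx; linarith
      · rintro rfl; simp at hx; linarith
      rw [Dom_far (by linarith), hx]
      have e1 : (1+N+y)/(1+N) ≤ 2 := by rw [div_le_iff₀ (by linarith)]; linarith [hy.2]
      have e2 : (1+N)^(-(9/8:ℝ)) ≤ N^(-(9/8:ℝ)) := Real.rpow_le_rpow_of_nonpos hnp (by linarith) (by norm_num)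
      gcongr)
    rwa [show b + N - b = N by ring, abs_of_nonneg (by linarith)] at this
  have s1 := side N (abs_of_pos hnp)
  have s2 := side (-N) (by rw [abs_neg, abs_of_pos hnp])
  have e : N^(-(9/8:ℝ)) * N = N^(-(1/8:ℝ)) := by
    rw [← Real.rpow_add_one hnp.ne']; norm_num
  have H2 : (∫ x in (-N)..N, gg (x + (b : ℂ) * I)) = (∫ x in (-N)..N, gg (x + ((b+N : ℝ) : ℂ) * I)) - I * (∫ y in b..(b+N), gg ((N:ℂ) + y * I)) + I * (∫ y in b..(b+N), gg (((-N : ℝ):ℂ) + y * I)) := by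
    linear_combination H
  rw [H2]
  refine (norm_add_le _ _).trans ?_
  have := norm_sub_le (∫ x in (-N)..N, gg (x + ((b+N : ℝ) : ℂ) * I)) (I * (∫ y in b..(b+N), gg ((N:ℂ) + y * I)))
  rw [norm_mul, Complex.norm_I, one_mul] at *
  rw [← e]
  linarith

lemma gg_int0 : Integrable (fun x : ℝ => gg x) ∧ ∫ x : ℝ, gg x = 0 := by
  obtain ⟨C2, hC2, hs⟩ := g_bd
  obtain ⟨C, hb⟩ := bot_zero
  have ae01 : ∀ᵐ x : ℝ, x ≠ 0 ∧ x ≠ 1 := by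
    have : ∀ᵐ v : ℝ, v ∉ ({0,1} : Set ℝ) := measure_eq_zero_iff_ae_notMem.1 (Set.Finite.measure_zero (by simp) _)
    filter_upwards [this] with v hv
    simpa using hv
  set b : ℕ → ℝ := fun n => 1/((n:ℝ)+1) with hbdef
  have hbp : ∀ n, 0 < b n := fun n => by positivity
  have hb1 : ∀ n, b n ≤ 1 := fun n => by
    simp only [hbdef]; rw [div_le_one (by positivity)]; linarith [(Nat.cast_nonneg n : (0:ℝ) ≤ n)]
  have hbt : Filter.Tendsto b Filter.atTop (nhds 0) := tendsto_one_div_add_atTop_nhds_zero_nat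
  have hcont : ∀ n, Continuous (fun x : ℝ => gg ((x:ℂ) + b n * I)) := fun n => by
    rw [continuous_iff_continuousAt]
    intro x
    have : ContinuousAt gg ((x:ℂ) + b n * I) := (gg_diff (by simpa using hbp n)).continuousAt
    exact this.comp (f := fun x : ℝ => ((x:ℂ) + b n * I)) (by fun_prop)
  have hbd : ∀ n : ℕ, ∀ᵐ x : ℝ, ‖(Set.Ioc (-(n:ℝ)) n).indicator (fun x : ℝ => gg ((x:ℂ) + b n * I)) x‖ ≤ C2 * 2 * Dom x := by
    intro n
    filter_upwards [ae01] with x hx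
    refine (norm_indicator_le_norm_self _ _).trans ?_
    refine (hs x (b n) hx.1 hx.2 (hbp n).le).trans ?_
    have := Dom_nonneg x
    have e1 : (1+|x|+b n)/(1+|x|) ≤ 2 := by
      rw [div_le_iff₀ (by positivity)]; linarith [hb1 n, abs_nonneg x]
    gcongr
  have hlim : ∀ᵐ x : ℝ, Filter.Tendsto (fun n : ℕ => (Set.Ioc (-(n:ℝ)) n).indicator (fun x : ℝ => gg ((x:ℂ) + b n * I)) x) Filter.atTop (nhds (gg x)) := by
    filter_upwards [ae01] with x hx
    refine (gg_lim hx.1 hx.2 (fun n => (hbp n).le) hbt).congr' ?_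
    obtain ⟨m, hm⟩ := exists_nat_gt |x|
    filter_upwards [Filter.eventually_ge_atTop m] with n hn
    have : |x| < n := hm.trans_le (by exact_mod_cast hn)
    have := abs_lt.1 this
    rw [Set.indicator_of_mem (show x ∈ Set.Ioc (-(n:ℝ)) n from ⟨this.1, this.2.le⟩)]
  have hmeas : ∀ n : ℕ, AEStronglyMeasurable ((Set.Ioc (-(n:ℝ)) n).indicator (fun x : ℝ => gg ((x:ℂ) + b n * I))) volume :=
    fun n => (hcont n).aestronglyMeasurable.indicator measurableSet_Ioc
  have T := tendsto_integral_of_dominated_convergence (fun x => C2 * 2 * Dom x) hmeas (Dom_int.const_mul _) hbd hlim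
  constructor
  · refine Integrable.mono' (Dom_int.const_mul (C2 * 1)) (aestronglyMeasurable_of_tendsto_ae _ hmeas hlim) ?_
    filter_upwards [ae01] with x hx
    have := hs x 0 hx.1 hx.2 le_rfl
    rw [add_zero, div_self (by positivity)] at this
    simpa using this
  · refine tendsto_nhds_unique T ?_
    rw [tendsto_zero_iff_norm_tendsto_zero]
    have T2 : Filter.Tendsto (fun n : ℕ => C * (n:ℝ)^(-(1/8:ℝ))) Filter.atTop (nhds 0) := by
      have := ((tendsto_rpow_neg_atTop (show (0:ℝ) < 1/8 by norm_num)).comp tendsto_natCast_atTop_atTop).const_mul C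
      simpa using this
    refine squeeze_zero' (Filter.Eventually.of_forall fun n => norm_nonneg _) ?_ T2
    filter_upwards [Filter.eventually_ge_atTop 2] with n hn
    refine le_trans (le_of_eq ?_) (hb n hn)
    rw [MeasureTheory.integral_indicator measurableSet_Ioc, intervalIntegral.integral_of_le (by linarith [(Nat.cast_nonneg n : (0:ℝ) ≤ n)])]


lemma npw {a : ℝ} (ha : a ≤ 0) (c : ℝ) : (a:ℂ)^(c:ℂ) = (((-a)^c : ℝ) : ℂ) * Complex.exp (π * I * c) := by
  rw [Complex.ofReal_cpow_of_nonpos ha, Complex.ofReal_cpow (by linarith)]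
  push_cast; rfl

lemma ppw {a : ℝ} (ha : 0 ≤ a) (c : ℝ) : (a:ℂ)^(c:ℂ) = ((a^c : ℝ) : ℂ) := (Complex.ofReal_cpow ha c).symm

lemma cexp_mh : Complex.exp (π * I * ((-(1/2:ℝ) : ℝ) : ℂ)) = -I := by
  have : (π * I * ((-(1/2:ℝ) : ℝ) : ℂ)) = -(π / 2 * I) := by push_cast; ring
  rw [this, Complex.exp_neg, Complex.exp_pi_div_two_mul_I, Complex.inv_I]

noncomputable def kk (m : ℝ) : ℝ := ∫ v in Set.Ioo (0:ℝ) 1, (v*(1-v))^(-(1/2:ℝ)) * (1-m*v)^(-(1/2:ℝ))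

lemma KC_lt {x : ℝ} (hx : x < 1) : KC x = kk x := by
  rw [KC, kk, ← integral_complex_ofReal, ← MeasureTheory.integral_const_mul]
  refine setIntegral_congr_fun measurableSet_Ioo fun v hv => ?_
  have h : x * v - 1 ≤ 0 := by nlinarith [hv.1, hv.2]
  have := npw h (-(1/2:ℝ))
  rw [cexp_mh] at this
  push_cast at this ⊢
  rw [this]
  rw [show -(x*v-1) = 1 - x*v by ring]
  linear_combination (-1 : ℂ) * ((((v*(1-v))^(-(1/2:ℝ)) : ℝ) : ℂ) * (((1 - x*v)^(-(1/2:ℝ)) : ℝ) : ℂ)) * Complex.I_sq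

lemma kk1 {x : ℝ} (hx : 1 < x) :
    ∫ v in Set.Ioo (0:ℝ) (1/x), (v*(1-v))^(-(1/2:ℝ)) * (1-x*v)^(-(1/2:ℝ)) = x^(-(1/2:ℝ)) * kk (1/x) := by
  have hx0 : 0 < x := by linarith
  have h := cov_i (s := Set.Ioo (0:ℝ) 1) (t := Set.Ioo (0:ℝ) (1/x)) measurableSet_Ioo
    (f := fun w => w/x) (f' := fun w => 1/x) (g := fun v => x*v)
    (fun w hw => (hasDerivAt_id w).div_const x) (fun w hw => by positivity)
    (fun w hw => ⟨by have := hw.1; positivity, by have := hw.2; gcongr⟩)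
    (fun v hv => ⟨by have := hv.1; positivity, by have := hv.2; rw [lt_div_iff₀ hx0] at this; linarith⟩)
    (fun w hw => by field_simp) (fun v hv => by field_simp)
    (fun v => (v*(1-v))^(-(1/2:ℝ)) * (1-x*v)^(-(1/2:ℝ)))
  rw [h, kk, ← MeasureTheory.integral_const_mul]
  refine setIntegral_congr_fun measurableSet_Ioo fun w hw => ?_
  have h0 := hw.1
  have h1 : 0 < 1 - w := by linarith [hw.2]
  have h2 : 0 < 1 - w/x := by
    have : w/x < 1 := by rw [div_lt_one hx0]; linarith
    linarith
  rw [show x*(w/x) = w by field_simp, show 1 - 1/x*w = 1 - w/x by ring,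
    Real.mul_rpow (by positivity) h2.le, Real.mul_rpow h0.le h1.le, Real.div_rpow h0.le hx0.le]
  have e : 1/x * (1/x^(-(1/2:ℝ))) = x^(-(1/2:ℝ)) := by
    rw [Real.rpow_neg hx0.le, ← Real.sqrt_eq_rpow]
    have := Real.sq_sqrt hx0.le
    have : 0 < √x := by positivity
    field_simp; nlinarith
  linear_combination (w^(-(1/2:ℝ)) * (1-w/x)^(-(1/2:ℝ)) * (1-w)^(-(1/2:ℝ))) * e

lemma kk2 {x : ℝ} (hx : 1 < x) :
    ∫ v in Set.Ioo (1/x) 1, (v*(1-v))^(-(1/2:ℝ)) * (x*v-1)^(-(1/2:ℝ)) = x^(-(1/2:ℝ)) * kk (1-1/x) := by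
  have hx0 : 0 < x := by linarith
  have hr : 0 < 1 - 1/x := by
    have : 1/x < 1 := by rw [div_lt_one hx0]; linarith
    linarith
  have hx1 : 0 < x - 1 := by linarith
  have h := cov_a (s := Set.Ioo (0:ℝ) 1) (t := Set.Ioo (1/x) 1) measurableSet_Ioo
    (f := fun w => 1-(1-1/x)*w) (f' := fun w => 1-1/x) (g := fun v => (1-v)/(1-1/x))
    (fun w hw => hda (((hasDerivAt_id w).const_mul (1-1/x)).const_sub 1) (fun y => rfl) (by simp)) (fun w hw => hr.le)
    (fun w hw => ⟨by have := hw.2; nlinarith, by have := hw.1; nlinarith⟩)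
    (fun v hv => ⟨by have := hv.2; exact div_pos (by linarith) hr, by have := hv.1; rw [div_lt_one hr]; linarith⟩)
    (fun w hw => by rw [div_eq_iff hr.ne']; ring) (fun v hv => by rw [mul_div_cancel₀ _ hr.ne']; ring)
    (fun v => (v*(1-v))^(-(1/2:ℝ)) * (x*v-1)^(-(1/2:ℝ)))
  rw [h, kk, ← MeasureTheory.integral_const_mul]
  refine setIntegral_congr_fun measurableSet_Ioo fun w hw => ?_
  have h0 := hw.1
  have h1 : 0 < 1 - w := by linarith [hw.2]
  have hz : 0 < 1/x := by positivity
  have h2 : 0 < 1 - (1-1/x)*w := by nlinarith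
  rw [show x*(1-(1-1/x)*w)-1 = (x-1)*(1-w) by field_simp; ring, show 1-(1-(1-1/x)*w) = (1-1/x)*w by ring,
    Real.mul_rpow h2.le (by positivity), Real.mul_rpow hr.le h0.le, Real.mul_rpow h0.le h1.le, Real.mul_rpow hx1.le h1.le]
  have e : (1-1/x) * ((1-1/x)^(-(1/2:ℝ)) * (x-1)^(-(1/2:ℝ))) = x^(-(1/2:ℝ)) := by
    rw [← Real.mul_rpow hr.le hx1.le, show (1-1/x)*(x-1) = (x-1)^2/x by field_simp, rpow_nh (by positivity), rpow_nh hx0.le,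
      Real.sqrt_div (by positivity), Real.sqrt_sq hx1.le]
    have := Real.sq_sqrt hx0.le
    have : 0 < √x := by positivity
    field_simp; nlinarith
  rw [← e]; ring

lemma KC_gt {x : ℝ} (hx : 1 < x) : KC x = ((x^(-(1/2:ℝ)) : ℝ) : ℂ) * (kk (1/x) + I * kk (1-1/x)) := by
  have hx0 : 0 < x := by linarith
  have hx1 : 1/x < 1 := by rw [div_lt_one hx0]; linarith
  have hx2 : 0 < 1/x := by positivity
  have hint : IntegrableOn (fun v : ℝ => (((v*(1-v))^(-(1/2:ℝ)) : ℝ) : ℂ) * ((x:ℂ) * v - 1) ^ ((-(1/2:ℝ) : ℝ) : ℂ)) (Set.Ioo 0 1) := by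
    refine Integrable.mono' (Ai_int hx0.ne' hx.ne') (Measurable.aestronglyMeasurable (by fun_prop)) ?_
    refine (ae_restrict_iff' measurableSet_Ioo).2 ?_
    filter_upwards [ae_ne x] with v h hv
    simpa using KCi_bd x 0 hv h
  have hU : Set.Ioo (0:ℝ) 1 = Set.Ioc 0 (1/x) ∪ Set.Ioo (1/x) 1 := (Set.Ioc_union_Ioo_eq_Ioo hx2.le hx1).symm
  rw [KC, hU, setIntegral_union (Set.disjoint_left.2 fun v h1 h2 => absurd h2.1 (not_lt.2 h1.2)) measurableSet_Ioo
    (hint.mono_set (by rw [hU]; exact Set.subset_union_left)) (hint.mono_set (by rw [hU]; exact Set.subset_union_right)),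
    integral_Ioc_eq_integral_Ioo]
  have e1 : ∫ v in Set.Ioo (0:ℝ) (1/x), (((v*(1-v))^(-(1/2:ℝ)) : ℝ) : ℂ) * ((x:ℂ) * v - 1) ^ ((-(1/2:ℝ) : ℝ) : ℂ) = -I * ((x^(-(1/2:ℝ)) * kk (1/x) : ℝ) : ℂ) := by
    rw [← kk1 hx, ← integral_complex_ofReal, ← MeasureTheory.integral_const_mul]
    refine setIntegral_congr_fun measurableSet_Ioo fun v hv => ?_
    have h : x * v - 1 ≤ 0 := by have := hv.2; rw [lt_div_iff₀ hx0] at this; linarith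
    have := npw h (-(1/2:ℝ))
    rw [cexp_mh] at this
    push_cast at this ⊢
    rw [this]
    rw [show -(x*v-1) = 1 - x*v by ring]
    ring
  have e2 : ∫ v in Set.Ioo (1/x) 1, (((v*(1-v))^(-(1/2:ℝ)) : ℝ) : ℂ) * ((x:ℂ) * v - 1) ^ ((-(1/2:ℝ) : ℝ) : ℂ) = ((x^(-(1/2:ℝ)) * kk (1-1/x) : ℝ) : ℂ) := by
    rw [← kk2 hx, ← integral_complex_ofReal]
    refine setIntegral_congr_fun measurableSet_Ioo fun v hv => ?_
    have h : 0 ≤ x * v - 1 := by have := hv.1; rw [div_lt_iff₀ hx0] at this; linarith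
    have := ppw h (-(1/2:ℝ))
    push_cast at this ⊢
    rw [this]
  rw [e1, e2]
  push_cast
  linear_combination (-1:ℂ) * (((x^(-(1/2:ℝ)) : ℝ) : ℂ) * kk (1/x)) * Complex.I_sq

lemma kk_nonneg {m : ℝ} (hm : m < 1) : 0 ≤ kk m := by
  refine setIntegral_nonneg measurableSet_Ioo fun v hv => ?_
  have h0 := hv.1
  have h1 : 0 < 1 - v := by linarith [hv.2]
  have : 0 < 1 - m * v := by nlinarith
  positivity

lemma kk_bd : ∃ C : ℝ, 0 ≤ C ∧ ∀ m ∈ Set.Ioo (0:ℝ) 1, kk m ≤ C * (1-m)^(-(1/12:ℝ)) := by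
  obtain ⟨C, hC, hJ⟩ := Ja_bd
  refine ⟨2 * C, by positivity, fun m hm => ?_⟩
  have h0 := hm.1
  have h1 : 0 < 1 - m := by linarith [hm.2]
  have a1 := KC_bd 0 hm.1.ne' hm.2.ne
  rw [Complex.ofReal_zero, zero_mul, add_zero, KC_lt hm.2, Complex.norm_real, Real.norm_of_nonneg (kk_nonneg hm.2)] at a1
  have a2 := a1.trans (hJ m hm.1.ne' hm.2.ne)
  rw [abs_of_pos h0, abs_sub_comm, abs_of_pos h1] at a2
  have b1 : (1+m)^(-(5/12:ℝ)) ≤ 1 := Real.rpow_le_one_of_one_le_of_nonpos (by linarith) (by norm_num)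
  have b2 : 1 ≤ (1-m)^(-(1/12:ℝ)) := Real.one_le_rpow_of_pos_of_le_one_of_nonpos h1 (by linarith) (by norm_num)
  calc kk m ≤ _ := a2
    _ ≤ C * (1 * ((1-m)^(-(1/12:ℝ)) + (1-m)^(-(1/12:ℝ)))) := by gcongr
    _ = _ := by ring

lemma kk_meas : Measurable kk := by
  unfold kk
  refine StronglyMeasurable.measurable ?_
  refine StronglyMeasurable.integral_prod_right (f := fun m v : ℝ => (v*(1-v))^(-(1/2:ℝ)) * (1-m*v)^(-(1/2:ℝ))) ?_
  apply Measurable.stronglyMeasurable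
  unfold Function.uncurry
  fun_prop

lemma kk_K {k : ℝ} (hk : k ∈ Set.Ioo (0:ℝ) 1) : kk (k^2) = 2 * ellipticK k := by
  rw [ellipticK, intervalIntegral.integral_of_le (by positivity), integral_Ioc_eq_integral_Ioo, ← MeasureTheory.integral_const_mul]
  have h := cov_i (s := Set.Ioo (0:ℝ) (π/2)) (t := Set.Ioo (0:ℝ) 1) measurableSet_Ioo
    (f := fun θ => Real.sin θ^2) (f' := fun θ => 2 * Real.sin θ * Real.cos θ) (g := fun v => Real.arcsin (√v))
    (fun θ hθ => hda ((Real.hasDerivAt_sin θ).pow 2) (fun y => rfl) (by simp))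
    (fun θ hθ => ?_) (fun θ hθ => ?_) (fun v hv => ?_) (fun θ hθ => ?_) (fun v hv => ?_)
    (fun v => (v*(1-v))^(-(1/2:ℝ)) * (1-k^2*v)^(-(1/2:ℝ)))
  · rw [kk, h]
    refine setIntegral_congr_fun measurableSet_Ioo fun θ hθ => ?_
    have hs := Real.sin_pos_of_pos_of_lt_pi hθ.1 (by linarith [hθ.2, Real.pi_pos])
    have hc := Real.cos_pos_of_mem_Ioo ⟨by linarith [hθ.1, Real.pi_pos], hθ.2⟩
    rw [show Real.sin θ^2 * (1 - Real.sin θ^2) = (Real.sin θ * Real.cos θ)^2 by rw [← Real.cos_sq']; ring,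
      rpow_nh (by positivity), Real.sqrt_sq (by positivity)]
    field_simp
  · have hs := Real.sin_pos_of_pos_of_lt_pi hθ.1 (by linarith [hθ.2, Real.pi_pos])
    have hc := Real.cos_pos_of_mem_Ioo ⟨by linarith [hθ.1, Real.pi_pos], hθ.2⟩
    positivity
  · have hs := Real.sin_pos_of_pos_of_lt_pi hθ.1 (by linarith [hθ.2, Real.pi_pos])
    have hc := Real.cos_pos_of_mem_Ioo ⟨by linarith [hθ.1, Real.pi_pos], hθ.2⟩
    constructor
    · positivity
    · nlinarith [Real.sin_sq_add_cos_sq θ]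
  · have h1 : √v < 1 := by rw [Real.sqrt_lt' one_pos]; linarith [hv.2]
    exact ⟨Real.arcsin_pos.2 (Real.sqrt_pos.2 hv.1), Real.arcsin_lt_pi_div_two.2 h1⟩
  · have hs := Real.sin_pos_of_pos_of_lt_pi hθ.1 (by linarith [hθ.2, Real.pi_pos])
    rw [Real.sqrt_sq hs.le, Real.arcsin_sin (by linarith [hθ.1, Real.pi_pos]) hθ.2.le]
  · have h1 : √v < 1 := by rw [Real.sqrt_lt' one_pos]; linarith [hv.2]
    rw [Real.sin_arcsin (by linarith [Real.sqrt_nonneg v]) h1.le, Real.sq_sqrt hv.1.le]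


noncomputable def EE : ℂ := Complex.exp ((7*π/8 : ℝ) * I)

noncomputable def ww (m : ℝ) : ℝ := (1+m) * m^(-(5/8:ℝ)) * (1-m)^(-(1/4:ℝ))

noncomputable def nn (i j : ℕ) : ℝ := ∫ m in Set.Ioo (0:ℝ) 1, ww m * kk m^i * kk (1-m)^j

lemma gg_neg {x : ℝ} (hx : x < 0) : (EE * gg x).im = 0 := by
  have h2 := npw (a := x - 1) (by linarith) (-(1/4:ℝ))
  rw [Complex.ofReal_sub, Complex.ofReal_one] at h2
  rw [gg, KC_lt (by linarith), npw hx.le, h2, EE]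
  have e : Complex.exp ((7*π/8 : ℝ) * I) * Complex.exp (π * I * ((-(5/8:ℝ) : ℝ) : ℂ)) * Complex.exp (π * I * ((-(1/4:ℝ) : ℝ) : ℂ)) = 1 := by
    rw [← Complex.exp_add, ← Complex.exp_add, ← Complex.exp_zero]
    congr 1; push_cast; ring
  have : Complex.exp ((7*π/8 : ℝ) * I) * ((1 + (x:ℂ)) * ((((-x)^(-(5/8:ℝ)) : ℝ) : ℂ) * Complex.exp (π * I * ((-(5/8:ℝ) : ℝ) : ℂ))) *
      ((((-(x-1))^(-(1/4:ℝ)) : ℝ) : ℂ) * Complex.exp (π * I * ((-(1/4:ℝ) : ℝ) : ℂ))) * (kk x : ℂ)^3)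
      = (((1+x) * (-x)^(-(5/8:ℝ)) * (-(x-1))^(-(1/4:ℝ)) * kk x^3 : ℝ) : ℂ) := by
    rw [Complex.ofReal_mul, Complex.ofReal_mul, Complex.ofReal_mul, Complex.ofReal_add, Complex.ofReal_one, Complex.ofReal_pow]
    linear_combination ((1 + (x:ℂ)) * (((-x)^(-(5/8:ℝ)) : ℝ) : ℂ) * (((-(x-1))^(-(1/4:ℝ)) : ℝ) : ℂ) * (kk x : ℂ)^3) * e
  rw [this, Complex.ofReal_im]

lemma gg_mid {x : ℝ} (hx : x ∈ Set.Ioo (0:ℝ) 1) : (EE * gg x).im = Real.cos (π/8) * (ww x * kk x^3 * kk (1-x)^0) := by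
  have h2 := npw (a := x - 1) (by linarith [hx.2]) (-(1/4:ℝ))
  rw [Complex.ofReal_sub, Complex.ofReal_one] at h2
  rw [gg, KC_lt hx.2, ppw hx.1.le, h2, EE]
  have e : Complex.exp ((7*π/8 : ℝ) * I) * Complex.exp (π * I * ((-(1/4:ℝ) : ℝ) : ℂ)) = Complex.exp ((5*π/8 : ℝ) * I) := by
    rw [← Complex.exp_add]
    congr 1; push_cast; ring
  have : Complex.exp ((7*π/8 : ℝ) * I) * ((1 + (x:ℂ)) * (((x)^(-(5/8:ℝ)) : ℝ) : ℂ)  *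
      ((((-(x-1))^(-(1/4:ℝ)) : ℝ) : ℂ) * Complex.exp (π * I * ((-(1/4:ℝ) : ℝ) : ℂ))) * (kk x : ℂ)^3)
      = ((ww x * kk x^3 : ℝ) : ℂ) * Complex.exp ((5*π/8 : ℝ) * I) := by
    rw [ww, show -(x-1) = 1 - x by ring, Complex.ofReal_mul, Complex.ofReal_mul, Complex.ofReal_mul, Complex.ofReal_add, Complex.ofReal_one, Complex.ofReal_pow]
    linear_combination ((1 + (x:ℂ)) * (((x)^(-(5/8:ℝ)) : ℝ) : ℂ) * (((1-x)^(-(1/4:ℝ)) : ℝ) : ℂ) * (kk x : ℂ)^3) * e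
  rw [this, Complex.im_ofReal_mul, Complex.exp_ofReal_mul_I_im]
  have : Real.sin (5*π/8) = Real.cos (π/8) := by
    rw [← Real.cos_pi_div_two_sub, ← Real.cos_neg]; congr 1; ring
  rw [this]; ring

lemma gg_big {x : ℝ} (hx : 1 < x) : (EE * gg x).im = (1+x) * x^(-(5/8:ℝ)) * (x-1)^(-(1/4:ℝ)) * x^(-(3/2:ℝ)) *
    (Real.sin (π/8) * (kk (1/x)^3 - 3 * kk (1/x) * kk (1-1/x)^2) - Real.cos (π/8) * (3 * kk (1/x)^2 * kk (1-1/x) - kk (1-1/x)^3)) := by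
  have hx0 : 0 < x := by linarith
  have h2 := ppw (a := x - 1) (by linarith) (-(1/4:ℝ))
  rw [Complex.ofReal_sub, Complex.ofReal_one] at h2
  rw [gg, KC_gt hx, ppw hx0.le, h2, EE]
  have e : x^(-(3/2:ℝ)) = (x^(-(1/2:ℝ)))^3 := by
    rw [← Real.rpow_natCast, ← Real.rpow_mul hx0.le]; norm_num
  rw [e]
  generalize x^(-(1/2:ℝ)) = r
  generalize kk (1/x) = a
  generalize kk (1-1/x) = b
  have : Complex.exp ((7*π/8 : ℝ) * I) * ((1 + (x:ℂ)) * (((x)^(-(5/8:ℝ)) : ℝ) : ℂ)  *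
      (((x-1)^(-(1/4:ℝ)) : ℝ) : ℂ) * ((r:ℂ) * ((a:ℂ) + I * b))^3) 
      = (((1+x) * x^(-(5/8:ℝ)) * (x-1)^(-(1/4:ℝ)) * r^3 : ℝ) : ℂ) * (Complex.exp ((7*π/8 : ℝ) * I) * (((a^3 - 3*a*b^2 : ℝ) : ℂ) + ((3*a^2*b - b^3 : ℝ) : ℂ) * I)) := by
    generalize Complex.exp ((7*π/8 : ℝ) * I) = X
    generalize x^(-(5/8:ℝ)) = p
    generalize (x-1)^(-(1/4:ℝ)) = q
    push_cast
    linear_combination (X * ((1 + (x:ℂ)) * p * q * r^3 * (3 * a * b^2 + b^3 * I))) * Complex.I_sq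
  rw [this, Complex.im_ofReal_mul, Complex.mul_im, Complex.exp_ofReal_mul_I_im, Complex.exp_ofReal_mul_I_re]
  have c1 : Real.sin (7*π/8) = Real.sin (π/8) := by
    rw [← Real.sin_pi_sub]; congr 1; ring
  have c2 : Real.cos (7*π/8) = -Real.cos (π/8) := by
    rw [← Real.cos_pi_sub]; congr 1; ring
  rw [c1, c2]
  simp only [Complex.add_re, Complex.add_im, Complex.ofReal_re, Complex.ofReal_im, Complex.mul_re, Complex.mul_im, Complex.I_re, Complex.I_im]
  ring

lemma nn_int {i j : ℕ} (hi : i ≤ 3) (hj : j ≤ 3) : IntegrableOn (fun m => ww m * kk m^i * kk (1-m)^j) (Set.Ioo 0 1) := by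
  obtain ⟨C, hC, hk⟩ := kk_bd
  have hb := (int_beta (a := 1/8) (b := 1/2) (by norm_num) (by norm_num)).const_mul (2 * C^i * C^j)
  have hm := kk_meas
  refine Integrable.mono' hb (Measurable.aestronglyMeasurable (by unfold ww; fun_prop)) ?_
  refine (ae_restrict_iff' measurableSet_Ioo).2 (Filter.Eventually.of_forall fun m hm => ?_)
  have h0 := hm.1
  have h1 : 0 < 1 - m := by linarith [hm.2]
  have k1 := kk_nonneg hm.2
  have k2 := kk_nonneg (m := 1 - m) (by linarith)
  have b1 := hk m hm
  have b2 := hk (1-m) ⟨h1, by linarith⟩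
  rw [show 1-(1-m) = m by ring] at b2
  have hw : 0 ≤ ww m := by unfold ww; positivity
  rw [Real.norm_of_nonneg (by positivity)]
  have p : ∀ y : ℝ, 0 < y → y < 1 → ∀ i : ℕ, i ≤ 3 → (y^(-(1/12:ℝ)))^i ≤ y^(-(1/4:ℝ)) := by
    intro y hy hy1 i hi
    rw [← Real.rpow_natCast, ← Real.rpow_mul hy.le]
    refine Real.rpow_le_rpow_of_exponent_ge hy hy1.le ?_
    have : (i:ℝ) ≤ 3 := by exact_mod_cast hi
    linarith
  calc ww m * kk m^i * kk (1-m)^j ≤ ww m * (C * (1-m)^(-(1/12:ℝ)))^i * (C * m^(-(1/12:ℝ)))^j := by gcongr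
    _ = ww m * C^i * C^j * ((1-m)^(-(1/12:ℝ)))^i * (m^(-(1/12:ℝ)))^j := by ring
    _ ≤ (2 * m^(-(5/8:ℝ)) * (1-m)^(-(1/4:ℝ))) * C^i * C^j * (1-m)^(-(1/4:ℝ)) * m^(-(1/4:ℝ)) := by
      have q1 := p m h0 hm.2 j hj
      have q2 := p (1-m) h1 (by linarith) i hi
      have q3 : ww m ≤ 2 * m^(-(5/8:ℝ)) * (1-m)^(-(1/4:ℝ)) := by
        unfold ww; gcongr; linarith [hm.2]
      gcongr
    _ = 2 * C^i * C^j * ((m^(-(5/8:ℝ)) * m^(-(1/4:ℝ))) * ((1-m)^(-(1/4:ℝ)) * (1-m)^(-(1/4:ℝ)))) := by ring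
    _ = _ := by rw [← Real.rpow_add h0, ← Real.rpow_add h1]; norm_num

lemma nn_rel : Real.cos (π/8) * nn 3 0 + Real.sin (π/8) * (nn 3 0 - 3 * nn 1 2) - Real.cos (π/8) * (3 * nn 2 1 - nn 0 3) = 0 := by
  obtain ⟨hI, h0⟩ := gg_int0
  have hE : Integrable (fun x : ℝ => EE * gg x) := hI.const_mul EE
  have hh : Integrable (fun x : ℝ => (EE * gg x).im) := hE.im
  have hz : ∫ x : ℝ, (EE * gg x).im = 0 := by
    have := integral_im hE
    rw [MeasureTheory.integral_const_mul, h0, mul_zero] at this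
    simpa using this
  rw [← integral_Iic_add_Ioi (b := 0) hh.integrableOn hh.integrableOn, integral_Iic_eq_integral_Iio,
    setIntegral_congr_fun measurableSet_Iio (g := fun _ => (0:ℝ)) (fun x hx => gg_neg hx), integral_zero, zero_add,
    ← Set.Ioc_union_Ioi_eq_Ioi (zero_le_one' ℝ),
    setIntegral_union (Set.Ioc_disjoint_Ioi le_rfl) measurableSet_Ioi hh.integrableOn hh.integrableOn,
    integral_Ioc_eq_integral_Ioo] at hz
  have e1 : ∫ x in Set.Ioo (0:ℝ) 1, (EE * gg x).im = Real.cos (π/8) * nn 3 0 := by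
    rw [nn, ← MeasureTheory.integral_const_mul]
    exact setIntegral_congr_fun measurableSet_Ioo fun x hx => gg_mid hx
  have e2 : ∫ x in Set.Ioi (1:ℝ), (EE * gg x).im = Real.sin (π/8) * (nn 3 0 - 3 * nn 1 2) - Real.cos (π/8) * (3 * nn 2 1 - nn 0 3) := by
    have h := cov_a (s := Set.Ioo (0:ℝ) 1) (t := Set.Ioi (1:ℝ)) measurableSet_Ioo
      (f := fun m => m⁻¹) (f' := fun m => (m^2)⁻¹) (g := fun x => x⁻¹)
      (fun m hm => hasDerivAt_inv hm.1.ne') (fun m hm => by positivity)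
      (fun m hm => (one_lt_inv₀ hm.1).2 hm.2)
      (fun x hx => ⟨inv_pos.2 (lt_trans one_pos hx), inv_lt_one_of_one_lt₀ hx⟩)
      (fun m hm => inv_inv m) (fun m hm => inv_inv m)
      (fun x : ℝ => (EE * gg x).im)
    rw [h]
    have h3 : ∀ m ∈ Set.Ioo (0:ℝ) 1, (m^2)⁻¹ * (EE * gg ((m⁻¹ : ℝ) : ℂ)).im = 
        (Real.sin (π/8) * (ww m * kk m^3 * kk (1-m)^0 - 3 * (ww m * kk m^1 * kk (1-m)^2)) - Real.cos (π/8) * (3 * (ww m * kk m^2 * kk (1-m)^1) - ww m * kk m^0 * kk (1-m)^3)) := by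
      intro m hm
      have hm0 := hm.1
      have h1 : 0 < 1 - m := by linarith [hm.2]
      rw [gg_big ((one_lt_inv₀ hm.1).2 hm.2), one_div m⁻¹, inv_inv]
      have : (m^2)⁻¹ * ((1+m⁻¹) * m⁻¹^(-(5/8:ℝ)) * (m⁻¹-1)^(-(1/4:ℝ)) * m⁻¹^(-(3/2:ℝ))) = ww m := by
        rw [show m⁻¹ - 1 = (1-m) * m⁻¹ by field_simp, show 1 + m⁻¹ = (1+m) * m⁻¹ by field_simp; ring, Real.mul_rpow h1.le (by positivity),
          ← Real.rpow_neg_eq_inv_rpow, ← Real.rpow_neg_eq_inv_rpow, ← Real.rpow_neg_eq_inv_rpow]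
        have : (m^2)⁻¹ = m^(-2:ℝ) := by rw [Real.rpow_neg hm0.le]; norm_cast
        rw [this, ← Real.rpow_neg_one m, ww]
        have : m^(-(5/8:ℝ)) = m^(-2:ℝ) * m^(-1:ℝ) * m^(- -(5/8:ℝ)) * m^(- -(1/4:ℝ)) * m^(- -(3/2:ℝ)) := by
          rw [← Real.rpow_add hm0, ← Real.rpow_add hm0, ← Real.rpow_add hm0, ← Real.rpow_add hm0]; norm_num
        rw [this]; ring
      rw [← this]; ring
    rw [setIntegral_congr_fun measurableSet_Ioo h3]
    have i30 := nn_int (i := 3) (j := 0) (by norm_num) (by norm_num)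
    have i12 := nn_int (i := 1) (j := 2) (by norm_num) (by norm_num)
    have i21 := nn_int (i := 2) (j := 1) (by norm_num) (by norm_num)
    have i03 := nn_int (i := 0) (j := 3) (by norm_num) (by norm_num)
    have J1 := i30.sub (i12.const_mul 3)
    have J2 := (i21.const_mul 3).sub i03
    have k1 := MeasureTheory.integral_sub (J1.const_mul (Real.sin (π/8))) (J2.const_mul (Real.cos (π/8)))
    have k2 := MeasureTheory.integral_sub i30 (i12.const_mul 3)
    have k3 := MeasureTheory.integral_sub (i21.const_mul 3) i03
    simp only [Pi.sub_apply] at k1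
    refine k1.trans ?_
    rw [MeasureTheory.integral_const_mul, MeasureTheory.integral_const_mul, k2, k3, MeasureTheory.integral_const_mul, MeasureTheory.integral_const_mul]
    rfl
  rw [e1, e2] at hz
  linarith

lemma nn_mm {i j : ℕ} (h : i + j = 3) : nn i j = 16 * mm i j := by
  have h := cov_i (s := Set.Ioo (0:ℝ) 1) (t := Set.Ioo (0:ℝ) 1) measurableSet_Ioo
    (f := fun k => k^2) (f' := fun k => 2*k) (g := fun x => √x)
    (fun k hk => hda (hasDerivAt_pow 2 k) (fun y => rfl) (by simp)) (fun m hm => by have := hm.1; positivity)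
    (fun m hm => ⟨by have := hm.1; positivity, by nlinarith [hm.1, hm.2]⟩)
    (fun x hx => ⟨Real.sqrt_pos.2 hx.1, by rw [Real.sqrt_lt' one_pos]; linarith [hx.2]⟩)
    (fun m hm => Real.sqrt_sq hm.1.le) (fun m hm => Real.sq_sqrt hm.1.le)
    (fun m => ww m * kk m^i * kk (1-m)^j)
  rw [nn, h, mm, ← MeasureTheory.integral_const_mul]
  refine setIntegral_congr_fun measurableSet_Ioo fun k hk => ?_
  have h0 := hk.1
  have h1 : 0 < 1 - k^2 := by nlinarith [hk.1, hk.2]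
  have e1 : kk (1-k^2) = 2 * eK' k := by
    have := kk_K (k := √(1-k^2)) ⟨Real.sqrt_pos.2 h1, by rw [Real.sqrt_lt' one_pos]; nlinarith⟩
    rwa [Real.sq_sqrt h1.le] at this
  have e2 : 2 * k * ww (k^2) = 2 * om k := by
    rw [ww, om, Real.mul_rpow h0.le h1.le, ← Real.rpow_natCast k 2, ← Real.rpow_mul h0.le]
    have : k^(-(1/4:ℝ)) = k^(1:ℝ) * k^(((2:ℕ):ℝ) * (-(5/8:ℝ))) := by rw [← Real.rpow_add h0]; norm_num
    rw [this, Real.rpow_one]; ring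
  have e3 : (2:ℝ)^i * 2^j = 8 := by rw [← pow_add, ‹i + j = 3›]; norm_num
  rw [kk_K hk, e1, mul_pow, mul_pow]
  linear_combination (2^i * 2^j * ellipticK k^i * eK' k^j) * e2 + 2 * om k * ellipticK k^i * eK' k^j * e3

lemma tan8 : Real.sin (π/8) = (√2 - 1) * Real.cos (π/8) := by
  have hc : Real.cos (π/8) ≠ 0 := (Real.cos_pos_of_mem_Ioo ⟨by linarith [Real.pi_pos], by linarith [Real.pi_pos]⟩).ne'
  have h1 := Real.sin_two_mul (π/8)
  have h2 := Real.cos_two_mul (π/8)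
  rw [show 2*(π/8) = π/4 by ring, Real.sin_pi_div_four] at h1
  rw [show 2*(π/8) = π/4 by ring, Real.cos_pi_div_four] at h2
  have h3 : √2^2 = 2 := Real.sq_sqrt (by norm_num)
  apply mul_right_cancel₀ hc
  linear_combination -(1/2) * h1 + (√2-1)/2 * h2 - 1/4 * h3 

lemma mm_rel : √2 * mm 3 0 = (3 - √2) * mm 2 1 := by
  have h := nn_rel
  rw [nn_mm (i := 3) (j := 0) rfl, nn_mm (i := 1) (j := 2) rfl, nn_mm (i := 2) (j := 1) rfl, nn_mm (i := 0) (j := 3) rfl,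
    mm_symm (i := 0) (j := 3) rfl, mm_symm (i := 1) (j := 2) rfl, tan8] at h
  have hc : Real.cos (π/8) ≠ 0 := (Real.cos_pos_of_mem_Ioo ⟨by linarith [Real.pi_pos], by linarith [Real.pi_pos]⟩).ne'
  have h3 : √2^2 = 2 := Real.sq_sqrt (by norm_num)
  apply mul_left_cancel₀ hc
  linear_combination 1/48 * h + Real.cos (π/8) * mm 2 1 * h3


theorem stmt17 :
    (∫ t in (0:ℝ)..1, (2 - t) * (ellipticK (Real.sqrt t)) ^ 3 /
        (2 * (1 - t) ^ ((5:ℝ)/8) * t ^ ((1:ℝ)/4)))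
      = Real.sqrt (1 + Real.sqrt 2) * (1 + 2 * Real.sqrt 2) * Real.Gamma (1/8) ^ 8 /
        (8 * (2:ℝ) ^ ((5:ℝ)/2) * (2 + Real.sqrt 2) ^ 4 * Real.Gamma (1/4) ^ 4) := by
  rw [I_eq]
  have hmm := mm_rel
  rw [mm_Y] at hmm
  have g1 := Real.Gamma_mul_Gamma_add_half (1/8)
  have g2 := Real.Gamma_mul_Gamma_one_sub (3/8)
  have g3 := Real.Gamma_mul_Gamma_one_sub (1/4)
  norm_num at g1 g2 g3
  have hs : Real.sin (π * (3/8)) = √(2+√2)/2 := by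
    rw [← Real.cos_pi_div_eight, ← Real.cos_pi_div_two_sub]; congr 1; ring
  have hs4 : Real.sin (π * (1/4)) = √2/2 := by rw [← Real.sin_pi_div_four]; congr 1; ring
  have a0 : 0 < Real.Gamma (1/8) := Real.Gamma_pos_of_pos (by norm_num)
  have b0 : 0 < Real.Gamma (1/4) := Real.Gamma_pos_of_pos (by norm_num)
  have d0 : 0 < Real.Gamma (5/8) := Real.Gamma_pos_of_pos (by norm_num)
  have e0 : 0 < Real.Gamma (3/8) := Real.Gamma_pos_of_pos (by norm_num)
  have f0 : 0 < Real.Gamma (3/4) := Real.Gamma_pos_of_pos (by norm_num)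
  have hp : √π^2 = π := Real.sq_sqrt Real.pi_pos.le
  have hp0 : 0 < √π := Real.sqrt_pos.2 Real.pi_pos
  obtain ⟨r, hr⟩ : ∃ r : ℝ, r = 2^(1/4:ℝ) := ⟨_, rfl⟩
  have r0 : 0 < r := by rw [hr]; positivity
  have rp : ∀ n : ℕ, r^n = 2^((n:ℝ)/4) := fun n => by
    rw [hr, ← Real.rpow_natCast, ← Real.rpow_mul (by norm_num)]; congr 1; ring
  have r2 : √2 = r^2 := by rw [rp, Real.sqrt_eq_rpow]; norm_num
  have r4 : r^4 = 2 := by rw [rp]; norm_num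
  have r3 : (2:ℝ)^(3/4:ℝ) = r^3 := by rw [rp]; norm_num
  have r10 : (2:ℝ)^(5/2:ℝ) = r^10 := by rw [rp]; norm_num
  have r17 : (2:ℝ)^(17/4:ℝ) = r^17 := by rw [rp]; norm_num
  obtain ⟨q, hq⟩ : ∃ q : ℝ, q = √(1+√2) := ⟨_, rfl⟩
  have q0 : 0 < q := by rw [hq]; positivity
  have q2 : q^2 = 1 + r^2 := by rw [hq, Real.sq_sqrt (by positivity), r2]
  have hrq : √(2+√2) = r * q := by
    rw [show 2+√2 = (r*q)^2 by rw [mul_pow, q2, r2]; linear_combination -r4, Real.sqrt_sq (by positivity)]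
  rw [← hq, r10]
  rw [hs, hrq] at g2
  rw [hs4, r2] at g3
  rw [r3] at g1
  rw [r17] at hmm
  rw [r2] at hmm ⊢
  generalize Real.Gamma (1/8) = a at *
  generalize Real.Gamma (1/4) = b at *
  generalize Real.Gamma (5/8) = d at *
  generalize Real.Gamma (3/8) = e at *
  generalize Real.Gamma (3/4) = f at *
  have pp0 := Real.pi_pos
  have ha : a = r^3 * √π * b / d := by
    rw [eq_div_iff d0.ne', g1]; ring
  have he : e = 2 * π / (r * q * d) := by
    rw [eq_div_iff (by positivity)]
    rw [eq_div_iff (by positivity)] at g2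
    linear_combination 2 * g2
  have hf : f = 2 * π / (r^2 * b) := by
    rw [eq_div_iff (by positivity)]
    rw [eq_div_iff (by positivity)] at g3
    linear_combination 2 * g3
  have hp8 : √π^8 = π^4 := by rw [show √π^8 = (√π^2)^4 by ring, hp]
  have h1 : 2 * r^2 * mm 3 0 = 4 * (3 - r^2) * π^4 * b^4 / (r^14 * q^5 * d^8) := by
    rw [mul_assoc, hmm, he, hf]
    field_simp
    ring
  have h2 : q * (1 + 2 * r^2) * a^8 / (8 * r^10 * (2 + r^2)^4 * b^4)
      = q * (1 + 2 * r^2) * r^14 * π^4 * b^4 / (8 * (2 + r^2)^4 * d^8) := by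
    rw [ha, div_pow, mul_pow, mul_pow, hp8]
    field_simp
  rw [h1, h2, div_eq_div_iff (by positivity) (by positivity)]
  have q6 : q^6 = (1+r^2)^3 := by rw [← q2]; ring
  have r28 : r^28 = 128 := by
    rw [show r^28 = (r^4)^7 by ring, r4]; norm_num
  have key : 4 * (3 - r^2) * (8 * (2+r^2)^4) = (1+2*r^2) * (1+r^2)^3 * 128 := by
    have e1 : 2 + r^2 = r^2 * (1+r^2) := by linear_combination -r4
    have e2 : (3 - r^2) * (1+r^2) = 1 + 2*r^2 := by linear_combination -r4
    have e3 : (r^2)^4 = 4 := by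
      rw [show (r^2)^4 = (r^4)^2 by ring, r4]; norm_num
    rw [e1, mul_pow, e3, ← e2]; ring
  calc _ = (4 * (3 - r^2) * (8 * (2+r^2)^4)) * (π^4 * b^4 * d^8) := by ring
    _ = ((1+2*r^2) * q^6 * r^28) * (π^4 * b^4 * d^8) := by rw [key, q6, r28]
    _ = _ := by ring
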